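/- arXiv:1508.02335 — 3 statements merged into one kernel-verified Lean document; each statement's English description precedes it below -/
import Mathlib

section
/- Let Q ≥ 2 be an integer and Σ₁, Σ₂ finite alphabets. There is an assignment, Borel measurable and equivariant in the sense that (Sx, SI) is sent to Sw, which associates to every regular aperiodic point x = (y, z) ∈ (Σ₁ × Σ₂)^ℤ such that z is aperiodic and h(x|z) < log₂ Q, and to every I ⊆ ℤ with s̲*(I) > h(x|z)/log₂ Q, an element w = w(x, I) ∈ {1, …, Q}^I, such that (the word-frequency function of x, z, w) determines x: if x = (y, z) and x' = (y', z) are two such points with s(x, a) = s(x', a) for every finite word a over Σ₁ × Σ₂, and w(x, I) = w(x', I') as partial functions on ℤ, then x = x'. -/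
open Filter
open scoped Classical

/-- Discrete measurable structure on the (countable) set of partial values `Option (Fin Q)`. -/
instance optionFinMeasurableSpace (Q : ℕ) : MeasurableSpace (Option (Fin Q)) := ⊤

/-- The shift on `Λ^ℤ`. -/
def shift {Λ : Type*} (x : ℤ → Λ) : ℤ → Λ := fun i => x (i + 1)

/-- The shift on subsets of `ℤ`: `SI = I − 1 = {i : i + 1 ∈ I}`. -/
def shiftSet (I : Set ℤ) : Set ℤ := {i | i + 1 ∈ I}

/-- A point of `Λ^ℤ` is aperiodic if no shift `S^p`, `p ≥ 1`, fixes it. -/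
def Aperiodic {Λ : Type*} (x : ℤ → Λ) : Prop :=
  ∀ p : ℕ, 1 ≤ p → (fun i => x (i + (p : ℤ))) ≠ x

/-- The word `w ∈ Λ^k` occurs in `x ∈ Λ^ℤ` at position `i`. -/
def OccursAtW {Λ : Type*} {k : ℕ} (x : ℤ → Λ) (w : Fin k → Λ) (i : ℤ) : Prop :=
  ∀ j : Fin k, x (i + ((j : ℕ) : ℤ)) = w j

/-- `(1/N) · #{0 ≤ i < N : w occurs in x at i}`. -/
noncomputable def wordFreqW {Λ : Type*} {k : ℕ} (x : ℤ → Λ) (w : Fin k → Λ) (N : ℕ) : ℝ :=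
  (∑ i ∈ Finset.range N, if OccursAtW x w (i : ℤ) then (1 : ℝ) else 0) / N

/-- `x ∈ Λ^ℤ` is regular if `s(x,w)` exists for every finite word `w`. -/
def RegularW {Λ : Type*} (x : ℤ → Λ) : Prop :=
  ∀ (k : ℕ) (w : Fin k → Λ), ∃ L : ℝ, Tendsto (wordFreqW x w) atTop (nhds L)

/-- The frequency `s(x,w) = P_{x^{(k)}}(w)` of a word `w ∈ Λ^k` in `x` (the limit of the
finite window frequencies, when it exists). -/
noncomputable def blockDist {Λ : Type*} {k : ℕ} (x : ℤ → Λ) (w : Fin k → Λ) : ℝ :=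
  limUnder atTop (wordFreqW x w)

/-- `H(P_{x^{(k)}}) = −∑_{w∈Λ^k} s(x,w)·log₂ s(x,w)`. -/
noncomputable def blockEntropy {Λ : Type*} [Fintype Λ] (x : ℤ → Λ) (k : ℕ) : ℝ :=
  -∑ w : Fin k → Λ, blockDist x w * Real.logb 2 (blockDist x w)

/-- The empirical entropy `h(x) = lim_{k→∞} (1/k)·H(P_{x^{(k)}})`. -/
noncomputable def empEntropy {Λ : Type*} [Fintype Λ] (x : ℤ → Λ) : ℝ :=
  limUnder atTop (fun k : ℕ => blockEntropy x k / k)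

/-- The relative empirical entropy `h(x|z) = h(x) − h(z)` of `x = (y,z)` over its second
component `z`. -/
noncomputable def relEntropy {Λ₁ Λ₂ : Type*} [Fintype Λ₁] [Fintype Λ₂]
    (x : ℤ → Λ₁ × Λ₂) : ℝ :=
  empEntropy x - empEntropy (fun i => (x i).2)

/-- The lower uniform density of a set `I ⊆ ℤ`:
`liminf_{N→∞} inf_{n∈ℤ} (1/N)·|I ∩ [n, n+N−1]|`. -/
noncomputable def lowerUniformDensity (I : Set ℤ) : ℝ :=
  liminf (fun N : ℕ =>
    ⨅ n : ℤ, (∑ i ∈ Finset.range N, if n + (i : ℤ) ∈ I then (1 : ℝ) else 0) / N) atTop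

/-! ### Last-in-first-out matching of tokens to slots -/

/-- The number of slots (counted by `s`) in `[m, m+n]` minus the number of tokens (counted by `d`)
in `(m, m+n]`. -/
def balance (s d : ℤ → ℕ) (m : ℤ) (n : ℕ) : ℤ :=
  ∑ i ∈ Finset.range (n + 1), (s (m + i) : ℤ) - ∑ i ∈ Finset.range n, (d (m + 1 + i) : ℤ)

/-- In the last-in-first-out matching, the `t`-th token at `m` is sent to the slot `m + n`. -/
def SentTo (s d : ℤ → ℕ) (m : ℤ) (t n : ℕ) : Prop :=
  (t : ℤ) + 1 ≤ balance s d m n ∧ ∀ n' < n, balance s d m n' ≤ t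

lemma balance_succ (s d : ℤ → ℕ) (m : ℤ) (n : ℕ) :
    balance s d m (n + 1) = balance s d m n + s (m + (n + 1 : ℕ)) - d (m + (n + 1 : ℕ)) := by
  have h : m + 1 + (n : ℤ) = m + (n + 1 : ℕ) := by push_cast; ring
  simp only [balance]
  rw [Finset.sum_range_succ _ (n + 1), Finset.sum_range_succ (fun i : ℕ => (d (m + 1 + i) : ℤ)) n, h]
  ring

lemma balance_split (s d : ℤ → ℕ) (m : ℤ) (a n : ℕ) :
    balance s d m (a + 1 + n) =
      balance s d m a + balance s d (m + (a + 1 : ℕ)) n - d (m + (a + 1 : ℕ)) := by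
  induction n with
  | zero => rw [add_zero, balance_succ]; simp [balance]
  | succ n ih =>
    have h : m + ((a + 1 : ℕ) : ℤ) + ((n + 1 : ℕ) : ℤ) = m + ((a + 1 + n + 1 : ℕ) : ℤ) := by
      push_cast; ring
    rw [← add_assoc, balance_succ, ih, balance_succ, h]
    ring

lemma SentTo.exists_of_le {s d : ℤ → ℕ} {m : ℤ} {t n : ℕ} (h : (t : ℤ) + 1 ≤ balance s d m n) :
    ∃ n' ≤ n, SentTo s d m t n' := by
  have hex : ∃ n, (t : ℤ) + 1 ≤ balance s d m n := ⟨n, h⟩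
  refine ⟨Nat.find hex, Nat.find_le h, Nat.find_spec hex, fun n' hn' => ?_⟩
  have := Nat.find_min hex hn'
  omega

lemma SentTo.balance_eq {s d : ℤ → ℕ} (hs : ∀ i, s i ≤ 1) {m : ℤ} {t n : ℕ}
    (h : SentTo s d m t n) : balance s d m n = t + 1 ∧ s (m + n) = 1 := by
  obtain ⟨h1, h2⟩ := h
  cases n with
  | zero =>
    have := hs m
    simp [balance] at h1 ⊢
    omega
  | succ n =>
    have h3 := h2 n (Nat.lt_succ_self n)
    rw [balance_succ] at h1 ⊢
    have := hs (m + (n + 1 : ℕ))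
    omega

lemma SentTo.not_of_lt {s d : ℤ → ℕ} (hs : ∀ i, s i ≤ 1) {m : ℤ} {a t t' n : ℕ}
    (h : SentTo s d m t (a + 1 + n)) (h' : SentTo s d (m + (a + 1 : ℕ)) t' n) :
    d (m + (a + 1 : ℕ)) ≤ t' := by
  have h1 := h.1
  have h2 := h.2 a (by omega)
  have h3 := (h'.balance_eq hs).1
  rw [balance_split] at h1
  omega

/-- The last-in-first-out matching is injective. -/
lemma SentTo.injective {s d : ℤ → ℕ} (hs : ∀ i, s i ≤ 1) {m m' : ℤ} {t t' n n' : ℕ}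
    (ht : t < d m) (ht' : t' < d m') (h : SentTo s d m t n) (h' : SentTo s d m' t' n')
    (hj : m + n = m' + n') : m = m' ∧ t = t' := by
  rcases lt_trichotomy m m' with hlt | rfl | hlt
  · obtain ⟨a, rfl⟩ : ∃ a : ℕ, m' = m + (a + 1 : ℕ) := ⟨(m' - m - 1).toNat, by omega⟩
    obtain rfl : n = a + 1 + n' := by omega
    have := SentTo.not_of_lt hs h h'
    omega
  · obtain rfl : n = n' := by omega
    have h1 := (h.balance_eq hs).1
    have h2 := (h'.balance_eq hs).1
    exact ⟨rfl, by omega⟩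
  · obtain ⟨a, rfl⟩ : ∃ a : ℕ, m = m' + (a + 1 : ℕ) := ⟨(m - m' - 1).toNat, by omega⟩
    obtain rfl : n' = a + 1 + n := by omega
    have := SentTo.not_of_lt hs h' h
    omega

lemma balance_congr {s d d' : ℤ → ℕ} {m : ℤ} {n : ℕ}
    (h : ∀ i : ℕ, 0 < i → i ≤ n → d (m + i) = d' (m + i)) :
    balance s d m n = balance s d' m n := by
  unfold balance
  congr 1
  refine Finset.sum_congr rfl fun i hi => ?_
  have := h (i + 1) (by omega) (by simpa using hi)
  push_cast at this
  rw [add_assoc, add_comm 1 (i : ℤ), this]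

lemma SentTo.congr {s d d' : ℤ → ℕ} {m : ℤ} {t n : ℕ}
    (h : ∀ i : ℕ, 0 < i → i ≤ n → d (m + i) = d' (m + i)) (hS : SentTo s d m t n) :
    SentTo s d' m t n := by
  refine ⟨(balance_congr h) ▸ hS.1, fun n' hn' => ?_⟩
  rw [← balance_congr fun i hi hi' => h i hi (by omega)]
  exact hS.2 n' hn'

lemma balance_shift (s d : ℤ → ℕ) (m : ℤ) (n : ℕ) :
    balance (shift s) (shift d) m n = balance s d (m + 1) n := by
  simp only [balance, shift]
  congr 1 <;> refine Finset.sum_congr rfl fun i _ => ?_ <;> congr 2 <;> ring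

lemma sentTo_shift (s d : ℤ → ℕ) (m : ℤ) (t n : ℕ) :
    SentTo (shift s) (shift d) m t n ↔ SentTo s d (m + 1) t n := by
  simp only [SentTo, balance_shift]

/-! ### Markers in an aperiodic sequence -/

section Markers

variable {Λ : Type*}

/-- The finite pattern `F` occurs in `z` at `i`. -/
def PatternAt (F : Finset (ℤ × Λ)) (z : ℤ → Λ) (i : ℤ) : Prop :=
  ∀ p ∈ F, z (i + p.1) = p.2

/-- The pattern `F` occurs at `i`, but at no other position at distance less than `L`. -/
def IsolatedAt (L : ℕ) (F : Finset (ℤ × Λ)) (z : ℤ → Λ) (i : ℤ) : Prop :=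
  PatternAt F z i ∧ ∀ j : ℤ, j ≠ 0 → |j| < L → ¬ PatternAt F z (i + j)

/-- Greedy construction of an `L`-separated set, running through a list of patterns. -/
def markerStage (L : ℕ) (e : ℕ → Finset (ℤ × Λ)) (z : ℤ → Λ) : ℕ → Set ℤ
  | 0 => ∅
  | n + 1 => {i | i ∈ markerStage L e z n ∨
      (IsolatedAt L (e n) z i ∧ ∀ j : ℤ, |j| < L → i + j ∉ markerStage L e z n)}

/-- An enumeration of all finite patterns. -/
noncomputable def patternEnum (Λ : Type*) [Finite Λ] : ℕ → Finset (ℤ × Λ) :=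
  (exists_surjective_nat (Finset (ℤ × Λ))).choose

lemma patternEnum_surjective (Λ : Type*) [Finite Λ] : Function.Surjective (patternEnum Λ) :=
  (exists_surjective_nat (Finset (ℤ × Λ))).choose_spec

/-- A maximal `L`-separated set of positions, chosen equivariantly in `z`. -/
def markers [Finite Λ] (L : ℕ) (z : ℤ → Λ) : Set ℤ :=
  ⋃ n, markerStage L (patternEnum Λ) z n

lemma patternAt_shift (F : Finset (ℤ × Λ)) (z : ℤ → Λ) (i : ℤ) :
    PatternAt F (shift z) i ↔ PatternAt F z (i + 1) := by
  simp only [PatternAt, shift, add_right_comm]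

lemma isolatedAt_shift (L : ℕ) (F : Finset (ℤ × Λ)) (z : ℤ → Λ) (i : ℤ) :
    IsolatedAt L F (shift z) i ↔ IsolatedAt L F z (i + 1) := by
  simp only [IsolatedAt, patternAt_shift, add_right_comm]

lemma mem_markerStage_shift (L : ℕ) (e : ℕ → Finset (ℤ × Λ)) (z : ℤ → Λ) (n : ℕ) (i : ℤ) :
    i ∈ markerStage L e (shift z) n ↔ i + 1 ∈ markerStage L e z n := by
  induction n generalizing i with
  | zero => simp [markerStage]
  | succ n ih => simp only [markerStage, Set.mem_ofPred_eq, ih, isolatedAt_shift, add_right_comm]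

lemma mem_markers_shift [Finite Λ] (L : ℕ) (z : ℤ → Λ) (i : ℤ) :
    i ∈ markers L (shift z) ↔ i + 1 ∈ markers L z := by
  simp only [markers, Set.mem_iUnion, mem_markerStage_shift]

lemma markerStage_mono (L : ℕ) (e : ℕ → Finset (ℤ × Λ)) (z : ℤ → Λ) :
    Monotone (markerStage L e z) :=
  monotone_nat_of_le_succ fun _ _ h => Or.inl h

lemma markerStage_separated (L : ℕ) (e : ℕ → Finset (ℤ × Λ)) (z : ℤ → Λ) (n : ℕ) {i j : ℤ}
    (hi : i ∈ markerStage L e z n) (hj : i + j ∈ markerStage L e z n) (hj0 : j ≠ 0) :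
    (L : ℤ) ≤ |j| := by
  induction n generalizing i j with
  | zero => exact hi.elim
  | succ n ih =>
    by_contra! hlt
    rcases hi with hi | ⟨hi, hi'⟩ <;> rcases hj with hj | ⟨hj, hj'⟩
    · exact absurd (ih hi hj hj0) (not_le.2 hlt)
    · exact hj' (-j) (by rwa [abs_neg]) (by simpa using hi)
    · exact hi' j hlt hj
    · exact hi.2 j hj0 hlt hj.1

lemma markers_separated [Finite Λ] {L : ℕ} {z : ℤ → Λ} {i j : ℤ}
    (hi : i ∈ markers L z) (hj : i + j ∈ markers L z) (hj0 : j ≠ 0) : (L : ℤ) ≤ |j| := by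
  obtain ⟨a, ha⟩ := Set.mem_iUnion.1 hi
  obtain ⟨b, hb⟩ := Set.mem_iUnion.1 hj
  exact markerStage_separated L _ z (max a b) (markerStage_mono L _ z (le_max_left a b) ha)
    (markerStage_mono L _ z (le_max_right a b) hb) hj0

lemma Aperiodic.exists_ne {z : ℤ → Λ} (hz : Aperiodic z) (i : ℤ) {j : ℤ} (hj : j ≠ 0) :
    ∃ p, z (i + j + p) ≠ z (i + p) := by
  by_contra! h
  have h' : ∀ q, z (q + j) = z q := fun q => by
    have := h (q - i)
    rwa [show i + j + (q - i) = q + j by ring, show i + (q - i) = q by ring] at this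
  rcases lt_or_gt_of_ne hj with hneg | hpos
  · refine hz (-j).toNat (by omega) (funext fun q => ?_)
    have := h' (q + ((-j).toNat : ℤ))
    rw [show q + ((-j).toNat : ℤ) + j = q by omega] at this
    exact this.symm
  · refine hz j.toNat (by omega) (funext fun q => ?_)
    have := h' q
    rwa [show j = (j.toNat : ℤ) by omega] at this

lemma Aperiodic.exists_isolatedAt {z : ℤ → Λ} (hz : Aperiodic z) (L : ℕ) (i : ℤ) :
    ∃ F, IsolatedAt L F z i := by
  have h : ∀ j : ℤ, ∃ p, j ≠ 0 → z (i + j + p) ≠ z (i + p) := fun j => by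
    by_cases hj : j = 0
    · exact ⟨0, fun h => (h hj).elim⟩
    · obtain ⟨p, hp⟩ := hz.exists_ne i hj
      exact ⟨p, fun _ => hp⟩
  choose p hp using h
  refine ⟨(Finset.Ioo (-L : ℤ) L).image fun j => (p j, z (i + p j)), ?_, ?_⟩
  · intro q hq
    obtain ⟨j, -, rfl⟩ := Finset.mem_image.1 hq
    rfl
  · intro j hj hjL hP
    exact hp j hj (hP (p j, z (i + p j))
      (Finset.mem_image_of_mem _ (Finset.mem_Ioo.2 (abs_lt.1 hjL))))

lemma Aperiodic.exists_marker_near [Finite Λ] {z : ℤ → Λ} (hz : Aperiodic z) {L : ℕ} (hL : 0 < L)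
    (i : ℤ) : ∃ j : ℤ, |j| < L ∧ i + j ∈ markers L z := by
  obtain ⟨F, hF⟩ := hz.exists_isolatedAt L i
  obtain ⟨n, rfl⟩ := patternEnum_surjective Λ F
  by_cases h : ∃ j : ℤ, |j| < L ∧ i + j ∈ markerStage L (patternEnum Λ) z n
  · obtain ⟨j, hj, hm⟩ := h
    exact ⟨j, hj, Set.mem_iUnion.2 ⟨n, hm⟩⟩
  · push Not at h
    exact ⟨0, by simpa using hL, Set.mem_iUnion.2 ⟨n + 1, Or.inr (by simpa using ⟨hF, h⟩)⟩⟩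

/-- `[m, m + l)` is the interval between two consecutive elements of `M`. -/
def IsBlock (M : Set ℤ) (m : ℤ) (l : ℕ) : Prop :=
  m ∈ M ∧ m + l ∈ M ∧ 0 < l ∧ ∀ i : ℕ, 0 < i → i < l → m + i ∉ M

lemma IsBlock.unique {M : Set ℤ} {m : ℤ} {l l' : ℕ} (h : IsBlock M m l) (h' : IsBlock M m l') :
    l = l' := by
  rcases lt_trichotomy l l' with hlt | rfl | hlt
  · exact absurd h.2.1 (h'.2.2.2 l h.2.2.1 hlt)
  · rfl
  · exact absurd h'.2.1 (h.2.2.2 l' h'.2.2.1 hlt)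

lemma IsBlock.gap_le [Finite Λ] {L : ℕ} {z : ℤ → Λ} {m : ℤ} {l : ℕ}
    (h : IsBlock (markers L z) m l) : L ≤ l := by
  have := markers_separated h.1 h.2.1 (by have := h.2.2.1; omega)
  rw [Nat.abs_cast] at this
  exact_mod_cast this

lemma Aperiodic.exists_isBlock [Finite Λ] {z : ℤ → Λ} (hz : Aperiodic z) {L : ℕ} (hL : 0 < L)
    {m : ℤ} (hm : m ∈ markers L z) : ∃ l < 2 * L, IsBlock (markers L z) m l := by
  obtain ⟨j, hj, hjm⟩ := hz.exists_marker_near hL (m + L)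
  rw [abs_lt] at hj
  have hex : ∃ l : ℕ, 0 < l ∧ m + l ∈ markers L z :=
    ⟨(L + j).toNat, by omega, by
      rwa [show m + ((L + j).toNat : ℤ) = m + L + j by omega]⟩
  have hle : Nat.find hex ≤ (L + j).toNat := Nat.find_le ⟨by omega, by
      rwa [show m + ((L + j).toNat : ℤ) = m + L + j by omega]⟩
  refine ⟨Nat.find hex, by omega, hm, (Nat.find_spec hex).2, (Nat.find_spec hex).1, ?_⟩
  intro i hi hlt hmem
  exact Nat.find_min hex hlt ⟨hi, hmem⟩

lemma Aperiodic.exists_isBlock_mem [Finite Λ] {z : ℤ → Λ} (hz : Aperiodic z) {L : ℕ}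
    (hL : 0 < L) (i : ℤ) :
    ∃ (m : ℤ) (l j : ℕ), l < 2 * L ∧ IsBlock (markers L z) m l ∧ j < l ∧ m + j = i := by
  obtain ⟨j, hj, hjm⟩ := hz.exists_marker_near hL (i - L)
  rw [abs_lt] at hj
  have hex : ∃ n : ℕ, i - n ∈ markers L z :=
    ⟨(L - j).toNat, by rwa [show i - ((L - j).toNat : ℤ) = i - L + j by omega]⟩
  obtain ⟨l, hl, hb⟩ := hz.exists_isBlock hL (Nat.find_spec hex)
  refine ⟨_, l, Nat.find hex, hl, hb, ?_, by ring⟩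
  by_contra! hle
  refine Nat.find_min hex (m := Nat.find hex - l) (by have := hb.2.2.1; omega) ?_
  have := hb.2.1
  rwa [show i - ((Nat.find hex : ℕ) : ℤ) + l = i - ((Nat.find hex - l : ℕ) : ℤ) by omega] at this

lemma isBlock_markers_shift [Finite Λ] (L : ℕ) (z : ℤ → Λ) (m : ℤ) (l : ℕ) :
    IsBlock (markers L (shift z)) m l ↔ IsBlock (markers L z) (m + 1) l := by
  simp only [IsBlock, mem_markers_shift, add_right_comm]

variable [Finite Λ] [MeasurableSpace Λ] [DiscreteMeasurableSpace Λ]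

lemma measurable_patternAt (F : Finset (ℤ × Λ)) (i : ℤ) :
    Measurable fun z : ℤ → Λ => PatternAt F z i := by
  refine Measurable.forall fun p => Measurable.forall fun _ => ?_
  exact (Measurable.of_discrete (f := fun a : Λ => a = p.2)).comp (measurable_pi_apply (i + p.1))

lemma measurable_isolatedAt (L : ℕ) (F : Finset (ℤ × Λ)) (i : ℤ) :
    Measurable fun z : ℤ → Λ => IsolatedAt L F z i :=
  (measurable_patternAt F i).and <| Measurable.forall fun j => Measurable.forall fun _ =>
    Measurable.forall fun _ => (measurable_patternAt F (i + j)).not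

lemma measurable_mem_markerStage (L : ℕ) (e : ℕ → Finset (ℤ × Λ)) (n : ℕ) (i : ℤ) :
    Measurable fun z : ℤ → Λ => i ∈ markerStage L e z n := by
  induction n generalizing i with
  | zero => exact measurable_const
  | succ n ih =>
    exact (ih i).or <| (measurable_isolatedAt L (e n) i).and <|
      Measurable.forall fun j => Measurable.forall fun _ => (ih (i + j)).not

lemma measurable_mem_markers (L : ℕ) (i : ℤ) :
    Measurable fun z : ℤ → Λ => i ∈ markers L z := by
  simp only [markers, Set.mem_iUnion]
  exact Measurable.exists fun n => measurable_mem_markerStage L _ n i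

lemma measurable_isBlock_markers (L : ℕ) (m : ℤ) (l : ℕ) :
    Measurable fun z : ℤ → Λ => IsBlock (markers L z) m l :=
  (measurable_mem_markers L m).and <| (measurable_mem_markers L (m + l)).and <|
    measurable_const.and <| Measurable.forall fun i => Measurable.forall fun _ =>
      Measurable.forall fun _ => (measurable_mem_markers L (m + i)).not

end Markers

/-! ### Block codes built from weights on words -/

/-- The subword of length `k` of `u` starting at `i`. -/
def subword {Λ : Type*} {l k : ℕ} (u : Fin l → Λ) (i : Fin (l + 1 - k)) : Fin k → Λ :=
  fun j => u ⟨i + j, by omega⟩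

/-- The pair of words `(a, b)` as a word of pairs. -/
def zipWord {Γ₁ Γ₂ : Type*} {l : ℕ} (a : Fin l → Γ₁) (b : Fin l → Γ₂) : Fin l → Γ₁ × Γ₂ :=
  fun j => (a j, b j)

/-- The letters of `y` at distance less than `k` from one of the two ends. -/
def endLetters {Γ₁ : Type*} {l : ℕ} (k : ℕ) (y : Fin l → Γ₁) : Bool × Fin k → Option Γ₁ :=
  fun p => if h : (p.2 : ℕ) < l then
    some (y (if p.1 then ⟨l - 1 - p.2, by omega⟩ else ⟨p.2, h⟩)) else none

/-- A word is determined by its end letters and its subwords at positions congruent to `r`. -/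
lemma eq_of_endLetters_of_subword {Γ₁ : Type*} {l k r : ℕ} (hr : r < k) {y y' : Fin l → Γ₁}
    (hend : endLetters k y = endLetters k y')
    (hsub : ∀ i : Fin (l + 1 - k), (i : ℕ) % k = r → subword y i = subword y' i) : y = y' := by
  funext ⟨i, hi⟩
  by_cases h1 : i < k
  · have := congrFun hend (false, ⟨i, h1⟩)
    simpa [endLetters, hi] using this
  by_cases h2 : l - 1 - i < k
  · have := congrFun hend (true, ⟨l - 1 - i, h2⟩)
    have h3 : l - 1 - i < l := by omega
    have h4 : l - 1 - (l - 1 - i) = i := by omega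
    simpa [endLetters, h3, h4] using this
  · have hmod : (i - r) % k < k := Nat.mod_lt _ (by omega)
    have hle : (i - r) % k ≤ i - r := Nat.mod_le _ _
    have hres : (i - (i - r) % k) % k = r := by
      have h5 : i - (i - r) % k = r + k * ((i - r) / k) := by
        have := Nat.mod_add_div (i - r) k
        omega
      rw [h5, Nat.add_mul_mod_self_left, Nat.mod_eq_of_lt hr]
    have := congrFun (hsub ⟨i - (i - r) % k, by omega⟩ hres) ⟨(i - r) % k, hmod⟩
    simpa [subword, Nat.sub_add_cancel (show (i - r) % k ≤ i by omega)] using this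

section Kraft

variable {Γ₁ Γ₂ : Type*} [Fintype Γ₁]

/-- Kraft's inequality for the first component, conditionally on the second. -/
def KraftIneq (Q : ℕ) {k : ℕ} (f : (Fin k → Γ₁ × Γ₂) → ℕ) : Prop :=
  ∀ b : Fin k → Γ₂, ∑ a : Fin k → Γ₁, ((Q : ℝ)⁻¹) ^ f (zipWord a b) ≤ 1

lemma KraftIneq.sum_prod_le {Q k : ℕ} {f : (Fin k → Γ₁ × Γ₂) → ℕ} (hf : KraftIneq Q f)
    {l r : ℕ} (hr : r < k) (z : Fin l → Γ₂) :
    ∑ y : Fin l → Γ₁, ∏ i : {i : Fin (l + 1 - k) // (i : ℕ) % k = r},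
        ((Q : ℝ)⁻¹) ^ f (subword (zipWord y z) i) ≤
      Fintype.card (Bool × Fin k → Option Γ₁) := by
  let J := {i : Fin (l + 1 - k) // (i : ℕ) % k = r}
  let g : (J → Fin k → Γ₁) × (Bool × Fin k → Option Γ₁) → ℝ := fun p =>
    ∏ i : J, ((Q : ℝ)⁻¹) ^ f (zipWord (p.1 i) (subword z i.1))
  let Φ : (Fin l → Γ₁) → (J → Fin k → Γ₁) × (Bool × Fin k → Option Γ₁) := fun y =>
    (fun i => subword y i.1, endLetters k y)
  have hΦ : Function.Injective Φ := fun y y' h =>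
    eq_of_endLetters_of_subword hr (congrArg Prod.snd h)
      fun i hi => congrFun (congrArg Prod.fst h) ⟨i, hi⟩
  calc ∑ y : Fin l → Γ₁, ∏ i : J, ((Q : ℝ)⁻¹) ^ f (subword (zipWord y z) i.1)
      = ∑ p ∈ Finset.univ.image Φ, g p := by
        rw [Finset.sum_image fun _ _ _ _ h => hΦ h]
        rfl
    _ ≤ ∑ p, g p := Finset.sum_le_univ_sum_of_nonneg fun p =>
        Finset.prod_nonneg fun i _ => by positivity
    _ = Fintype.card (Bool × Fin k → Option Γ₁) *
          ∏ i : J, ∑ a : Fin k → Γ₁, ((Q : ℝ)⁻¹) ^ f (zipWord a (subword z i.1)) := by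
        rw [Finset.prod_univ_sum, Fintype.piFinset_univ, Fintype.sum_prod_type, Finset.mul_sum]
        refine Finset.sum_congr rfl fun A _ => ?_
        simp only [g, Finset.sum_const, nsmul_eq_mul, Finset.card_univ]
    _ ≤ Fintype.card (Bool × Fin k → Option Γ₁) * 1 := by
        refine mul_le_mul_of_nonneg_left ?_ (Nat.cast_nonneg _)
        exact Finset.prod_le_one (fun i _ => Finset.sum_nonneg fun a _ => by positivity)
          fun i _ => hf _
    _ = _ := mul_one _

lemma KraftIneq.card_le_of_residue {Q k : ℕ} (hQ : 0 < Q) {f : (Fin k → Γ₁ × Γ₂) → ℕ}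
    (hf : KraftIneq Q f) {l r : ℕ} (hr : r < k) (z : Fin l → Γ₂) (c : ℕ) :
    (Finset.univ.filter fun y : Fin l → Γ₁ =>
        ∑ i : {i : Fin (l + 1 - k) // (i : ℕ) % k = r}, f (subword (zipWord y z) i) ≤ c).card ≤
      Fintype.card (Bool × Fin k → Option Γ₁) * Q ^ c := by
  have hQ' : (0 : ℝ) < Q := by exact_mod_cast hQ
  have hQ1 : (Q : ℝ)⁻¹ ≤ 1 := inv_le_one_of_one_le₀ (by exact_mod_cast hQ)
  set Y := Finset.univ.filter fun y : Fin l → Γ₁ =>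
    ∑ i : {i : Fin (l + 1 - k) // (i : ℕ) % k = r}, f (subword (zipWord y z) i) ≤ c
  have h1 : (Y.card : ℝ) * ((Q : ℝ)⁻¹) ^ c ≤ Fintype.card (Bool × Fin k → Option Γ₁) := by
    refine le_trans ?_ (hf.sum_prod_le hr z)
    rw [← nsmul_eq_mul]
    refine le_trans (Finset.card_nsmul_le_sum Y (fun y => _) _ fun y hy => ?_)
      (Finset.sum_le_univ_sum_of_nonneg fun y => Finset.prod_nonneg fun i _ => by positivity)
    rw [Finset.prod_pow_eq_pow_sum]
    exact pow_le_pow_of_le_one (by positivity) hQ1 (Finset.mem_filter.1 hy).2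
  have h2 : (Y.card : ℝ) ≤ Fintype.card (Bool × Fin k → Option Γ₁) * (Q : ℝ) ^ c := by
    rwa [inv_pow, ← div_eq_mul_inv, div_le_iff₀ (by positivity)] at h1
  exact_mod_cast h2

/-- The number of words `y` for which the average weight of `(y, z)` has integer part `c`. -/
lemma KraftIneq.card_le {Q k : ℕ} (hQ : 0 < Q) (hk : 0 < k) {f : (Fin k → Γ₁ × Γ₂) → ℕ}
    (hf : KraftIneq Q f) {l : ℕ} (z : Fin l → Γ₂) (c : ℕ) :
    (Finset.univ.filter fun y : Fin l → Γ₁ =>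
        (∑ i : Fin (l + 1 - k), f (subword (zipWord y z) i)) / k = c).card ≤
      k * Fintype.card (Bool × Fin k → Option Γ₁) * Q ^ c := by
  have hsub : (Finset.univ.filter fun y : Fin l → Γ₁ =>
        (∑ i : Fin (l + 1 - k), f (subword (zipWord y z) i)) / k = c) ⊆
      (Finset.range k).biUnion fun r => Finset.univ.filter fun y : Fin l → Γ₁ =>
        ∑ i : {i : Fin (l + 1 - k) // (i : ℕ) % k = r}, f (subword (zipWord y z) i) ≤ c := by
    intro y hy
    have hy := (Finset.mem_filter.1 hy).2
    by_contra hcon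
    simp only [Finset.mem_biUnion, Finset.mem_range, Finset.mem_filter, Finset.mem_univ, true_and,
      not_exists, not_and, not_le] at hcon
    have h1 : ∑ i : Fin (l + 1 - k), f (subword (zipWord y z) i) =
        ∑ r ∈ Finset.range k, ∑ i : {i : Fin (l + 1 - k) // (i : ℕ) % k = r},
          f (subword (zipWord y z) i) := by
      rw [← Finset.sum_fiberwise_of_maps_to (t := Finset.range k)
        (g := fun i : Fin (l + 1 - k) => (i : ℕ) % k)
        (fun i _ => Finset.mem_range.2 (Nat.mod_lt _ hk))]
      refine Finset.sum_congr rfl fun r _ => ?_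
      exact Finset.sum_subtype _ (fun i => by simp) _
    have h2 : k * (c + 1) ≤ ∑ i : Fin (l + 1 - k), f (subword (zipWord y z) i) := by
      rw [h1]
      calc k * (c + 1) = ∑ r ∈ Finset.range k, (c + 1) := by simp
        _ ≤ _ := Finset.sum_le_sum fun r hr => hcon r (Finset.mem_range.1 hr)
    have h3 := (Nat.le_div_iff_mul_le hk).2 ((mul_comm _ _).trans_le h2)
    omega
  calc _ ≤ _ := Finset.card_le_card hsub
    _ ≤ ∑ r ∈ Finset.range k, Fintype.card (Bool × Fin k → Option Γ₁) * Q ^ c :=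
        Finset.card_biUnion_le.trans <| Finset.sum_le_sum fun r hr =>
          hf.card_le_of_residue hQ (Finset.mem_range.1 hr) z c
    _ = _ := by simp [mul_assoc]

end Kraft

/-- The discrete parameters of an encoding. -/
structure CodeParams (Γ : Type*) where
  /-- length of the words whose frequencies are used -/
  wordLen : ℕ
  /-- length of the codeword assigned to a word -/
  weight : (Fin wordLen → Γ) → ℕ
  /-- additional number of symbols used for each block -/
  overhead : ℕ
  /-- number of symbols used to transmit the length of the code of a block -/
  header : ℕ
  /-- minimal length of a block -/
  gap : ℕ

instance {Γ : Type*} [Finite Γ] : Countable (CodeParams Γ) := by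
  let φ : CodeParams Γ → (Σ k : ℕ, (Fin k → Γ) → ℕ) × ℕ × ℕ × ℕ := fun θ =>
    (⟨θ.wordLen, θ.weight⟩, θ.overhead, θ.header, θ.gap)
  refine Function.Injective.countable (f := φ) ?_
  rintro ⟨k, f, C, h, L⟩ ⟨k', f', C', h', L'⟩ heq
  simp only [φ, Prod.mk.injEq, Sigma.mk.injEq] at heq
  obtain ⟨⟨rfl, hf⟩, rfl, rfl, rfl⟩ := heq
  obtain rfl := eq_of_heq hf
  rfl

namespace CodeParams

section Word

variable {Γ : Type*} (θ : CodeParams Γ)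

/-- The length of the code of the word `u`. -/
def codeLength {l : ℕ} (u : Fin l → Γ) : ℕ :=
  (∑ i : Fin (l + 1 - θ.wordLen), θ.weight (subword u i)) / θ.wordLen + θ.overhead

/-- `θ` has the properties needed for block codes over the alphabet `Fin Q`. -/
structure Admissible {Γ₁ Γ₂ : Type*} [Fintype Γ₁] (Q : ℕ) (θ : CodeParams (Γ₁ × Γ₂)) :
    Prop where
  wordLen_pos : 0 < θ.wordLen
  gap_pos : 0 < θ.gap
  kraft : KraftIneq Q θ.weight
  card_le : θ.wordLen * Fintype.card (Bool × Fin θ.wordLen → Option Γ₁) ≤ Q ^ θ.overhead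
  codeLength_lt : ∀ l < 2 * θ.gap, ∀ u : Fin l → Γ₁ × Γ₂, θ.codeLength u < Q ^ θ.header

end Word

variable {Γ₁ Γ₂ : Type*} {Q : ℕ} [NeZero Q] (θ : CodeParams (Γ₁ × Γ₂))

/-- `code` is injective on words with a given second component and a given code length. -/
def IsBlockCode {l : ℕ} (code : (Fin l → Γ₁ × Γ₂) → ℕ → Fin Q) : Prop :=
  ∀ u u' : Fin l → Γ₁ × Γ₂, (∀ j, (u j).2 = (u' j).2) → θ.codeLength u = θ.codeLength u' →
    (∀ t < θ.codeLength u, code u t = code u' t) → u = u'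

lemma Admissible.exists_isBlockCode [Fintype Γ₁] {θ : CodeParams (Γ₁ × Γ₂)}
    (hθ : θ.Admissible Q) (l : ℕ) :
    ∃ code : (Fin l → Γ₁ × Γ₂) → ℕ → Fin Q, θ.IsBlockCode code := by
  have hemb : ∀ (z : Fin l → Γ₂) (n : ℕ),
      ∃ g : (Fin l → Γ₁) → (Fin n → Fin Q), Set.InjOn g {y | θ.codeLength (zipWord y z) = n} := by
    intro z n
    by_cases hn : θ.overhead ≤ n
    · have hcard : (Finset.univ.filter fun y : Fin l → Γ₁ =>
          θ.codeLength (zipWord y z) = n).card ≤ Fintype.card (Fin n → Fin Q) := by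
        have h1 := hθ.kraft.card_le (NeZero.pos Q) hθ.wordLen_pos z (n - θ.overhead)
        have h2 : Q ^ θ.overhead * Q ^ (n - θ.overhead) = Q ^ n := by
          rw [← pow_add, Nat.add_sub_cancel' hn]
        have h3 := h1.trans (Nat.mul_le_mul_right _ hθ.card_le)
        rw [h2] at h3
        simp only [Fintype.card_fun, Fintype.card_fin]
        refine (Finset.card_le_card fun y hy => ?_).trans h3
        have := (Finset.mem_filter.1 hy).2
        simp only [codeLength] at this
        exact Finset.mem_filter.2 ⟨Finset.mem_univ _, by omega⟩
      obtain ⟨e⟩ := Function.Embedding.nonempty_of_card_le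
        ((Fintype.card_coe _).trans_le hcard)
      refine ⟨fun y => if h : θ.codeLength (zipWord y z) = n then e ⟨y, by simpa using h⟩ else 0,
        fun y hy y' hy' h => ?_⟩
      replace hy : θ.codeLength (zipWord y z) = n := hy
      replace hy' : θ.codeLength (zipWord y' z) = n := hy'
      simp only [hy, hy', dif_pos] at h
      exact congrArg Subtype.val (e.injective h)
    · refine ⟨fun _ _ => 0, fun y hy => ?_⟩
      replace hy : θ.codeLength (zipWord y z) = n := hy
      exact absurd (hy ▸ Nat.le_add_left _ _) hn
  choose g hg using hemb
  refine ⟨fun u t => if h : t < θ.codeLength u then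
    g (fun j => (u j).2) (θ.codeLength u) (fun j => (u j).1) ⟨t, h⟩ else 0, ?_⟩
  intro u u' hz hlen hcode
  have hz' : (fun j => (u' j).2) = fun j => (u j).2 := funext fun j => (hz j).symm
  have hcongr : ∀ n n' (_ : n = n') (y : Fin l → Γ₁) (i : Fin n) (i' : Fin n') (_ : i.1 = i'.1),
      g (fun j => (u j).2) n y i = g (fun j => (u j).2) n' y i' := by
    rintro n _ rfl y i i' hi
    rw [Fin.ext hi]
  have h1 : (fun j => (u j).1) = fun j => (u' j).1 := by
    refine hg (fun j => (u j).2) (θ.codeLength u) rfl ?_ (funext fun ⟨t, ht⟩ => ?_)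
    · change θ.codeLength (zipWord _ (fun j => (u j).2)) = _
      rw [hlen, ← hz']
      rfl
    · have := hcode t ht
      beta_reduce at this
      rw [dif_pos ht, dif_pos (hlen ▸ ht)] at this
      rw [this]
      simp only [hz']
      exact hcongr _ _ hlen.symm _ _ _ rfl
  exact funext fun j => Prod.ext (congrFun h1 j) (hz j)

/-- A block code, if there is one. -/
noncomputable def blockCode (Q : ℕ) [NeZero Q] (l : ℕ) : (Fin l → Γ₁ × Γ₂) → ℕ → Fin Q :=
  Classical.epsilon θ.IsBlockCode

/-- The `t`-th digit in the representation of `n < Q ^ h` as a word of length `h`. -/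
noncomputable def headerDigit (Q : ℕ) [NeZero Q] (h n t : ℕ) : Fin Q :=
  if H : n < Q ^ h ∧ t < h then finFunctionFinEquiv.symm ⟨n, H.1⟩ ⟨t, H.2⟩ else 0

lemma headerDigit_injective {h n n' : ℕ} (hn : n < Q ^ h) (hn' : n' < Q ^ h)
    (hdig : ∀ t < h, headerDigit Q h n t = headerDigit Q h n' t) : n = n' := by
  have : (⟨n, hn⟩ : Fin (Q ^ h)) = ⟨n', hn'⟩ := by
    refine finFunctionFinEquiv.symm.injective (funext fun ⟨t, ht⟩ => ?_)
    simpa [headerDigit, hn, hn', ht] using hdig t ht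
  exact congrArg Fin.val this

/-- The message for a block: the length of its code, followed by its code. -/
noncomputable def message (Q : ℕ) [NeZero Q] {l : ℕ} (u : Fin l → Γ₁ × Γ₂) (t : ℕ) : Fin Q :=
  if t < θ.header then headerDigit Q θ.header (θ.codeLength u) t
  else θ.blockCode Q l u (t - θ.header)

lemma Admissible.codeLength_eq_of_message [Fintype Γ₁] {θ : CodeParams (Γ₁ × Γ₂)}
    (hθ : θ.Admissible Q) {l : ℕ} (hl : l < 2 * θ.gap) {u u' : Fin l → Γ₁ × Γ₂}
    (h : ∀ t < θ.header, θ.message Q u t = θ.message Q u' t) :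
    θ.codeLength u = θ.codeLength u' := by
  refine headerDigit_injective (hθ.codeLength_lt l hl u) (hθ.codeLength_lt l hl u') fun t ht => ?_
  simpa [message, ht] using h t ht

lemma Admissible.eq_of_message [Fintype Γ₁] {θ : CodeParams (Γ₁ × Γ₂)}
    (hθ : θ.Admissible Q) {l : ℕ} {u u' : Fin l → Γ₁ × Γ₂} (hz : ∀ j, (u j).2 = (u' j).2)
    (hlen : θ.codeLength u = θ.codeLength u')
    (h : ∀ t < θ.header + θ.codeLength u, θ.message Q u t = θ.message Q u' t) : u = u' := by
  refine Classical.epsilon_spec (hθ.exists_isBlockCode l) u u' hz hlen fun t ht => ?_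
  simpa [message, blockCode] using h (θ.header + t) (by omega)

end CodeParams

/-! ### The encoding for given parameters -/

/-- The word of length `l` that occurs in `x` at `m`. -/
def wordAt {Λ : Type*} (x : ℤ → Λ) (m : ℤ) (l : ℕ) : Fin l → Λ :=
  fun j => x (m + ((j : ℕ) : ℤ))

lemma wordAt_shift {Λ : Type*} (x : ℤ → Λ) (m : ℤ) (l : ℕ) :
    wordAt (shift x) m l = wordAt x (m + 1) l := by
  funext j
  simp only [wordAt, shift, add_right_comm]

lemma measurable_wordAt {Λ : Type*} [MeasurableSpace Λ] (m : ℤ) (l : ℕ) :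
    Measurable fun x : ℤ → Λ => wordAt x m l :=
  measurable_pi_lambda _ fun j => measurable_pi_apply (m + ((j : ℕ) : ℤ))

/-- The indicator function of `I`. -/
noncomputable def slots (I : Set ℤ) : ℤ → ℕ := fun i => if i ∈ I then 1 else 0

lemma slots_le_one (I : Set ℤ) (i : ℤ) : slots I i ≤ 1 := by
  unfold slots
  split_ifs <;> simp

lemma slots_shiftSet (I : Set ℤ) : slots (shiftSet I) = shift (slots I) := rfl

lemma measurable_slots (i : ℤ) : Measurable fun I : Set ℤ => slots I i :=
  Measurable.ite (measurable_set_mem i).setOf measurable_const measurable_const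

/-- An element of `A`, if `A` is nonempty. -/
noncomputable def pickSymbol {Q : ℕ} [NeZero Q] (A : Set (Fin Q)) : Fin Q :=
  if h : A.Nonempty then h.choose else 0

lemma pickSymbol_eq {Q : ℕ} [NeZero Q] {A : Set (Fin Q)} {a : Fin Q} (ha : a ∈ A)
    (h : ∀ b ∈ A, b = a) : pickSymbol A = a := by
  have hA : A.Nonempty := ⟨a, ha⟩
  rw [pickSymbol, dif_pos hA]
  exact h _ hA.choose_spec

namespace CodeParams

variable {Γ₁ Γ₂ : Type*} [Finite Γ₂] {Q : ℕ} [NeZero Q] (θ : CodeParams (Γ₁ × Γ₂))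

/-- `[m, m + l)` is a block of `x`. -/
def BlockAt (x : ℤ → Γ₁ × Γ₂) (m : ℤ) (l : ℕ) : Prop :=
  l < 2 * θ.gap ∧ IsBlock (markers θ.gap fun i => (x i).2) m l

/-- The number of symbols needed for the message of the block starting at `m`. -/
noncomputable def demand (x : ℤ → Γ₁ × Γ₂) (m : ℤ) : ℕ :=
  ∑ l ∈ Finset.range (2 * θ.gap),
    if θ.BlockAt x m l then θ.header + θ.codeLength (wordAt x m l) else 0

/-- The symbols sent to the slot `j`; there is at most one. -/
def symbolsAt (Q : ℕ) [NeZero Q] (x : ℤ → Γ₁ × Γ₂) (I : Set ℤ) (j : ℤ) : Set (Fin Q) :=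
  {a | ∃ (m : ℤ) (n l t : ℕ), m + n = j ∧ θ.BlockAt x m l ∧ t < θ.demand x m ∧
    SentTo (slots I) (θ.demand x) m t n ∧ θ.message Q (wordAt x m l) t = a}

/-- The encoding with parameters `θ`. -/
noncomputable def encode (Q : ℕ) [NeZero Q] (x : ℤ → Γ₁ × Γ₂) (I : Set ℤ) (j : ℤ) :
    Option (Fin Q) :=
  if j ∈ I then some (pickSymbol (θ.symbolsAt Q x I j)) else none

lemma isSome_encode (x : ℤ → Γ₁ × Γ₂) (I : Set ℤ) (j : ℤ) :
    (θ.encode Q x I j).isSome ↔ j ∈ I := by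
  unfold encode
  split_ifs with h <;> simp [h]

lemma blockAt_shift (x : ℤ → Γ₁ × Γ₂) (m : ℤ) (l : ℕ) :
    θ.BlockAt (shift x) m l ↔ θ.BlockAt x (m + 1) l :=
  and_congr_right fun _ => isBlock_markers_shift θ.gap (fun i => (x i).2) m l

lemma demand_shift (x : ℤ → Γ₁ × Γ₂) : θ.demand (shift x) = shift (θ.demand x) := by
  funext m
  simp only [demand, blockAt_shift, wordAt_shift, shift]

lemma encode_shift (x : ℤ → Γ₁ × Γ₂) (I : Set ℤ) (j : ℤ) :
    θ.encode Q (shift x) (shiftSet I) j = θ.encode Q x I (j + 1) := by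
  have h : θ.symbolsAt Q (shift x) (shiftSet I) j = θ.symbolsAt Q x I (j + 1) := by
    ext a
    simp only [symbolsAt, demand_shift, slots_shiftSet, sentTo_shift, blockAt_shift, wordAt_shift]
    constructor
    · rintro ⟨m, n, l, t, h1, h2⟩
      exact ⟨m + 1, n, l, t, by omega, h2⟩
    · rintro ⟨m, n, l, t, h1, h2⟩
      refine ⟨m - 1, n, l, t, by omega, ?_⟩
      simpa only [shift, sub_add_cancel] using h2
  rw [encode, encode, h]
  rfl

lemma measurable_blockAt [MeasurableSpace Γ₁] [MeasurableSpace Γ₂]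
    [DiscreteMeasurableSpace Γ₂] (m : ℤ) (l : ℕ) :
    Measurable fun x : ℤ → Γ₁ × Γ₂ => θ.BlockAt x m l :=
  measurable_const.and <| (measurable_isBlock_markers θ.gap m l).comp <|
    measurable_pi_lambda _ fun i => measurable_snd.comp (measurable_pi_apply i)

section Measurability

variable [Finite Γ₁] [MeasurableSpace Γ₁] [DiscreteMeasurableSpace Γ₁]
  [MeasurableSpace Γ₂] [DiscreteMeasurableSpace Γ₂]

lemma measurable_demand (m : ℤ) : Measurable fun x : ℤ → Γ₁ × Γ₂ => θ.demand x m := by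
  refine Finset.measurable_sum _ fun l _ => Measurable.ite (θ.measurable_blockAt m l).setOf ?_
    measurable_const
  exact (Measurable.of_discrete (f := fun u : Fin l → Γ₁ × Γ₂ => θ.header + θ.codeLength u)).comp
    (measurable_wordAt m l)

lemma measurable_balance (m : ℤ) (n : ℕ) : Measurable fun p : (ℤ → Γ₁ × Γ₂) × Set ℤ =>
    balance (slots p.2) (θ.demand p.1) m n := by
  refine Measurable.sub (Finset.measurable_sum _ fun i _ => ?_)
    (Finset.measurable_sum _ fun i _ => ?_)
  · exact (Measurable.of_discrete (f := fun a : ℕ => (a : ℤ))).comp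
      ((measurable_slots _).comp measurable_snd)
  · exact (Measurable.of_discrete (f := fun a : ℕ => (a : ℤ))).comp
      ((θ.measurable_demand _).comp measurable_fst)

lemma measurable_sentTo (m : ℤ) (t n : ℕ) : Measurable fun p : (ℤ → Γ₁ × Γ₂) × Set ℤ =>
    SentTo (slots p.2) (θ.demand p.1) m t n :=
  ((Measurable.of_discrete (f := fun a : ℤ => (t : ℤ) + 1 ≤ a)).comp
    (θ.measurable_balance m n)).and <| Measurable.forall fun n' => Measurable.forall fun _ =>
      (Measurable.of_discrete (f := fun a : ℤ => a ≤ (t : ℤ))).comp (θ.measurable_balance m n')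

lemma measurable_symbolsAt (j : ℤ) : Measurable fun p : (ℤ → Γ₁ × Γ₂) × Set ℤ =>
    θ.symbolsAt Q p.1 p.2 j := by
  refine measurable_set_iff.2 fun a => ?_
  refine Measurable.exists fun m => Measurable.exists fun n => Measurable.exists fun l =>
    Measurable.exists fun t => measurable_const.and <|
      ((θ.measurable_blockAt m l).comp measurable_fst).and <| Measurable.and ?_ <|
        (θ.measurable_sentTo m t n).and ?_
  · exact (Measurable.of_discrete (f := fun b : ℕ => t < b)).comp
      ((θ.measurable_demand m).comp measurable_fst)
  · exact (Measurable.of_discrete (f := fun u : Fin l → Γ₁ × Γ₂ => θ.message Q u t = a)).comp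
      ((measurable_wordAt m l).comp measurable_fst)

lemma measurable_encode : Measurable fun p : (ℤ → Γ₁ × Γ₂) × Set ℤ => θ.encode Q p.1 p.2 := by
  have : DiscreteMeasurableSpace (Set (Fin Q)) :=
    inferInstanceAs (DiscreteMeasurableSpace (Fin Q → Prop))
  refine measurable_pi_lambda _ fun j => Measurable.ite
    ((measurable_set_mem j).comp measurable_snd).setOf ?_ measurable_const
  exact (Measurable.of_discrete (f := fun A : Set (Fin Q) => some (pickSymbol A))).comp
    (θ.measurable_symbolsAt j)

end Measurability

lemma demand_eq {x : ℤ → Γ₁ × Γ₂} {m : ℤ} {l : ℕ} (h : θ.BlockAt x m l) :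
    θ.demand x m = θ.header + θ.codeLength (wordAt x m l) := by
  rw [demand, Finset.sum_eq_single l, if_pos h]
  · exact fun l' _ hne => if_neg fun h' => hne (h'.2.unique h.2)
  · exact fun hl => absurd (Finset.mem_range.2 h.1) hl

lemma demand_eq_zero {x : ℤ → Γ₁ × Γ₂} {m : ℤ} (h : m ∉ markers θ.gap fun i => (x i).2) :
    θ.demand x m = 0 :=
  Finset.sum_eq_zero fun _ _ => if_neg fun h' => h h'.2.1

lemma demand_eq_zero_of_blockAt {x : ℤ → Γ₁ × Γ₂} {m : ℤ} {l : ℕ} (h : θ.BlockAt x m l) {i : ℕ}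
    (hi : 0 < i) (hil : i < l) : θ.demand x (m + i) = 0 :=
  θ.demand_eq_zero (h.2.2.2.2 i hi hil)

lemma encode_of_sentTo {x : ℤ → Γ₁ × Γ₂} {I : Set ℤ} {m : ℤ} {l t n : ℕ} (hb : θ.BlockAt x m l)
    (ht : t < θ.demand x m) (h : SentTo (slots I) (θ.demand x) m t n) :
    θ.encode Q x I (m + n) = some (θ.message Q (wordAt x m l) t) := by
  have hI : m + n ∈ I := by
    have := (h.balance_eq (slots_le_one I)).2
    by_contra hI
    simp [slots, hI] at this
  rw [encode, if_pos hI]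
  refine congrArg some (pickSymbol_eq ⟨m, n, l, t, rfl, hb, ht, h, rfl⟩ ?_)
  rintro b ⟨m', n', l', t', hj, hb', ht', h', rfl⟩
  obtain ⟨rfl, rfl⟩ := SentTo.injective (slots_le_one I) ht' ht h' h hj
  rw [hb'.2.unique hb.2]

lemma exists_sentTo_header {x : ℤ → Γ₁ × Γ₂} {I : Set ℤ}
    (hfit : ∀ n : ℤ, θ.header ≤ ∑ i ∈ Finset.range θ.gap, slots I (n + i))
    {m : ℤ} {l t : ℕ} (hb : θ.BlockAt x m l) (ht : t < θ.header) :
    ∃ n < l, SentTo (slots I) (θ.demand x) m t n := by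
  have hl := hb.2.2.2.1
  have hbal : (t : ℤ) + 1 ≤ balance (slots I) (θ.demand x) m (l - 1) := by
    have h0 : balance (slots I) (θ.demand x) m (l - 1) = balance (slots I) 0 m (l - 1) :=
      balance_congr fun i hi hi' => θ.demand_eq_zero_of_blockAt hb hi (by omega)
    have h1 : ∑ i ∈ Finset.range θ.gap, slots I (m + i) ≤ ∑ i ∈ Finset.range l, slots I (m + i) :=
      Finset.sum_le_sum_of_subset (Finset.range_subset_range.2 hb.2.gap_le)
    have h2 := (hfit m).trans h1
    rw [h0, balance, Nat.sub_add_cancel hl]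
    simp only [Pi.zero_apply, Nat.cast_zero, Finset.sum_const_zero, sub_zero]
    zify at h2
    omega
  obtain ⟨n, hn, h⟩ := SentTo.exists_of_le hbal
  exact ⟨n, by omega, h⟩

/-- The encoding is injective in the first component of `x`, provided that every message fits. -/
theorem Admissible.eq_of_encode_eq [Fintype Γ₁] {θ : CodeParams (Γ₁ × Γ₂)}
    (hθ : θ.Admissible Q) {x x' : ℤ → Γ₁ × Γ₂} {I : Set ℤ}
    (hz : ∀ i, (x i).2 = (x' i).2) (hap : Aperiodic fun i => (x i).2)
    (hfit : ∀ n : ℤ, θ.header ≤ ∑ i ∈ Finset.range θ.gap, slots I (n + i))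
    (hbal : ∀ m ∈ markers θ.gap (fun i => (x i).2), ∀ T : ℤ,
      ∃ n, T ≤ balance (slots I) (θ.demand x) m n)
    (h : θ.encode Q x I = θ.encode Q x' I) : x = x' := by
  have hb : ∀ m l, θ.BlockAt x m l → θ.BlockAt x' m l := fun m l hb => by
    rwa [BlockAt, ← funext hz]
  have hlen : ∀ m l, θ.BlockAt x m l →
      θ.codeLength (wordAt x m l) = θ.codeLength (wordAt x' m l) := by
    intro m l hm
    refine hθ.codeLength_eq_of_message hm.1 fun t ht => ?_
    obtain ⟨n, hn, hs⟩ := θ.exists_sentTo_header hfit hm ht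
    have hs' : SentTo (slots I) (θ.demand x') m t n := hs.congr fun i hi hin => by
      rw [θ.demand_eq_zero_of_blockAt hm hi (by omega),
        θ.demand_eq_zero_of_blockAt (hb m l hm) hi (by omega)]
    have h1 := θ.encode_of_sentTo (Q := Q) hm (by rw [θ.demand_eq hm]; omega) hs
    have h2 := θ.encode_of_sentTo (Q := Q) (hb m l hm)
      (by rw [θ.demand_eq (hb m l hm)]; omega) hs'
    exact Option.some_injective _ (h1.symm.trans ((congrFun h _).trans h2))
  have hdem : θ.demand x = θ.demand x' := by
    funext m
    by_cases hm : m ∈ markers θ.gap fun i => (x i).2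
    · obtain ⟨l, hl, hm⟩ := hap.exists_isBlock hθ.gap_pos hm
      have hm : θ.BlockAt x m l := ⟨hl, hm⟩
      rw [θ.demand_eq hm, θ.demand_eq (hb m l hm), hlen m l hm]
    · rw [θ.demand_eq_zero hm, θ.demand_eq_zero (by rwa [← funext hz])]
  have hword : ∀ m l, θ.BlockAt x m l → wordAt x m l = wordAt x' m l := by
    intro m l hm
    refine hθ.eq_of_message (fun j => hz _) (hlen m l hm) fun t ht => ?_
    obtain ⟨N, hN⟩ := hbal m hm.2.1 (t + 1)
    obtain ⟨n, -, hs⟩ := SentTo.exists_of_le hN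
    have h1 := θ.encode_of_sentTo (Q := Q) hm (by rwa [θ.demand_eq hm]) hs
    have h2 := θ.encode_of_sentTo (Q := Q) (hb m l hm)
      (by rwa [θ.demand_eq (hb m l hm), ← hlen m l hm]) (hdem ▸ hs)
    exact Option.some_injective _ (h1.symm.trans ((congrFun h _).trans h2))
  funext i
  obtain ⟨m, l, j, hl, hm, hj, rfl⟩ := hap.exists_isBlock_mem hθ.gap_pos i
  exact congrFun (hword m l ⟨hl, hm⟩) ⟨j, hj⟩

end CodeParams

/-! ### Frequencies -/

section Frequencies

variable {Λ : Type*}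

lemma occursAtW_shift {k : ℕ} (x : ℤ → Λ) (w : Fin k → Λ) (i : ℤ) :
    OccursAtW (shift x) w i ↔ OccursAtW x w (i + 1) := by
  simp only [OccursAtW, shift, add_right_comm]

lemma occursAtW_iff {k : ℕ} (x : ℤ → Λ) (w : Fin k → Λ) (i : ℤ) :
    OccursAtW x w i ↔ wordAt x i k = w :=
  funext_iff.symm

lemma tendsto_wordFreqW_shift_sub {k : ℕ} (x : ℤ → Λ) (w : Fin k → Λ) :
    Tendsto (fun N => wordFreqW (shift x) w N - wordFreqW x w N) atTop (nhds 0) := by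
  refine squeeze_zero_norm (a := fun N : ℕ => (1 : ℝ) / N) (fun N => ?_)
    tendsto_one_div_atTop_nhds_zero_nat
  have h : ∑ i ∈ Finset.range N, (if OccursAtW (shift x) w (i : ℤ) then (1 : ℝ) else 0) -
      ∑ i ∈ Finset.range N, (if OccursAtW x w (i : ℤ) then (1 : ℝ) else 0) =
      (if OccursAtW x w (N : ℤ) then 1 else 0) - if OccursAtW x w ((0 : ℕ) : ℤ) then 1 else 0 := by
    rw [← Finset.sum_sub_distrib,
      ← Finset.sum_range_sub fun i : ℕ => if OccursAtW x w (i : ℤ) then (1 : ℝ) else 0]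
    simp only [occursAtW_shift, Nat.cast_add, Nat.cast_one]
  rw [wordFreqW, wordFreqW, ← sub_div, h, norm_div, Real.norm_natCast]
  refine div_le_div_of_nonneg_right ?_ (Nat.cast_nonneg N)
  split_ifs <;> simp

lemma tendsto_wordFreqW_shift {k : ℕ} {x : ℤ → Λ} {w : Fin k → Λ} {c : ℝ} :
    Tendsto (wordFreqW (shift x) w) atTop (nhds c) ↔ Tendsto (wordFreqW x w) atTop (nhds c) := by
  have h := tendsto_wordFreqW_shift_sub x w
  constructor
  · intro h'
    simpa using h'.sub h
  · intro h'
    simpa using h.add h'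

lemma tendsto_wordFreqW_translate {k : ℕ} {x : ℤ → Λ} {w : Fin k → Λ} {c : ℝ} (m : ℤ) :
    Tendsto (wordFreqW (fun i => x (i + m)) w) atTop (nhds c) ↔
      Tendsto (wordFreqW x w) atTop (nhds c) := by
  have hstep : ∀ m : ℤ, shift (fun i => x (i + m)) = fun i => x (i + (m + 1)) := fun m => by
    funext i
    simp only [shift]
    congr 1
    ring
  induction m using Int.induction_on with
  | zero => simp
  | succ m ih =>
    refine Iff.trans ?_ ih
    rw [← hstep]
    exact tendsto_wordFreqW_shift
  | pred m ih =>
    refine Iff.trans ?_ ih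
    rw [← sub_add_cancel (-(m : ℤ)) 1, ← hstep, sub_add_cancel]
    exact tendsto_wordFreqW_shift.symm

lemma RegularW.tendsto {x : ℤ → Λ} (hx : RegularW x) {k : ℕ} (w : Fin k → Λ) :
    Tendsto (wordFreqW x w) atTop (nhds (blockDist x w)) :=
  tendsto_nhds_limUnder (hx k w)

lemma RegularW.blockDist_shift {x : ℤ → Λ} (hx : RegularW x) {k : ℕ} (w : Fin k → Λ) :
    blockDist (shift x) w = blockDist x w :=
  (tendsto_wordFreqW_shift.2 (hx.tendsto w)).limUnder_eq

/-- The forward averages of a function of words converge, from every starting point. -/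
lemma RegularW.tendsto_average [Fintype Λ] {x : ℤ → Λ} (hx : RegularW x) {k : ℕ}
    (f : (Fin k → Λ) → ℕ) (m : ℤ) :
    Tendsto (fun N : ℕ => ((∑ i ∈ Finset.range N, f (wordAt x (m + i) k) : ℕ) : ℝ) / N) atTop
      (nhds (∑ u, blockDist x u * f u)) := by
  have h : ∀ u : Fin k → Λ, Tendsto (fun N => wordFreqW (fun i => x (i + m)) u N * f u) atTop
      (nhds (blockDist x u * f u)) := fun u =>
    ((tendsto_wordFreqW_translate m).2 (hx.tendsto u)).mul_const _
  refine (tendsto_finsetSum Finset.univ fun u _ => h u).congr fun N => ?_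
  have hocc : ∀ (u : Fin k → Λ) (i : ℕ), OccursAtW (fun i => x (i + m)) u (i : ℤ) ↔
      wordAt x (m + i) k = u := fun u i => by
    rw [occursAtW_iff]
    have : wordAt (fun i => x (i + m)) (i : ℤ) k = wordAt x (m + i) k := by
      funext j
      simp only [wordAt]
      congr 1
      ring
    rw [this]
  simp only [wordFreqW, hocc, div_mul_eq_mul_div, ← Finset.sum_div, Finset.sum_mul]
  rw [Finset.sum_comm]
  push_cast
  congr 1
  refine Finset.sum_congr rfl fun i _ => ?_
  simp [ite_mul]

end Frequencies

lemma lowerUniformDensity_eq (I : Set ℤ) : lowerUniformDensity I =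
    liminf (fun N : ℕ => ⨅ n : ℤ, ((∑ i ∈ Finset.range N, slots I (n + i) : ℕ) : ℝ) / N) atTop := by
  simp only [lowerUniformDensity, slots, Nat.cast_sum, Nat.cast_ite, Nat.cast_one, Nat.cast_zero]

lemma bddBelow_range_density (I : Set ℤ) (N : ℕ) :
    BddBelow (Set.range fun n : ℤ => ((∑ i ∈ Finset.range N, slots I (n + i) : ℕ) : ℝ) / N) :=
  ⟨0, by rintro _ ⟨n, rfl⟩; positivity⟩

lemma eventually_le_sum_slots {I : Set ℤ} {v : ℝ} (hv : v < lowerUniformDensity I) :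
    ∀ᶠ N : ℕ in atTop, ∀ n : ℤ, v * N ≤ ((∑ i ∈ Finset.range N, slots I (n + i) : ℕ) : ℝ) := by
  rw [lowerUniformDensity_eq] at hv
  have hbdd : IsBoundedUnder (· ≥ ·) atTop fun N : ℕ =>
      ⨅ n : ℤ, ((∑ i ∈ Finset.range N, slots I (n + i) : ℕ) : ℝ) / N :=
    isBoundedUnder_of ⟨0, fun N => Real.iInf_nonneg fun n => by positivity⟩
  filter_upwards [eventually_lt_of_lt_liminf hv hbdd, eventually_gt_atTop 0] with N hN hN0 n
  have h := hN.le.trans (ciInf_le (bddBelow_range_density I N) n)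
  rwa [le_div_iff₀ (by exact_mod_cast hN0)] at h

lemma lowerUniformDensity_shiftSet (I : Set ℤ) :
    lowerUniformDensity (shiftSet I) = lowerUniformDensity I := by
  rw [lowerUniformDensity_eq, lowerUniformDensity_eq]
  congr 1
  funext N
  rw [← (Equiv.addRight (1 : ℤ)).iInf_comp
    (g := fun n => ((∑ i ∈ Finset.range N, slots I (n + i) : ℕ) : ℝ) / N)]
  simp only [slots_shiftSet, shift, Equiv.coe_addRight, add_right_comm]

lemma measurable_lowerUniformDensity : Measurable lowerUniformDensity := by
  rw [show lowerUniformDensity = _ from funext lowerUniformDensity_eq]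
  refine Measurable.liminf fun N => Measurable.iInf fun n => Measurable.div_const ?_ _
  exact (Measurable.of_discrete (f := fun a : ℕ => (a : ℝ))).comp <|
    Finset.measurable_sum _ fun i _ => measurable_slots _

lemma measurable_blockDist {Λ : Type*} [Finite Λ] [MeasurableSpace Λ] [DiscreteMeasurableSpace Λ]
    {k : ℕ} (w : Fin k → Λ) : Measurable fun x : ℤ → Λ => blockDist x w := by
  refine (MeasureTheory.StronglyMeasurable.limUnder (l := atTop) fun N =>
    Measurable.stronglyMeasurable ?_).measurable
  refine Measurable.div_const (Finset.measurable_sum _ fun i _ => Measurable.ite ?_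
    measurable_const measurable_const) _
  simp only [occursAtW_iff]
  exact ((Measurable.of_discrete (f := fun u : Fin k → Λ => u = w)).comp
    (measurable_wordAt (i : ℤ) k)).setOf

/-! ### All messages fit -/

namespace CodeParams

variable {Γ₁ Γ₂ : Type*} (θ : CodeParams (Γ₁ × Γ₂))

lemma wordLen_mul_codeLength_le (hk : 0 < θ.wordLen) (x : ℤ → Γ₁ × Γ₂) (m : ℤ) (l : ℕ) :
    θ.wordLen * θ.codeLength (wordAt x m l) ≤
      ∑ i ∈ Finset.range l, θ.weight (wordAt x (m + i) θ.wordLen) + θ.wordLen * θ.overhead := by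
  have hsub : ∀ i : Fin (l + 1 - θ.wordLen),
      subword (wordAt x m l) i = wordAt x (m + (i : ℕ)) θ.wordLen := fun i => by
    funext j
    simp only [subword, wordAt, Nat.cast_add, add_assoc]
  simp only [codeLength, hsub, mul_add]
  rw [Fin.sum_univ_eq_sum_range fun i => θ.weight (wordAt x (m + i) θ.wordLen)]
  refine Nat.add_le_add_right ((Nat.mul_div_le _ _).trans ?_) _
  exact Finset.sum_le_sum_of_subset (Finset.range_subset_range.2 (by omega))

variable [Fintype Γ₁] [Fintype Γ₂] {Q : ℕ} {θ}

lemma Admissible.exists_demand_le (hθ : θ.Admissible Q) {x : ℤ → Γ₁ × Γ₂}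
    (hap : Aperiodic fun i => (x i).2) {m : ℤ} (hm : m ∈ markers θ.gap fun i => (x i).2)
    (n : ℕ) : ∃ N ≥ n, m + N ∈ markers θ.gap (fun i => (x i).2) ∧
      θ.wordLen * θ.gap * ∑ i ∈ Finset.range N, θ.demand x (m + i) ≤
        θ.gap * ∑ i ∈ Finset.range N, θ.weight (wordAt x (m + i) θ.wordLen) +
          θ.wordLen * (θ.header + θ.overhead) * N := by
  induction n with
  | zero => exact ⟨0, le_rfl, by simpa using hm, by simp⟩
  | succ n ih =>
    obtain ⟨N, hN, hmN, hle⟩ := ih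
    obtain ⟨l, hl, hb⟩ := hap.exists_isBlock hθ.gap_pos hmN
    have hb : θ.BlockAt x (m + N) l := ⟨hl, hb⟩
    have hl0 := hb.2.2.2.1
    refine ⟨N + l, by omega, by rw [Nat.cast_add, ← add_assoc]; exact hb.2.2.1, ?_⟩
    have hcast : ∀ i : ℕ, m + ((N + i : ℕ) : ℤ) = m + N + i := fun i => by push_cast; ring
    have hdem : ∑ i ∈ Finset.range l, θ.demand x (m + N + i) =
        θ.header + θ.codeLength (wordAt x (m + N) l) := by
      rw [Finset.sum_eq_single_of_mem 0 (Finset.mem_range.2 hl0), Nat.cast_zero, add_zero,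
        θ.demand_eq hb]
      exact fun i hi hi0 => θ.demand_eq_zero_of_blockAt hb (Nat.pos_of_ne_zero hi0)
        (Finset.mem_range.1 hi)
    have hcode := θ.wordLen_mul_codeLength_le hθ.wordLen_pos x (m + N) l
    have hgap := hb.2.gap_le
    rw [Finset.sum_range_add, Finset.sum_range_add]
    simp only [hcast]
    rw [hdem]
    have h1 := Nat.mul_le_mul_left θ.gap hcode
    have h2 := Nat.mul_le_mul_left (θ.wordLen * (θ.header + θ.overhead)) hgap
    nlinarith

/-- The data of `(x, I)` that make every message fit. -/
structure Suitable (Q : ℕ) (θ : CodeParams (Γ₁ × Γ₂)) (x : ℤ → Γ₁ × Γ₂) (I : Set ℤ) :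
    Prop where
  admissible : θ.Admissible Q
  header_le : ∀ n : ℤ, θ.header ≤ ∑ i ∈ Finset.range θ.gap, slots I (n + i)
  lt_density : (∑ u, blockDist x u * θ.weight u) / θ.wordLen +
    ((θ.header + θ.overhead : ℕ) : ℝ) / θ.gap < lowerUniformDensity I

lemma Suitable.exists_le_balance {x : ℤ → Γ₁ × Γ₂} {I : Set ℤ} (h : θ.Suitable Q x I)
    (hx : RegularW x) (hap : Aperiodic fun i => (x i).2) {m : ℤ}
    (hm : m ∈ markers θ.gap fun i => (x i).2) (T : ℤ) :
    ∃ n, T ≤ balance (slots I) (θ.demand x) m n := by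
  obtain ⟨v, hv1, hv2⟩ := exists_between h.lt_density
  have hk : (0 : ℝ) < θ.wordLen := by exact_mod_cast h.admissible.wordLen_pos
  have hL : (0 : ℝ) < θ.gap := by exact_mod_cast h.admissible.gap_pos
  set φ := ∑ u, blockDist x u * θ.weight u
  set r : ℝ := ((θ.header + θ.overhead : ℕ) : ℝ) / θ.gap with hr
  obtain ⟨φ', hφ, hφ'⟩ : ∃ φ', φ < φ' ∧ φ' / θ.wordLen + r < v := by
    obtain ⟨c, hc1, hc2⟩ := exists_between (lt_sub_iff_add_lt.2 hv1)
    refine ⟨c * θ.wordLen, (div_lt_iff₀ hk).1 hc1, ?_⟩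
    rw [mul_div_cancel_right₀ _ hk.ne']
    linarith
  set δ := v - (φ' / θ.wordLen + r) with hδ
  have hδ0 : 0 < δ := sub_pos.2 hφ'
  have hev := ((hx.tendsto_average θ.weight m).eventually_lt_const hφ).and
    ((eventually_le_sum_slots hv2).and
      (((tendsto_natCast_atTop_atTop (R := ℝ)).const_mul_atTop hδ0).eventually_ge_atTop (T : ℝ)))
  obtain ⟨n₀, hn₀⟩ := eventually_atTop.1 hev
  obtain ⟨N, hN, -, hdem⟩ := h.admissible.exists_demand_le hap hm (n₀ + 1)
  obtain ⟨hF, hS, hT⟩ := hn₀ N (by omega)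
  have hN0 : (0 : ℝ) < N := by exact_mod_cast (show 0 < N by omega)
  rw [div_lt_iff₀ hN0] at hF
  obtain ⟨n, rfl⟩ : ∃ n, N = n + 1 := ⟨N - 1, by omega⟩
  refine ⟨n, ?_⟩
  have hd : ∑ i ∈ Finset.range n, θ.demand x (m + 1 + i) ≤
      ∑ i ∈ Finset.range (n + 1), θ.demand x (m + i) := by
    rw [Finset.sum_range_succ']
    refine le_trans (le_of_eq ?_) (Nat.le_add_right _ _)
    refine Finset.sum_congr rfl fun i _ => ?_
    congr 1
    push_cast
    ring
  have hbal : ((balance (slots I) (θ.demand x) m n : ℤ) : ℝ) =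
      ((∑ i ∈ Finset.range (n + 1), slots I (m + i) : ℕ) : ℝ) -
        ((∑ i ∈ Finset.range n, θ.demand x (m + 1 + i) : ℕ) : ℝ) := by
    simp [balance]
  have hdem' : ((∑ i ∈ Finset.range (n + 1), θ.demand x (m + i) : ℕ) : ℝ) ≤
      (φ' / θ.wordLen + r) * (n + 1 : ℕ) := by
    have h1 : (θ.wordLen * θ.gap : ℝ) *
        ((∑ i ∈ Finset.range (n + 1), θ.demand x (m + i) : ℕ) : ℝ) ≤
        θ.gap * ((∑ i ∈ Finset.range (n + 1), θ.weight (wordAt x (m + i) θ.wordLen) : ℕ) : ℝ) +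
          θ.wordLen * ((θ.header + θ.overhead : ℕ) : ℝ) * (n + 1 : ℕ) := by
      exact_mod_cast hdem
    have h2 : (θ.wordLen * θ.gap : ℝ) * ((φ' / θ.wordLen + r) * (n + 1 : ℕ)) =
        θ.gap * (φ' * (n + 1 : ℕ)) +
          θ.wordLen * ((θ.header + θ.overhead : ℕ) : ℝ) * (n + 1 : ℕ) := by
      rw [hr]
      field_simp
    refine le_of_mul_le_mul_left ?_ (mul_pos hk hL)
    rw [h2]
    have := mul_le_mul_of_nonneg_left hF.le hL.le
    linarith
  have hdR : ((∑ i ∈ Finset.range n, θ.demand x (m + 1 + i) : ℕ) : ℝ) ≤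
      ((∑ i ∈ Finset.range (n + 1), θ.demand x (m + i) : ℕ) : ℝ) := by exact_mod_cast hd
  have hfinal : (T : ℝ) ≤ ((balance (slots I) (θ.demand x) m n : ℤ) : ℝ) := by
    rw [hbal]
    have := hS m
    rw [hδ] at hT
    linarith
  exact_mod_cast hfinal

lemma suitable_shift {x : ℤ → Γ₁ × Γ₂} (hx : RegularW x) (I : Set ℤ) :
    θ.Suitable Q (shift x) (shiftSet I) ↔ θ.Suitable Q x I := by
  have hsum : ∑ u, blockDist (shift x) u * θ.weight u = ∑ u, blockDist x u * θ.weight u :=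
    Finset.sum_congr rfl fun u _ => by rw [hx.blockDist_shift]
  have hfit : (∀ n : ℤ, θ.header ≤ ∑ i ∈ Finset.range θ.gap, slots (shiftSet I) (n + i)) ↔
      ∀ n : ℤ, θ.header ≤ ∑ i ∈ Finset.range θ.gap, slots I (n + i) := by
    rw [← (Equiv.addRight (1 : ℤ)).forall_congr_right
      (q := fun n => θ.header ≤ ∑ i ∈ Finset.range θ.gap, slots I (n + i))]
    simp only [slots_shiftSet, shift, Equiv.coe_addRight, add_right_comm]
  constructor
  · rintro ⟨h1, h2, h3⟩
    exact ⟨h1, hfit.1 h2, by rwa [hsum, lowerUniformDensity_shiftSet] at h3⟩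
  · rintro ⟨h1, h2, h3⟩
    exact ⟨h1, hfit.2 h2, by rwa [hsum, lowerUniformDensity_shiftSet]⟩

lemma suitable_congr {x x' : ℤ → Γ₁ × Γ₂}
    (h : ∀ (k : ℕ) (w : Fin k → Γ₁ × Γ₂), blockDist x w = blockDist x' w) (I : Set ℤ) :
    θ.Suitable Q x I ↔ θ.Suitable Q x' I := by
  have hsum : ∑ u, blockDist x u * θ.weight u = ∑ u, blockDist x' u * θ.weight u :=
    Finset.sum_congr rfl fun u _ => by rw [h]
  exact ⟨fun ⟨h1, h2, h3⟩ => ⟨h1, h2, hsum ▸ h3⟩, fun ⟨h1, h2, h3⟩ => ⟨h1, h2, hsum ▸ h3⟩⟩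

lemma measurable_suitable [MeasurableSpace Γ₁] [DiscreteMeasurableSpace Γ₁]
    [MeasurableSpace Γ₂] [DiscreteMeasurableSpace Γ₂] :
    Measurable fun p : (ℤ → Γ₁ × Γ₂) × Set ℤ => θ.Suitable Q p.1 p.2 := by
  have h : ∀ p : (ℤ → Γ₁ × Γ₂) × Set ℤ, θ.Suitable Q p.1 p.2 ↔ θ.Admissible Q ∧
      (∀ n : ℤ, θ.header ≤ ∑ i ∈ Finset.range θ.gap, slots p.2 (n + i)) ∧
      (∑ u, blockDist p.1 u * θ.weight u) / θ.wordLen +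
        ((θ.header + θ.overhead : ℕ) : ℝ) / θ.gap < lowerUniformDensity p.2 := fun p =>
    ⟨fun h => ⟨h.1, h.2, h.3⟩, fun h => ⟨h.1, h.2.1, h.2.2⟩⟩
  simp only [h]
  refine measurable_const.and <| Measurable.and (Measurable.forall fun n => ?_) ?_
  · exact (Measurable.of_discrete (f := fun a : ℕ => θ.header ≤ a)).comp <|
      Finset.measurable_sum _ fun i _ => (measurable_slots _).comp measurable_snd
  · refine measurableSet_setOfPred.1 (measurableSet_lt ?_
      (measurable_lowerUniformDensity.comp measurable_snd))
    exact Measurable.add_const (Measurable.div_const (Finset.measurable_sum _ fun u _ =>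
      ((measurable_blockDist u).comp measurable_fst).mul_const _) _) _

end CodeParams

/-! ### Entropy -/

section Marginals

variable {ι α β : Type*} [Fintype ι]

/-- The image of the weights `P` under `a`. -/
noncomputable def marginal (P : ι → ℝ) (a : ι → α) (c : α) : ℝ :=
  ∑ u, if a u = c then P u else 0

lemma marginal_nonneg {P : ι → ℝ} (hP : ∀ u, 0 ≤ P u) (a : ι → α) (c : α) : 0 ≤ marginal P a c :=
  Finset.sum_nonneg fun u _ => by split_ifs; exacts [hP u, le_rfl]

lemma le_marginal {P : ι → ℝ} (hP : ∀ u, 0 ≤ P u) (a : ι → α) (u : ι) :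
    P u ≤ marginal P a (a u) := by
  refine le_trans (le_of_eq (by simp)) (Finset.single_le_sum
    (f := fun v => if a v = a u then P v else 0) (fun v _ => ?_) (Finset.mem_univ u))
  split_ifs
  exacts [hP v, le_rfl]

variable [Fintype α] [Fintype β]

lemma sum_marginal_mul (P : ι → ℝ) (a : ι → α) (F : α → ℝ) :
    ∑ c, marginal P a c * F c = ∑ u, P u * F (a u) := by
  simp only [marginal, Finset.sum_mul]
  rw [Finset.sum_comm]
  simp [ite_mul]

/-- Subadditivity of the Shannon entropy. -/
lemma neg_sum_mul_logb_le {P : ι → ℝ} (hP : ∀ u, 0 ≤ P u) (hP1 : ∑ u, P u = 1)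
    {a : ι → α} {b : ι → β} (hab : Function.Injective fun u => (a u, b u)) :
    -∑ u, P u * Real.logb 2 (P u) ≤
      -∑ c, marginal P a c * Real.logb 2 (marginal P a c) +
        -∑ c, marginal P b c * Real.logb 2 (marginal P b c) := by
  rw [sum_marginal_mul P a fun c => Real.logb 2 (marginal P a c),
    sum_marginal_mul P b fun c => Real.logb 2 (marginal P b c)]
  have hPa1 : ∑ c, marginal P a c = 1 := by simpa [hP1] using sum_marginal_mul P a fun _ => 1
  have hPb1 : ∑ c, marginal P b c = 1 := by simpa [hP1] using sum_marginal_mul P b fun _ => 1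
  have hPa0 := marginal_nonneg hP a
  have hPb0 := marginal_nonneg hP b
  have hPa := le_marginal hP a
  have hPb := le_marginal hP b
  generalize marginal P a = Pa at *
  generalize marginal P b = Pb at *
  have hl2 : 0 < Real.log 2 := Real.log_pos one_lt_two
  have hterm : ∀ u, P u * Real.logb 2 (Pa (a u)) + P u * Real.logb 2 (Pb (b u)) -
      P u * Real.logb 2 (P u) ≤ (Pa (a u) * Pb (b u) - P u) / Real.log 2 := fun u => by
    rcases (hP u).eq_or_lt with h0 | hpos
    · simp only [← h0, zero_mul, add_zero, sub_zero]
      exact div_nonneg (mul_nonneg (hPa0 _) (hPb0 _)) hl2.le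
    · have h1 : 0 < Pa (a u) := hpos.trans_le (hPa u)
      have h2 : 0 < Pb (b u) := hpos.trans_le (hPb u)
      have h3 := Real.log_le_sub_one_of_pos (div_pos (mul_pos h1 h2) hpos)
      rw [Real.log_div (mul_pos h1 h2).ne' hpos.ne', Real.log_mul h1.ne' h2.ne'] at h3
      have h4 := mul_le_mul_of_nonneg_left h3 hpos.le
      rw [mul_sub (P u) (_ / _), mul_div_cancel₀ _ hpos.ne', mul_one] at h4
      simp only [Real.logb]
      rw [le_div_iff₀ hl2]
      field_simp
      linarith
  have hprod : ∑ u, Pa (a u) * Pb (b u) ≤ 1 := by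
    calc ∑ u, Pa (a u) * Pb (b u)
        = ∑ p ∈ Finset.univ.image (fun u => (a u, b u)), Pa p.1 * Pb p.2 :=
          (Finset.sum_image (f := fun p : α × β => Pa p.1 * Pb p.2) fun u _ v _ h => hab h).symm
      _ ≤ ∑ p : α × β, Pa p.1 * Pb p.2 :=
          Finset.sum_le_sum_of_subset_of_nonneg (Finset.subset_univ _)
            fun p _ _ => mul_nonneg (hPa0 _) (hPb0 _)
      _ = 1 := by rw [Fintype.sum_prod_type, ← Finset.sum_mul_sum, hPa1, hPb1, one_mul]
  have hsum := Finset.sum_le_sum fun u (_ : u ∈ Finset.univ) => hterm u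
  rw [← Finset.sum_div, Finset.sum_sub_distrib, Finset.sum_sub_distrib, Finset.sum_add_distrib,
    hP1] at hsum
  have : (∑ u, Pa (a u) * Pb (b u) - 1) / Real.log 2 ≤ 0 :=
    div_nonpos_of_nonpos_of_nonneg (by linarith) hl2.le
  linarith

end Marginals

/-! ### Word frequencies of regular points -/

namespace RegularW

variable {Λ : Type*} {x : ℤ → Λ}

lemma blockDist_nonneg (hx : RegularW x) {k : ℕ} (u : Fin k → Λ) : 0 ≤ blockDist x u :=
  ge_of_tendsto' (hx.tendsto u) fun N => div_nonneg
    (Finset.sum_nonneg fun i _ => by split_ifs <;> norm_num) (Nat.cast_nonneg N)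

variable [Fintype Λ]

lemma sum_blockDist (hx : RegularW x) (k : ℕ) : ∑ u : Fin k → Λ, blockDist x u = 1 := by
  have h := hx.tendsto_average (k := k) (fun _ => 1) 0
  simp only [Nat.cast_one, mul_one, Finset.sum_const, Finset.card_range, smul_eq_mul] at h
  refine tendsto_nhds_unique h (tendsto_const_nhds.congr' ?_)
  filter_upwards [eventually_gt_atTop 0] with N hN
  rw [div_self (by positivity)]

/-- If the words of `y` are read off from the words of length `k` of `x`, then so are their
frequencies. -/
lemma tendsto_wordFreqW_of_eq (hx : RegularW x) {Λ' : Type*} {y : ℤ → Λ'} {j k : ℕ}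
    {a : (Fin k → Λ) → Fin j → Λ'} (h : ∀ i : ℤ, wordAt y i j = a (wordAt x i k))
    (v : Fin j → Λ') :
    Tendsto (wordFreqW y v) atTop (nhds (marginal (fun u => blockDist x u) a v)) := by
  have h1 := hx.tendsto_average (k := k) (fun u => if a u = v then 1 else 0) 0
  simp only [Nat.cast_ite, Nat.cast_one, Nat.cast_zero, mul_ite, mul_one, mul_zero] at h1
  have h2 : marginal (fun u => blockDist x u) a v = ∑ u, if a u = v then blockDist x u else 0 := by
    unfold marginal
    congr!
  rw [h2]
  refine h1.congr fun N => ?_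
  simp only [wordFreqW, occursAtW_iff, h, zero_add]
  push_cast
  rfl

lemma blockDist_castAdd (hx : RegularW x) (m n : ℕ) : (fun v : Fin m → Λ => blockDist x v) =
    marginal (fun u : Fin (m + n) → Λ => blockDist x u) fun u i => u (Fin.castAdd n i) :=
  funext fun v => (hx.tendsto_wordFreqW_of_eq
    (a := fun (u : Fin (m + n) → Λ) i => u (Fin.castAdd n i)) (fun _ => rfl) v).limUnder_eq

lemma blockDist_natAdd (hx : RegularW x) (m n : ℕ) : (fun v : Fin n → Λ => blockDist x v) =
    marginal (fun u : Fin (m + n) → Λ => blockDist x u) fun u i => u (Fin.natAdd m i) := by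
  refine funext fun v => Tendsto.limUnder_eq ((tendsto_wordFreqW_translate (m : ℤ)).1
    (hx.tendsto_wordFreqW_of_eq (a := fun (u : Fin (m + n) → Λ) i => u (Fin.natAdd m i))
      (fun i => ?_) v))
  funext t
  simp only [wordAt, Fin.val_natAdd, Nat.cast_add]
  congr 1
  ring

lemma blockEntropy_add_le (hx : RegularW x) (m n : ℕ) :
    blockEntropy x (m + n) ≤ blockEntropy x m + blockEntropy x n := by
  have h := neg_sum_mul_logb_le (P := fun u : Fin (m + n) → Λ => blockDist x u)
    (a := fun u i => u (Fin.castAdd n i)) (b := fun u i => u (Fin.natAdd m i))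
    hx.blockDist_nonneg (hx.sum_blockDist _) (fun u v huv => ?_)
  · rwa [← hx.blockDist_castAdd, ← hx.blockDist_natAdd] at h
  simp only [Prod.mk.injEq] at huv
  funext i
  refine Fin.addCases (fun i => ?_) (fun i => ?_) i
  exacts [congrFun huv.1 i, congrFun huv.2 i]

lemma blockEntropy_nonneg (hx : RegularW x) (k : ℕ) : 0 ≤ blockEntropy x k := by
  refine neg_nonneg.2 (Finset.sum_nonpos fun u _ => mul_nonpos_of_nonneg_of_nonpos
    (hx.blockDist_nonneg u) (Real.logb_nonpos one_lt_two (hx.blockDist_nonneg u) ?_))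
  rw [← hx.sum_blockDist k]
  exact Finset.single_le_sum (fun u _ => hx.blockDist_nonneg u) (Finset.mem_univ u)

lemma tendsto_blockEntropy (hx : RegularW x) :
    Tendsto (fun k : ℕ => blockEntropy x k / k) atTop (nhds (empEntropy x)) := by
  have hsub : Subadditive (blockEntropy x) := hx.blockEntropy_add_le
  refine tendsto_nhds_limUnder ⟨_, hsub.tendsto_lim ⟨0, ?_⟩⟩
  rintro _ ⟨k, rfl⟩
  exact div_nonneg (hx.blockEntropy_nonneg k) (Nat.cast_nonneg k)

end RegularW

section Factor

variable {Γ₁ Γ₂ : Type*} [Fintype Γ₁] [Fintype Γ₂] {x : ℤ → Γ₁ × Γ₂}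

lemma RegularW.tendsto_snd (hx : RegularW x) {k : ℕ} (b : Fin k → Γ₂) :
    Tendsto (wordFreqW (fun i => (x i).2) b) atTop
      (nhds (marginal (fun u : Fin k → Γ₁ × Γ₂ => blockDist x u) (fun u i => (u i).2) b)) :=
  hx.tendsto_wordFreqW_of_eq (a := fun (u : Fin k → Γ₁ × Γ₂) i => (u i).2) (fun _ => rfl) b

lemma RegularW.snd (hx : RegularW x) : RegularW fun i => (x i).2 :=
  fun _ b => ⟨_, hx.tendsto_snd b⟩

lemma RegularW.blockDist_snd (hx : RegularW x) {k : ℕ} (b : Fin k → Γ₂) :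
    blockDist (fun i => (x i).2) b =
      marginal (fun u : Fin k → Γ₁ × Γ₂ => blockDist x u) (fun u i => (u i).2) b :=
  (hx.tendsto_snd b).limUnder_eq

lemma marginal_snd_eq_sum_zipWord {k : ℕ} (F : (Fin k → Γ₁ × Γ₂) → ℝ) (b : Fin k → Γ₂) :
    marginal F (fun u i => (u i).2) b = ∑ a : Fin k → Γ₁, F (zipWord a b) := by
  rw [marginal, ← (Equiv.arrowProdEquivProdArrow (Fin k) (fun _ => Γ₁) fun _ => Γ₂).symm.sum_comp,
    Fintype.sum_prod_type]
  refine Finset.sum_congr rfl fun a _ => ?_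
  rw [Finset.sum_eq_single_of_mem b (Finset.mem_univ b)]
  · exact if_pos rfl
  · exact fun c _ hc => if_neg hc

/-- A code length close to the conditional information content. -/
noncomputable def shannonWeight (Q K : ℕ) (x : ℤ → Γ₁ × Γ₂) {k : ℕ} (u : Fin k → Γ₁ × Γ₂) : ℕ :=
  if blockDist x u = 0 then K else
    ⌈(Real.logb 2 (blockDist (fun i => (x i).2) fun i => (u i).2) -
      Real.logb 2 (blockDist x u)) / Real.logb 2 Q⌉₊ + 1

lemma RegularW.sum_mul_shannonWeight_le (hx : RegularW x) {Q : ℕ} (hQ : 2 ≤ Q) (K k : ℕ) :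
    ∑ u : Fin k → Γ₁ × Γ₂, blockDist x u * shannonWeight Q K x u ≤
      (blockEntropy x k - blockEntropy (fun i => (x i).2) k) / Real.logb 2 Q + 2 := by
  have hlog : 0 < Real.logb 2 Q := Real.logb_pos one_lt_two (by exact_mod_cast hQ)
  set Pz : (Fin k → Γ₂) → ℝ := fun b => blockDist (fun i => (x i).2) b with hPz
  have hterm : ∀ u : Fin k → Γ₁ × Γ₂, blockDist x u * shannonWeight Q K x u ≤
      (blockDist x u * Real.logb 2 (Pz fun i => (u i).2) -
        blockDist x u * Real.logb 2 (blockDist x u)) / Real.logb 2 Q + 2 * blockDist x u :=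
      fun u => by
    rcases (hx.blockDist_nonneg u).eq_or_lt with h0 | hpos
    · simp [← h0]
    · have hle : blockDist x u ≤ Pz fun i => (u i).2 := by
        simp only [hPz, hx.blockDist_snd]
        exact le_marginal (P := fun u : Fin k → Γ₁ × Γ₂ => blockDist x u) hx.blockDist_nonneg
          (fun u i => (u i).2) u
      have h1 : 0 ≤ (Real.logb 2 (Pz fun i => (u i).2) - Real.logb 2 (blockDist x u)) /
          Real.logb 2 Q :=
        div_nonneg (sub_nonneg.2 (Real.logb_le_logb_of_le one_lt_two hpos hle)) hlog.le
      have h2 := Nat.ceil_lt_add_one h1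
      rw [shannonWeight, if_neg hpos.ne', ← mul_sub, mul_div_assoc, mul_comm 2, ← mul_add]
      refine mul_le_mul_of_nonneg_left ?_ hpos.le
      push_cast
      linarith
  refine (Finset.sum_le_sum fun u _ => hterm u).trans (le_of_eq ?_)
  rw [Finset.sum_add_distrib, ← Finset.sum_div, Finset.sum_sub_distrib, ← Finset.mul_sum,
    hx.sum_blockDist, mul_one]
  congr 2
  have h := sum_marginal_mul (fun u : Fin k → Γ₁ × Γ₂ => blockDist x u) (fun u i => (u i).2)
    fun b => Real.logb 2 (Pz b)
  simp only [← hx.blockDist_snd] at h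
  rw [← h, blockEntropy, blockEntropy]
  ring

lemma RegularW.kraftIneq_shannonWeight (hx : RegularW x) {Q : ℕ} (hQ : 2 ≤ Q) {K k : ℕ}
    (hK : 2 * Fintype.card (Fin k → Γ₁) ≤ Q ^ K) :
    KraftIneq Q fun u : Fin k → Γ₁ × Γ₂ => shannonWeight Q K x u := by
  intro b
  have hQ0 : (0 : ℝ) < Q := by positivity
  have hQ1 : (Q : ℝ)⁻¹ ≤ 1 / 2 := by
    rw [one_div]
    exact inv_anti₀ two_pos (by exact_mod_cast hQ)
  have hlog : 0 < Real.logb 2 Q := Real.logb_pos one_lt_two (by exact_mod_cast hQ)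
  set p := blockDist (fun i => (x i).2) b with hp
  set c : ℝ := (Fintype.card (Fin k → Γ₁) : ℝ) with hc
  have hp0 : 0 ≤ p := hx.snd.blockDist_nonneg b
  have hsum : ∑ a : Fin k → Γ₁, blockDist x (zipWord a b) = p := by
    rw [hp, hx.blockDist_snd, marginal_snd_eq_sum_zipWord]
  have hterm : ∀ a : Fin k → Γ₁, ((Q : ℝ)⁻¹) ^ shannonWeight Q K x (zipWord a b) ≤
      1 / 2 * (blockDist x (zipWord a b) / p) + 1 / 2 * c⁻¹ := fun a => by
    rcases (hx.blockDist_nonneg (zipWord a b)).eq_or_lt with h0 | hpos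
    · rw [shannonWeight, if_pos h0.symm, ← h0, zero_div, mul_zero, zero_add, inv_pow, one_div,
        ← mul_inv]
      have hc0 : 0 < c := by
        rw [hc]
        exact_mod_cast Fintype.card_pos_iff.2 ⟨a⟩
      refine inv_anti₀ (by positivity) ?_
      rw [hc]
      exact_mod_cast hK
    · have hle : blockDist x (zipWord a b) ≤ p := by
        rw [← hsum]
        exact Finset.single_le_sum (f := fun a => blockDist x (zipWord a b))
          (fun a _ => hx.blockDist_nonneg _) (Finset.mem_univ a)
      have hppos := hpos.trans_le hle
      have h1 : ((Q : ℝ)⁻¹) ^ ⌈(Real.logb 2 p - Real.logb 2 (blockDist x (zipWord a b))) /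
          Real.logb 2 Q⌉₊ ≤ blockDist x (zipWord a b) / p := by
        rw [inv_pow, ← inv_div p]
        refine inv_anti₀ (div_pos hppos hpos) ?_
        rw [← Real.logb_div hppos.ne' hpos.ne']
        set t := p / blockDist x (zipWord a b) with ht
        have ht0 : 0 < t := div_pos hppos hpos
        have h2 : Real.logb 2 t ≤ Real.logb 2 ((Q : ℝ) ^ ⌈Real.logb 2 t / Real.logb 2 Q⌉₊) := by
          rw [Real.logb_pow]
          exact (div_le_iff₀ hlog).1 (Nat.le_ceil _)
        exact (Real.logb_le_logb one_lt_two ht0 (by positivity)).1 h2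
      rw [shannonWeight, if_neg hpos.ne', pow_succ, mul_comm]
      have h3 : 0 ≤ 1 / 2 * c⁻¹ := by positivity
      have h4 := mul_le_mul hQ1 h1 (by positivity) (by norm_num)
      exact h4.trans (le_add_of_nonneg_right h3)
  refine (Finset.sum_le_sum fun a _ => hterm a).trans ?_
  rw [Finset.sum_add_distrib, ← Finset.mul_sum, ← Finset.sum_div, hsum, Finset.sum_const,
    Finset.card_univ, nsmul_eq_mul, ← hc]
  have h1 : p / p ≤ 1 := div_self_le_one p
  have h2 : c * (1 / 2 * c⁻¹) ≤ 1 / 2 := by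
    have : c * c⁻¹ ≤ 1 := mul_inv_le_one
    linarith
  linarith

end Factor

/-! ### Existence of suitable parameters -/

namespace CodeParams

lemma codeLength_le {Γ : Type*} (θ : CodeParams Γ) (hk : 0 < θ.wordLen) {F : ℕ}
    (hF : ∀ u, θ.weight u ≤ F) {l : ℕ} (u : Fin l → Γ) :
    θ.codeLength u ≤ l * F + θ.overhead := by
  refine Nat.add_le_add_right ((Nat.div_le_self _ _).trans ?_) _
  refine (Finset.sum_le_card_nsmul _ _ F fun i _ => hF _).trans ?_
  rw [Finset.card_univ, Fintype.card_fin, smul_eq_mul]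
  exact Nat.mul_le_mul_right _ (by omega)

lemma exists_suitable {Γ₁ Γ₂ : Type*} [Fintype Γ₁] [Fintype Γ₂] {Q : ℕ} (hQ : 2 ≤ Q)
    {x : ℤ → Γ₁ × Γ₂} (hx : RegularW x) {I : Set ℤ}
    (hI : relEntropy x / Real.logb 2 Q < lowerUniformDensity I) :
    ∃ θ : CodeParams (Γ₁ × Γ₂), θ.Suitable Q x I := by
  obtain ⟨k, hk, hkI⟩ : ∃ k : ℕ, 0 < k ∧
      ((blockEntropy x k - blockEntropy (fun i => (x i).2) k) / Real.logb 2 Q + 2) / k <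
        lowerUniformDensity I := by
    have h := ((hx.tendsto_blockEntropy.sub hx.snd.tendsto_blockEntropy).div_const
      (Real.logb 2 Q)).add (tendsto_const_div_atTop_nhds_zero_nat 2)
    rw [add_zero] at h
    obtain ⟨k, hk, hk0⟩ := ((h.eventually_lt_const hI).and (eventually_gt_atTop 0)).exists
    refine ⟨k, hk0, lt_of_eq_of_lt ?_ hk⟩
    rw [add_div, div_right_comm, sub_div]
  obtain ⟨K, hK⟩ : ∃ K, 2 * Fintype.card (Fin k → Γ₁) ≤ Q ^ K :=
    ⟨_, (Nat.lt_pow_self (by omega)).le⟩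
  obtain ⟨C, hC⟩ : ∃ C, k * Fintype.card (Bool × Fin k → Option Γ₁) ≤ Q ^ C :=
    ⟨_, (Nat.lt_pow_self (by omega)).le⟩
  let f : (Fin k → Γ₁ × Γ₂) → ℕ := fun u => shannonWeight Q K x u
  obtain ⟨F, hF⟩ : ∃ F, ∀ u, f u ≤ F :=
    ⟨Finset.univ.sup f, fun u => Finset.le_sup (Finset.mem_univ u)⟩
  have hφ : (∑ u, blockDist x u * f u) / k < lowerUniformDensity I :=
    lt_of_le_of_lt (div_le_div_of_nonneg_right (hx.sum_mul_shannonWeight_le hQ K k)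
      (Nat.cast_nonneg k)) hkI
  have hφ0 : 0 ≤ (∑ u, blockDist x u * f u) / k :=
    div_nonneg (Finset.sum_nonneg fun u _ => mul_nonneg (hx.blockDist_nonneg u)
      (Nat.cast_nonneg _)) (Nat.cast_nonneg k)
  obtain ⟨v, hv0, hv⟩ := exists_between (hφ0.trans_lt hφ)
  have hsq : Tendsto (fun h : ℕ => h ^ 2) atTop atTop := tendsto_pow_atTop two_ne_zero
  have hdens : Tendsto (fun h : ℕ => (∑ u, blockDist x u * f u) / k +
      ((h + C : ℕ) : ℝ) / ((h ^ 2 : ℕ) : ℝ)) atTop (nhds ((∑ u, blockDist x u * f u) / k)) := by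
    have h1 : Tendsto (fun h : ℕ => (1 : ℝ) / h + (C : ℝ) / ((h ^ 2 : ℕ) : ℝ)) atTop (nhds 0) := by
      simpa using tendsto_one_div_atTop_nhds_zero_nat.add
        ((tendsto_const_div_atTop_nhds_zero_nat (C : ℝ)).comp hsq)
    have h2 := h1.const_add ((∑ u, blockDist x u * f u) / k)
    rw [add_zero] at h2
    refine h2.congr' ?_
    filter_upwards [eventually_gt_atTop 0] with h hh
    have : (h : ℝ) ≠ 0 := by positivity
    push_cast
    field_simp
  have hexp : ∀ᶠ h : ℕ in atTop, 2 * h ^ 2 * F + C < 2 ^ h := by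
    have h1 : Tendsto (fun h : ℕ => 2 * F * ((h : ℝ) ^ 2 / 2 ^ h) + C * ((h : ℝ) ^ 0 / 2 ^ h)) atTop
        (nhds 0) := by
      simpa using ((tendsto_pow_const_div_const_pow_of_one_lt 2 one_lt_two).const_mul
        (2 * F : ℝ)).add ((tendsto_pow_const_div_const_pow_of_one_lt 0 one_lt_two).const_mul (C : ℝ))
    filter_upwards [h1.eventually_lt_const one_pos] with h hh
    have h2 : (0 : ℝ) < 2 ^ h := by positivity
    have h3 : (2 * h ^ 2 * F + C : ℝ) < 2 ^ h := by
      rw [← div_lt_one h2]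
      refine lt_of_eq_of_lt ?_ hh
      field_simp
    exact_mod_cast h3
  obtain ⟨h, hh1, hh2, hh3, hh4, hh5⟩ := ((hdens.eventually_lt_const hφ).and <| hexp.and <|
    (hsq.eventually (eventually_le_sum_slots hv)).and <|
    (((tendsto_natCast_atTop_atTop (R := ℝ)).const_mul_atTop hv0).eventually_ge_atTop 1).and
    (eventually_gt_atTop 0)).exists
  refine ⟨⟨k, f, C, h, h ^ 2⟩, ⟨hk, by positivity, hx.kraftIneq_shannonWeight hQ hK, hC, ?_⟩, ?_,
    hh1⟩
  · intro l hl u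
    refine (codeLength_le _ hk hF u).trans_lt (lt_of_le_of_lt ?_
      (hh2.trans_le (Nat.pow_le_pow_left hQ h)))
    exact Nat.add_le_add_right (Nat.mul_le_mul_right _ hl.le) _
  · intro n
    have h1 := hh3 n
    have h2 : (h : ℝ) ≤ v * ((h ^ 2 : ℕ) : ℝ) := by
      push_cast
      nlinarith [(Nat.cast_nonneg h : (0 : ℝ) ≤ h)]
    exact_mod_cast h2.trans h1

end CodeParams

/-! ### The universal encoding -/

instance {Γ : Type*} : Nonempty (CodeParams Γ) := ⟨⟨0, fun _ => 0, 0, 0, 0⟩⟩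

/-- An enumeration of all parameters. -/
noncomputable def paramSeq (Γ : Type*) [Finite Γ] : ℕ → CodeParams Γ :=
  (exists_surjective_nat (CodeParams Γ)).choose

lemma paramSeq_surjective (Γ : Type*) [Finite Γ] : Function.Surjective (paramSeq Γ) :=
  (exists_surjective_nat (CodeParams Γ)).choose_spec

namespace CodeParams

variable {Γ₁ Γ₂ : Type*} [Fintype Γ₁] [Fintype Γ₂] {Q : ℕ}

lemma exists_index (Q : ℕ) (x : ℤ → Γ₁ × Γ₂) (I : Set ℤ) :
    ∃ n, (paramSeq (Γ₁ × Γ₂) n).Suitable Q x I ∨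
      ∀ m, ¬ (paramSeq (Γ₁ × Γ₂) m).Suitable Q x I := by
  by_cases h : ∃ n, (paramSeq (Γ₁ × Γ₂) n).Suitable Q x I
  · exact h.imp fun _ => Or.inl
  · exact ⟨0, Or.inr (not_exists.1 h)⟩

/-- The first suitable parameters in the enumeration. -/
noncomputable def first (Q : ℕ) (x : ℤ → Γ₁ × Γ₂) (I : Set ℤ) : CodeParams (Γ₁ × Γ₂) :=
  paramSeq (Γ₁ × Γ₂) (Nat.find (exists_index Q x I))

lemma suitable_first (hQ : 2 ≤ Q) {x : ℤ → Γ₁ × Γ₂} (hx : RegularW x) {I : Set ℤ}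
    (hI : relEntropy x / Real.logb 2 Q < lowerUniformDensity I) : (first Q x I).Suitable Q x I := by
  obtain ⟨θ, hθ⟩ := exists_suitable hQ hx hI
  obtain ⟨n, rfl⟩ := paramSeq_surjective _ θ
  exact (Nat.find_spec (exists_index Q x I)).resolve_right fun h => h n hθ

lemma first_congr {x x' : ℤ → Γ₁ × Γ₂} {I I' : Set ℤ}
    (h : ∀ θ : CodeParams (Γ₁ × Γ₂), θ.Suitable Q x I ↔ θ.Suitable Q x' I') :
    first Q x I = first Q x' I' := by
  simp only [first, h]

lemma measurable_encode_first [NeZero Q] [MeasurableSpace Γ₁] [DiscreteMeasurableSpace Γ₁]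
    [MeasurableSpace Γ₂] [DiscreteMeasurableSpace Γ₂] :
    Measurable fun p : (ℤ → Γ₁ × Γ₂) × Set ℤ => (first Q p.1 p.2).encode Q p.1 p.2 := by
  refine Measurable.find (fun n => (paramSeq (Γ₁ × Γ₂) n).measurable_encode) (fun n => ?_)
    fun p => exists_index Q p.1 p.2
  exact (measurable_suitable.or (Measurable.forall fun m => measurable_suitable.not)).setOf

end CodeParams

/-- **Relative generator theorem.** Let `Q ≥ 2` and let `Γ₁, Γ₂` be finite alphabets. There
is a Borel, equivariant assignment associating to every regular aperiodic `x = (y,z)` with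
`z` aperiodic and `h(x|z) < log₂ Q`, and every `I ⊆ ℤ` with `s̲*(I) > h(x|z)/log₂ Q`, an
element `w = W x I ∈ {1,…,Q}^I`, such that `(P_x^*, z, w)` determines `x`. -/
theorem relative_krieger {Γ₁ Γ₂ : Type*} [Fintype Γ₁] [Fintype Γ₂]
    [MeasurableSpace Γ₁] [DiscreteMeasurableSpace Γ₁]
    [MeasurableSpace Γ₂] [DiscreteMeasurableSpace Γ₂]
    (Q : ℕ) (hQ : 2 ≤ Q) :
    ∃ W : (ℤ → Γ₁ × Γ₂) → Set ℤ → (ℤ → Option (Fin Q)),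
      -- Borel measurability of the assignment
      Measurable (fun p : (ℤ → Γ₁ × Γ₂) × Set ℤ => W p.1 p.2) ∧
      -- on valid inputs, `W x I` is an element of `{1,…,Q}^I` and the assignment is
      -- equivariant: `(Sx, SI) ↦ Sw`
      (∀ (x : ℤ → Γ₁ × Γ₂) (I : Set ℤ),
        RegularW x → Aperiodic x → Aperiodic (fun i => (x i).2) →
        relEntropy x < Real.logb 2 Q →
        relEntropy x / Real.logb 2 Q < lowerUniformDensity I →
          ((∀ i : ℤ, (W x I i).isSome ↔ i ∈ I) ∧
            W (shift x) (shiftSet I) = fun i => W x I (i + 1))) ∧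
      -- `(P_x^*, z, w)` determines `x`
      (∀ (x x' : ℤ → Γ₁ × Γ₂) (I I' : Set ℤ),
        RegularW x → Aperiodic x → Aperiodic (fun i => (x i).2) →
        relEntropy x < Real.logb 2 Q →
        relEntropy x / Real.logb 2 Q < lowerUniformDensity I →
        RegularW x' → Aperiodic x' → Aperiodic (fun i => (x' i).2) →
        relEntropy x' < Real.logb 2 Q →
        relEntropy x' / Real.logb 2 Q < lowerUniformDensity I' →
        (∀ i, (x i).2 = (x' i).2) →
        (∀ (k : ℕ) (w : Fin k → Γ₁ × Γ₂), blockDist x w = blockDist x' w) →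
        W x I = W x' I' → x = x') := by
  have : NeZero Q := ⟨by omega⟩
  refine ⟨fun x I => (CodeParams.first Q x I).encode Q x I, CodeParams.measurable_encode_first,
    fun x I hx _ _ _ _ => ⟨fun i => CodeParams.isSome_encode _ x I i, ?_⟩, ?_⟩
  · dsimp only
    rw [CodeParams.first_congr fun θ => CodeParams.suitable_shift hx I]
    funext i
    exact CodeParams.encode_shift _ x I i
  · intro x x' I I' hx _ hap _ hI _ _ _ _ _ hz hdist hW
    obtain rfl : I = I' := Set.ext fun i => by
      rw [← CodeParams.isSome_encode (Q := Q) (CodeParams.first Q x I) x I i,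
        ← CodeParams.isSome_encode (Q := Q) (CodeParams.first Q x' I') x' I' i]
      exact iff_of_eq (congrArg (fun w => (w i).isSome = true) hW)
    have hs := CodeParams.suitable_first hQ hx hI
    have hfirst : CodeParams.first Q x I = CodeParams.first Q x' I :=
      CodeParams.first_congr fun θ => CodeParams.suitable_congr hdist I
    dsimp only at hW
    rw [← hfirst] at hW
    exact hs.admissible.eq_of_encode_eq hz hap hs.header_le
      (fun m hm T => hs.exists_le_balance hx hap hm T) hW
end

section
/- Let Σ be a countably infinite alphabet. For every δ > 0 there exists a factor map π_δ : Deficient(Σ^ℤ) → Σ^ℤ whose image is contained in Deficient(Σ^ℤ) ∪ Divergent(Σ^ℤ), such that for every x ∈ Deficient(Σ^ℤ), if π_δ(x) is regular then ∑_{a∈Σ} s(π_δ(x), a) < δ. -/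
open Filter
open scoped Classical

/-- The word `a` occurs in `x ∈ Λ^ℤ` at position `i`. -/
def OccursAt {Λ : Type*} (x : ℤ → Λ) (a : List Λ) (i : ℤ) : Prop :=
  ∀ j : Fin a.length, x (i + ((j : ℕ) : ℤ)) = a.get j

/-- `(1/N) · #{0 ≤ i < N : a occurs in x at i}`. -/
noncomputable def wordFreq {Λ : Type*} (x : ℤ → Λ) (a : List Λ) (N : ℕ) : ℝ :=
  (∑ i ∈ Finset.range N, if OccursAt x a (i : ℤ) then (1 : ℝ) else 0) / N

/-- A point `x ∈ Λ^ℤ` is regular if the frequency `s(x,a)` exists for every finite word `a`;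
otherwise it is divergent. -/
def Regular {Λ : Type*} (x : ℤ → Λ) : Prop :=
  ∀ a : List Λ, ∃ L : ℝ, Tendsto (wordFreq x a) atTop (nhds L)

/-- The set of divergent points of `Λ^ℤ`. -/
def DivergentSet (Λ : Type*) : Set (ℤ → Λ) := {x | ¬ Regular x}

/-- The set of deficient points of `Λ^ℤ`: points `x` such that `s(x,a)` exists and is
positive for every symbol `a ∈ Λ`, and `ρ(x) = ∑_{a∈Λ} s(x,a) < 1`. -/
def DeficientSet (Λ : Type*) : Set (ℤ → Λ) :=
  {x | (∀ a : Λ, ∃ L : ℝ, 0 < L ∧ Tendsto (wordFreq x [a]) atTop (nhds L)) ∧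
    ∃ c : ℝ, HasSum (fun a : Λ => limUnder atTop (wordFreq x [a])) c ∧ c < 1}

/-- `#{0 ≤ i < N : u i = n}` for a one-sided sequence `u`. -/
def symbolCount (u : ℕ → ℕ) (n N : ℕ) : ℕ := ((Finset.range N).filter fun i => u i = n).card

/-- `#{0 ≤ i < N : M ≤ u i}` for a one-sided sequence `u`. -/
def tailCount (M : ℕ) (u : ℕ → ℕ) (N : ℕ) : ℕ := ((Finset.range N).filter fun i => M ≤ u i).card

/-- The first time `m` at which the symbols `≥ M` of `u` seen so far, each of capacity `K`, can
accommodate all positions `0, …, m`. -/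
noncomputable def reach (K M : ℕ) (u : ℕ → ℕ) : ℕ := sInf {m | m + 1 ≤ K * tailCount M u (m + 1)}

/-- The symbol that encodes the large symbol at position `reach K M u` together with its
distance from the origin. -/
noncomputable def reachCode (K M : ℕ) (u : ℕ → ℕ) : ℕ := u (reach K M u) - M + reach K M u

theorem tailCount_succ (M : ℕ) (u : ℕ → ℕ) (N : ℕ) :
    tailCount M u (N + 1) = tailCount M u N + if M ≤ u N then 1 else 0 := by
  unfold tailCount
  rw [Finset.range_add_one, Finset.filter_insert]
  split_ifs <;> simp

theorem tailCount_add (M : ℕ) (u : ℕ → ℕ) (i m : ℕ) :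
    tailCount M u (i + m) = tailCount M u i + tailCount M (fun j => u (i + j)) m := by
  induction m with
  | zero => simp [tailCount]
  | succ m ih => rw [← add_assoc, tailCount_succ, tailCount_succ, ih, add_assoc]

theorem tailCount_le (M : ℕ) (u : ℕ → ℕ) (N : ℕ) : tailCount M u N ≤ N :=
  (Finset.card_filter_le _ _).trans (by simp)

/-- The surplus of capacity over positions in `[0, n)`. -/
def surplus (K M : ℕ) (u : ℕ → ℕ) (n : ℕ) : ℤ := K * tailCount M u n - n

theorem surplus_succ_of_le {K M : ℕ} {u : ℕ → ℕ} {n : ℕ} (h : M ≤ u n) :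
    surplus K M u (n + 1) = surplus K M u n + K - 1 := by
  simp only [surplus, tailCount_succ, h, if_true]
  push_cast
  ring

theorem surplus_succ_of_lt {K M : ℕ} {u : ℕ → ℕ} {n : ℕ} (h : u n < M) :
    surplus K M u (n + 1) = surplus K M u n - 1 := by
  simp only [surplus, tailCount_succ, not_le.2 h, if_false]
  push_cast
  ring

theorem reach_condition_iff (K M : ℕ) (u : ℕ → ℕ) (i m : ℕ) :
    m + 1 ≤ K * tailCount M (fun j => u (i + j)) (m + 1) ↔
      surplus K M u i ≤ surplus K M u (i + m + 1) := by
  have h := tailCount_add M u i (m + 1)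
  rw [surplus, surplus, add_assoc, h]
  push_cast
  zify
  constructor <;> intro h <;> nlinarith

section Reach

variable {K M : ℕ} {u : ℕ → ℕ}

theorem surplus_le_reach {i : ℕ}
    (h : ∃ m, m + 1 ≤ K * tailCount M (fun j => u (i + j)) (m + 1)) :
    surplus K M u i ≤ surplus K M u (i + reach K M (fun j => u (i + j)) + 1) :=
  (reach_condition_iff K M u i _).1 (Nat.sInf_mem
    (s := {m | m + 1 ≤ K * tailCount M (fun j => u (i + j)) (m + 1)}) h)

theorem surplus_lt_of_le_reach {i k : ℕ} (hik : i < k)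
    (hk : k ≤ i + reach K M (fun j => u (i + j))) : surplus K M u k < surplus K M u i := by
  obtain ⟨m, rfl⟩ : ∃ m, k = i + m + 1 := ⟨k - i - 1, by omega⟩
  by_contra! hle
  have := Nat.sInf_le (s := {m | m + 1 ≤ K * tailCount M (fun j => u (i + j)) (m + 1)})
    ((reach_condition_iff K M u i m).2 hle)
  unfold reach at hk
  omega

theorem surplus_le_of_le_reach {i k : ℕ} (hik : i ≤ k)
    (hk : k ≤ i + reach K M (fun j => u (i + j))) : surplus K M u k ≤ surplus K M u i := by
  rcases hik.eq_or_lt with rfl | hlt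
  · rfl
  · exact (surplus_lt_of_le_reach hlt hk).le

theorem le_apply_reach {i : ℕ}
    (h : ∃ m, m + 1 ≤ K * tailCount M (fun j => u (i + j)) (m + 1)) :
    M ≤ u (i + reach K M (fun j => u (i + j))) := by
  by_contra! hlt
  have h₁ := surplus_le_reach h
  have h₂ := surplus_succ_of_lt (K := K) hlt
  have h₃ := surplus_le_of_le_reach (K := K) (M := M) (u := u) (i := i)
    (Nat.le_add_right _ _) le_rfl
  omega

/-- At most `K` positions reach any given position. -/
theorem card_reach_fiber_le
    (h : ∀ i, ∃ m, m + 1 ≤ K * tailCount M (fun j => u (i + j)) (m + 1)) (s : Finset ℕ) (b : ℕ) :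
    (s.filter fun i => i + reach K M (fun j => u (i + j)) = b).card ≤ K := by
  have hcard : (Finset.Icc (surplus K M u b) (surplus K M u b + K - 1)).card = K := by
    rw [Int.card_Icc]
    omega
  refine (Finset.card_le_card_of_injOn (surplus K M u) ?_ ?_).trans_eq hcard
  · intro i hi
    obtain ⟨-, rfl⟩ := Finset.mem_filter.1 (Finset.mem_coe.1 hi)
    have h₁ := surplus_le_reach (h i)
    rw [surplus_succ_of_le (le_apply_reach (h i))] at h₁
    exact Finset.mem_coe.2
      (Finset.mem_Icc.2 ⟨surplus_le_of_le_reach (Nat.le_add_right _ _) le_rfl, h₁⟩)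
  · intro i hi k hk heq
    have hi' := (Finset.mem_filter.1 (Finset.mem_coe.1 hi)).2
    have hk' := (Finset.mem_filter.1 (Finset.mem_coe.1 hk)).2
    rcases lt_trichotomy i k with hlt | rfl | hlt
    · exact absurd heq (surplus_lt_of_le_reach (K := K) (M := M) (u := u) hlt (by omega)).ne'
    · rfl
    · exact absurd heq (surplus_lt_of_le_reach (K := K) (M := M) (u := u) hlt (by omega)).ne

/-- A small code comes from a nearby symbol which is large, but not too large. -/
theorem card_reachCode_lt_le
    (h : ∀ i, ∃ m, m + 1 ≤ K * tailCount M (fun j => u (i + j)) (m + 1)) (L N : ℕ) :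
    ((Finset.range N).filter fun i => reachCode K M (fun j => u (i + j)) < L).card ≤
      K * ((Finset.range (N + L)).filter fun j => u j ∈ Finset.Ico M (M + L)).card := by
  refine Finset.card_le_mul_card_image_of_maps_to
    (f := fun i => i + reach K M (fun j => u (i + j))) ?_ K
    fun b _ => card_reach_fiber_le h _ b
  intro i hi
  have hi := Finset.mem_filter.1 hi
  have hN := Finset.mem_range.1 hi.1
  have hL := hi.2
  have hM := le_apply_reach (h i)
  simp only [reachCode] at hL
  simp only [Finset.mem_filter, Finset.mem_range, Finset.mem_Ico]
  omega

theorem reachCode_of_le (hK : 0 < K) (hM : M ≤ u 0) : reachCode K M u = u 0 - M := by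
  have h0 : reach K M u = 0 := by
    refine Nat.sInf_eq_zero.2 (Or.inl ?_)
    simp only [Set.mem_ofPred_eq, tailCount_succ, hM, if_true]
    simp [tailCount]
    omega
  simp [reachCode, h0]

end Reach

theorem sum_symbolCount (u : ℕ → ℕ) (s : Finset ℕ) (N : ℕ) :
    ∑ n ∈ s, symbolCount u n N = ((Finset.range N).filter fun i => u i ∈ s).card := by
  rw [Finset.card_eq_sum_card_fiberwise (f := u) (t := s)]
  · refine Finset.sum_congr rfl fun n hn => ?_
    unfold symbolCount
    congr 1
    ext i
    simp only [Finset.mem_filter]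
    constructor
    · rintro ⟨h, rfl⟩
      exact ⟨⟨h, hn⟩, rfl⟩
    · rintro ⟨⟨h, -⟩, hu⟩
      exact ⟨h, hu⟩
  · intro i hi
    exact (Finset.mem_filter.1 (Finset.mem_coe.1 hi)).2

theorem tailCount_add_sum_symbolCount (u : ℕ → ℕ) (M N : ℕ) :
    tailCount M u N + ∑ n ∈ Finset.range M, symbolCount u n N = N := by
  rw [sum_symbolCount]
  have := Finset.card_filter_add_card_filter_not (s := Finset.range N) (fun i => M ≤ u i)
  simpa [tailCount] using this

section Frequencies

variable {K M : ℕ} {u : ℕ → ℕ} {σ : ℕ → ℝ}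

theorem tendsto_sum_symbolCount
    (hσ : ∀ n, Tendsto (fun N : ℕ => (symbolCount u n N : ℝ) / N) atTop (nhds (σ n)))
    (s : Finset ℕ) :
    Tendsto (fun N : ℕ => ((∑ n ∈ s, symbolCount u n N : ℕ) : ℝ) / N) atTop
      (nhds (∑ n ∈ s, σ n)) := by
  simp only [Nat.cast_sum, Finset.sum_div]
  exact tendsto_finsetSum _ fun n _ => hσ n

/-- If the symbols `≥ M` have density larger than `1 / K`, every position reaches some position. -/
theorem exists_reach
    (hσ : ∀ n, Tendsto (fun N : ℕ => (symbolCount u n N : ℝ) / N) atTop (nhds (σ n)))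
    (hK : 1 < K * (1 - ∑ n ∈ Finset.range M, σ n)) (i : ℕ) :
    ∃ m, m + 1 ≤ K * tailCount M (fun j => u (i + j)) (m + 1) := by
  have hlim : Tendsto (fun N : ℕ =>
      (K : ℝ) * (1 - ((∑ n ∈ Finset.range M, symbolCount u n N : ℕ) : ℝ) / N) - (K * i : ℕ) / N)
      atTop (nhds (K * (1 - ∑ n ∈ Finset.range M, σ n) - 0)) :=
    (((tendsto_sum_symbolCount hσ _).const_sub 1).const_mul _).sub
      (tendsto_const_div_atTop_nhds_zero_nat _)
  rw [sub_zero] at hlim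
  obtain ⟨N, hN, hiN⟩ :=
    ((hlim.eventually (lt_mem_nhds hK)).and (eventually_gt_atTop i)).exists
  have hN0 : (0 : ℝ) < N := by exact_mod_cast (Nat.zero_le i).trans_lt hiN
  have hcount := tailCount_add_sum_symbolCount u M N
  have hlt : N + K * i < K * tailCount M u N := by
    have hcount' : (tailCount M u N : ℝ) + (∑ n ∈ Finset.range M, symbolCount u n N : ℕ) = N := by
      exact_mod_cast hcount
    have heq : (K : ℝ) * (1 - ((∑ n ∈ Finset.range M, symbolCount u n N : ℕ) : ℝ) / N)
        - (K * i : ℕ) / N = ((K * tailCount M u N : ℝ) - (K * i : ℕ)) / N := by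
      rw [eq_sub_of_add_eq' hcount']
      field_simp
      ring
    rw [heq, lt_div_iff₀ hN0] at hN
    have : ((N + K * i : ℕ) : ℝ) < ((K * tailCount M u N : ℕ) : ℝ) := by
      push_cast at hN ⊢
      linarith
    exact_mod_cast this
  obtain ⟨m, rfl⟩ : ∃ m, N = i + (m + 1) := ⟨N - i - 1, by omega⟩
  refine ⟨m, ?_⟩
  rw [tailCount_add, mul_add] at hlt
  have := Nat.mul_le_mul_left K (tailCount_le M u i)
  omega

theorem symbolCount_le_symbolCount_reachCode (hK : 0 < K) (n N : ℕ) :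
    symbolCount u (n + M) N ≤ symbolCount (fun i => reachCode K M (fun j => u (i + j))) n N := by
  refine Finset.card_le_card fun i hi => ?_
  simp only [Finset.mem_filter] at hi ⊢
  refine ⟨hi.1, ?_⟩
  rw [reachCode_of_le hK (by simp [hi.2])]
  simp [hi.2]

/-- The frequencies of the codes have total mass at most `K` times that of the symbols `≥ M`. -/
theorem sum_freq_reachCode_le {τ : ℕ → ℝ} {c : ℝ}
    (hσ : ∀ n, Tendsto (fun N : ℕ => (symbolCount u n N : ℝ) / N) atTop (nhds (σ n)))
    (hσ0 : ∀ n, 0 ≤ σ n) (hc : HasSum σ c)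
    (hK : 1 < K * (1 - ∑ n ∈ Finset.range M, σ n))
    (hτ : ∀ n, Tendsto
      (fun N : ℕ => (symbolCount (fun i => reachCode K M (fun j => u (i + j))) n N : ℝ) / N)
      atTop (nhds (τ n))) (L : ℕ) :
    ∑ n ∈ Finset.range L, τ n ≤ K * (c - ∑ n ∈ Finset.range M, σ n) := by
  have hright : Tendsto (fun N : ℕ => (K : ℝ) *
      (((∑ n ∈ Finset.Ico M (M + L), symbolCount u n N : ℕ) : ℝ) / N + (L : ℝ) / N)) atTop
      (nhds (K * (∑ n ∈ Finset.Ico M (M + L), σ n + 0))) :=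
    ((tendsto_sum_symbolCount hσ _).add (tendsto_const_div_atTop_nhds_zero_nat _)).const_mul _
  have hle : ∑ n ∈ Finset.range L, τ n ≤ K * (∑ n ∈ Finset.Ico M (M + L), σ n + 0) := by
    refine le_of_tendsto_of_tendsto' (tendsto_sum_symbolCount hτ (Finset.range L)) hright ?_
    intro N
    rw [← add_div, ← mul_div_assoc]
    gcongr
    have h₁ := card_reachCode_lt_le (exists_reach hσ hK) L N
    have h₂ : ((Finset.range (N + L)).filter fun j => u j ∈ Finset.Ico M (M + L)).card ≤
        ((Finset.range N).filter fun j => u j ∈ Finset.Ico M (M + L)).card + L := by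
      rw [Finset.range_eq_Ico, ← Finset.Ico_union_Ico_eq_Ico (Nat.zero_le N)
        (Nat.le_add_right N L), Finset.filter_union, ← Finset.range_eq_Ico]
      refine (Finset.card_union_le _ _).trans (Nat.add_le_add_left ?_ _)
      exact (Finset.card_filter_le _ _).trans (by simp)
    have h₃ := h₁.trans (Nat.mul_le_mul_left K h₂)
    rw [sum_symbolCount, sum_symbolCount]
    simp only [Finset.mem_range]
    exact_mod_cast h₃
  refine hle.trans ?_
  rw [add_zero]
  gcongr
  rw [le_sub_iff_add_le', Finset.range_eq_Ico,
    Finset.sum_Ico_consecutive _ (Nat.zero_le M) (Nat.le_add_right M L)]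
  exact sum_le_hasSum _ (fun n _ => hσ0 n) hc

end Frequencies

theorem measurable_nat_sInf {α : Type*} [MeasurableSpace α] {p : α → ℕ → Prop}
    (hp : ∀ n, MeasurableSet {x | p x n}) : Measurable fun x => sInf {n | p x n} := by
  have hempty : MeasurableSet {x | ¬ ∃ n, p x n} := by
    simp only [Set.ofPred_exists, ← Set.compl_ofPred]
    exact (MeasurableSet.iUnion hp).compl
  have hex : ∀ x, ∃ n, p x n ∨ ¬ ∃ k, p x k := fun x => by
    by_cases h : ∃ n, p x n
    · exact h.imp fun _ => Or.inl
    · exact ⟨0, Or.inr h⟩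
  have heq : (fun x => sInf {n | p x n}) = fun x => Nat.find (hex x) := by
    funext x
    by_cases h : ∃ n, p x n
    · rw [Nat.sInf_def (s := {n | p x n}) h]
      refine Nat.find_congr' ?_
      intro n
      simp [h]
    · have : {n | p x n} = ∅ := by
        ext n
        simpa using fun hn => h ⟨n, hn⟩
      rw [this, Nat.sInf_empty, eq_comm, Nat.find_eq_zero]
      exact Or.inr h
  rw [heq]
  exact measurable_find hex fun n => (hp n).union hempty

theorem measurable_reachCode {α : Type*} [MeasurableSpace α] {K M : α → ℕ} {u : α → ℕ → ℕ}
    (hK : Measurable K) (hM : Measurable M) (hu : ∀ j, Measurable fun x => u x j) :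
    Measurable fun x => reachCode (K x) (M x) (u x) := by
  have htail : ∀ n, Measurable fun x => tailCount (M x) (u x) n := by
    intro n
    simp only [tailCount, Finset.card_filter]
    exact Finset.measurable_fun_sum _ fun j _ =>
      Measurable.ite (measurableSet_le hM (hu j)) measurable_const measurable_const
  have hreach : Measurable fun x => reach (K x) (M x) (u x) :=
    measurable_nat_sInf fun m => measurableSet_le measurable_const (hK.mul (htail (m + 1)))
  have happly : Measurable fun q : α × ℕ => u q.1 q.2 :=
    measurable_from_prod_countable_left fun j => hu j
  exact ((happly.comp (measurable_id.prodMk hreach)).sub hM).add hreach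

section Parameters

variable {Λ : Type*}

/-- The frequency `s(x,a)` of the symbol `a`. -/
noncomputable def symbolFreq (x : ℤ → Λ) (a : Λ) : ℝ := limUnder atTop (wordFreq x [a])

/-- The total mass `ρ(x)` of the symbol frequencies. -/
noncomputable def totalFreq (x : ℤ → Λ) : ℝ := (∑' a : Λ, ENNReal.ofReal (symbolFreq x a)).toReal

/-- A capacity `K` with `K (1 - ρ(x)) > 1`. -/
noncomputable def capacity (x : ℤ → Λ) : ℕ := ⌊(1 - totalFreq x)⁻¹⌋₊ + 1

/-- A threshold beyond which the symbols have total frequency less than `ε / capacity x`. -/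
noncomputable def threshold (e : Λ ≃ ℕ) (ε : ℝ) (x : ℤ → Λ) : ℕ :=
  sInf {M | capacity x *
    (totalFreq x - ∑ n ∈ Finset.range M, symbolFreq x (e.symm n)) < ε}

/-- Replace each symbol by the code of the large symbol that its position reaches. -/
noncomputable def increaseDefect (e : Λ ≃ ℕ) (ε : ℝ) (x : ℤ → Λ) : ℤ → Λ := fun i =>
  e.symm (reachCode (capacity x) (threshold e ε x) fun j : ℕ => e (x (i + j)))

theorem occursAt_singleton (x : ℤ → Λ) (a : Λ) (i : ℤ) : OccursAt x [a] i ↔ x i = a := by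
  simp [OccursAt]

theorem wordFreq_singleton (e : Λ ≃ ℕ) (x : ℤ → Λ) (n : ℕ) :
    wordFreq x [e.symm n] = fun N : ℕ => (symbolCount (fun i : ℕ => e (x i)) n N : ℝ) / N := by
  funext N
  simp [wordFreq, symbolCount, occursAt_singleton, Equiv.eq_symm_apply]

theorem tendsto_symbolFreq {x : ℤ → Λ} {a : Λ} (h : ∃ L, Tendsto (wordFreq x [a]) atTop (nhds L)) :
    Tendsto (wordFreq x [a]) atTop (nhds (symbolFreq x a)) :=
  tendsto_nhds_limUnder h

theorem wordFreq_singleton_shift (x : ℤ → Λ) (a : Λ) (N : ℕ) :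
    wordFreq (shift x) [a] N =
      wordFreq x [a] (N + 1) * ((N + 1 : ℕ) / N) - (if x 0 = a then 1 else 0) / N := by
  have hN : ((N + 1 : ℕ) : ℝ) ≠ 0 := by positivity
  simp only [wordFreq, occursAt_singleton]
  rw [div_mul_div_cancel₀ hN, ← sub_div, Finset.sum_range_succ']
  simp only [shift, Nat.cast_add, Nat.cast_one, Nat.cast_zero, add_sub_cancel_right]
  congr!

theorem tendsto_wordFreq_shift {x : ℤ → Λ} {a : Λ} {L : ℝ}
    (h : Tendsto (wordFreq x [a]) atTop (nhds L)) :
    Tendsto (wordFreq (shift x) [a]) atTop (nhds L) := by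
  have hratio : Tendsto (fun N : ℕ => ((N + 1 : ℕ) : ℝ) / N) atTop (nhds 1) := by
    have h1 : Tendsto (fun N : ℕ => 1 + (1 : ℝ) / N) atTop (nhds (1 + 0)) :=
      (tendsto_const_div_atTop_nhds_zero_nat 1).const_add 1
    rw [add_zero] at h1
    refine h1.congr' ?_
    filter_upwards [eventually_gt_atTop 0] with N hN
    have : (N : ℝ) ≠ 0 := by positivity
    push_cast
    field_simp
  have := ((h.comp (tendsto_add_atTop_nat 1)).mul hratio).sub
    (tendsto_const_div_atTop_nhds_zero_nat (if x 0 = a then (1 : ℝ) else 0))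
  rw [mul_one, sub_zero] at this
  exact this.congr fun N => (wordFreq_singleton_shift x a N).symm

section Deficient

variable {x : ℤ → Λ}

theorem DeficientSet.tendsto (hx : x ∈ DeficientSet Λ) (a : Λ) :
    Tendsto (wordFreq x [a]) atTop (nhds (symbolFreq x a)) :=
  tendsto_symbolFreq ((hx.1 a).imp fun _ h => h.2)

theorem DeficientSet.symbolFreq_pos (hx : x ∈ DeficientSet Λ) (a : Λ) : 0 < symbolFreq x a := by
  obtain ⟨L, hL, h⟩ := hx.1 a
  rwa [symbolFreq, h.limUnder_eq]

theorem DeficientSet.hasSum_totalFreq (hx : x ∈ DeficientSet Λ) :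
    HasSum (symbolFreq x) (totalFreq x) := by
  obtain ⟨c, hc, -⟩ := hx.2
  have hc : HasSum (symbolFreq x) c := hc
  have h0 := fun a => (DeficientSet.symbolFreq_pos hx a).le
  rwa [totalFreq, ← ENNReal.ofReal_tsum_of_nonneg h0 hc.summable, hc.tsum_eq,
    ENNReal.toReal_ofReal (hc.nonneg h0)]

theorem DeficientSet.totalFreq_lt_one (hx : x ∈ DeficientSet Λ) : totalFreq x < 1 := by
  obtain ⟨c, hc, h1⟩ := hx.2
  rwa [(DeficientSet.hasSum_totalFreq hx).unique hc]

theorem DeficientSet.one_lt_capacity_mul (hx : x ∈ DeficientSet Λ) :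
    1 < capacity x * (1 - totalFreq x) := by
  have h0 : 0 < 1 - totalFreq x := sub_pos.2 (DeficientSet.totalFreq_lt_one hx)
  have := Nat.lt_floor_add_one (1 - totalFreq x)⁻¹
  rw [inv_lt_iff_one_lt_mul₀ h0] at this
  simpa [capacity, mul_comm] using this

theorem DeficientSet.threshold_spec (hx : x ∈ DeficientSet Λ) (e : Λ ≃ ℕ) {ε : ℝ} (hε : 0 < ε) :
    capacity x * (totalFreq x - ∑ n ∈ Finset.range (threshold e ε x), symbolFreq x (e.symm n))
      < ε := by
  have hsum : HasSum (fun n => symbolFreq x (e.symm n)) (totalFreq x) :=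
    e.symm.hasSum_iff.2 (DeficientSet.hasSum_totalFreq hx)
  have hlim := (hsum.tendsto_sum_nat.const_sub (totalFreq x)).const_mul (capacity x : ℝ)
  rw [sub_self, mul_zero] at hlim
  exact Nat.sInf_mem (s := {M | capacity x *
    (totalFreq x - ∑ n ∈ Finset.range M, symbolFreq x (e.symm n)) < ε})
    (hlim.eventually (gt_mem_nhds hε)).exists

theorem DeficientSet.symbolFreq_shift (hx : x ∈ DeficientSet Λ) :
    symbolFreq (shift x) = symbolFreq x :=
  funext fun a => (tendsto_wordFreq_shift (DeficientSet.tendsto hx a)).limUnder_eq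

theorem DeficientSet.increaseDefect_shift (hx : x ∈ DeficientSet Λ) (e : Λ ≃ ℕ) (ε : ℝ) :
    increaseDefect e ε (shift x) = shift (increaseDefect e ε x) := by
  have h₁ := DeficientSet.symbolFreq_shift hx
  have h₂ : totalFreq (shift x) = totalFreq x := by simp only [totalFreq, h₁]
  have h₃ : capacity (shift x) = capacity x := by simp only [capacity, h₂]
  have h₄ : threshold e ε (shift x) = threshold e ε x := by simp only [threshold, h₁, h₂, h₃]
  funext i
  simp only [increaseDefect, shift, h₃, h₄, add_right_comm]

/-- If the symbol frequencies of the image exist, they are positive with total mass `< ε`. -/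
theorem DeficientSet.increaseDefect_freq (hx : x ∈ DeficientSet Λ) (e : Λ ≃ ℕ) {ε : ℝ} (hε : 0 < ε)
    (hreg : Regular (increaseDefect e ε x)) :
    (∀ a, 0 < symbolFreq (increaseDefect e ε x) a) ∧
      ∃ c, HasSum (symbolFreq (increaseDefect e ε x)) c ∧ c < ε := by
  have hσ : ∀ n, Tendsto (fun N : ℕ => (symbolCount (fun i : ℕ => e (x i)) n N : ℝ) / N) atTop
      (nhds (symbolFreq x (e.symm n))) := fun n => by
    rw [← wordFreq_singleton]
    exact DeficientSet.tendsto hx _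
  have hσ0 := fun n => DeficientSet.symbolFreq_pos hx (e.symm n)
  have hc : HasSum (fun n => symbolFreq x (e.symm n)) (totalFreq x) :=
    e.symm.hasSum_iff.2 (DeficientSet.hasSum_totalFreq hx)
  have hτ : ∀ n, Tendsto (fun N : ℕ => (symbolCount (fun i => reachCode (capacity x)
      (threshold e ε x) (fun j => (fun i : ℕ => e (x i)) (i + j))) n N : ℝ) / N)
      atTop (nhds (symbolFreq (increaseDefect e ε x) (e.symm n))) := fun n => by
    have h := tendsto_symbolFreq (hreg [e.symm n])
    rw [wordFreq_singleton] at h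
    simpa [increaseDefect] using h
  have hK : 1 < capacity x *
      (1 - ∑ n ∈ Finset.range (threshold e ε x), symbolFreq x (e.symm n)) := by
    refine (DeficientSet.one_lt_capacity_mul hx).trans_le ?_
    gcongr
    exact sum_le_hasSum _ (fun n _ => (hσ0 n).le) hc
  have hpos : ∀ n, 0 < symbolFreq (increaseDefect e ε x) (e.symm n) := fun n => by
    refine (hσ0 (n + threshold e ε x)).trans_le (le_of_tendsto_of_tendsto' (hσ _) (hτ n) ?_)
    intro N
    gcongr
    exact symbolCount_le_symbolCount_reachCode (Nat.succ_pos _) n N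
  have hbound := sum_freq_reachCode_le hσ (fun n => (hσ0 n).le) hc hK hτ
  have hsummable := summable_of_sum_range_le (fun n => (hpos n).le) hbound
  refine ⟨fun a => by simpa using hpos (e a), _, e.symm.hasSum_iff.1 hsummable.hasSum, ?_⟩
  exact (Real.tsum_le_of_sum_range_le (fun n => (hpos n).le) hbound).trans_lt
    (DeficientSet.threshold_spec hx e hε)

end Deficient

section Measurability

variable [Countable Λ] [MeasurableSpace Λ] [DiscreteMeasurableSpace Λ]

theorem measurable_symbolFreq (a : Λ) : Measurable fun x : ℤ → Λ => symbolFreq x a := by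
  refine (MeasureTheory.StronglyMeasurable.limUnder fun N =>
    (Measurable.div_const ?_ _).stronglyMeasurable).measurable
  refine Finset.measurable_fun_sum _ fun i _ =>
    Measurable.ite ?_ measurable_const measurable_const
  simp only [occursAt_singleton]
  exact measurableSet_eq_fun (measurable_pi_apply (i : ℤ)) measurable_const

theorem measurable_totalFreq : Measurable fun x : ℤ → Λ => totalFreq x :=
  (Measurable.tsum fun a => (measurable_symbolFreq a).ennreal_ofReal).ennreal_toReal

theorem measurable_capacity : Measurable fun x : ℤ → Λ => capacity x :=
  (Nat.measurable_floor.comp (measurable_totalFreq.const_sub 1).inv).add_const 1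

theorem measurable_threshold (e : Λ ≃ ℕ) (ε : ℝ) :
    Measurable fun x : ℤ → Λ => threshold e ε x := by
  refine measurable_nat_sInf fun M => measurableSet_lt ?_ measurable_const
  refine (measurable_from_nat.comp measurable_capacity).mul (measurable_totalFreq.sub ?_)
  exact Finset.measurable_fun_sum _ fun n _ => measurable_symbolFreq _

theorem measurable_increaseDefect (e : Λ ≃ ℕ) (ε : ℝ) :
    Measurable (increaseDefect e ε) := by
  refine measurable_pi_lambda _ fun i => measurable_from_nat.comp ?_
  exact measurable_reachCode measurable_capacity (measurable_threshold e ε) fun j =>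
    (Measurable.of_discrete (f := e)).comp (measurable_pi_apply _)

end Measurability

end Parameters

/-- **Increasing the defect.** For every `δ > 0` there is a factor map
`π_δ : Deficient(Λ^ℤ) → Λ^ℤ` whose image lies in `Deficient(Λ^ℤ) ∪ Divergent(Λ^ℤ)`, such
that if `x` is deficient and `π_δ(x)` is regular then `∑_{a∈Λ} s(π_δ(x),a) < δ`. -/
theorem increase_defect {Λ : Type*} [Countable Λ] [Infinite Λ]
    [MeasurableSpace Λ] [DiscreteMeasurableSpace Λ] (δ : ℝ) (hδ : 0 < δ) :
    ∃ π : (ℤ → Λ) → (ℤ → Λ),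
      Measurable π ∧
      (∀ x ∈ DeficientSet Λ, π (shift x) = shift (π x)) ∧
      (∀ x ∈ DeficientSet Λ, π x ∈ DeficientSet Λ ∪ DivergentSet Λ) ∧
      (∀ x ∈ DeficientSet Λ, Regular (π x) →
        ∃ c : ℝ, HasSum (fun a : Λ => limUnder atTop (wordFreq (π x) [a])) c ∧ c < δ) := by
  obtain ⟨e⟩ : Nonempty (Λ ≃ ℕ) := nonempty_equiv_of_countable
  have hε : 0 < min δ 1 := lt_min hδ one_pos
  refine ⟨increaseDefect e (min δ 1), measurable_increaseDefect e _,
    fun x hx => DeficientSet.increaseDefect_shift hx e _, fun x hx => ?_, fun x hx hreg => ?_⟩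
  · by_cases hreg : Regular (increaseDefect e (min δ 1) x)
    · obtain ⟨hpos, c, hc, hlt⟩ := DeficientSet.increaseDefect_freq hx e hε hreg
      exact Or.inl ⟨fun a => ⟨_, hpos a, tendsto_symbolFreq (hreg [a])⟩, c, hc,
        hlt.trans_le (min_le_right _ _)⟩
    · exact Or.inr hreg
  · obtain ⟨-, c, hc, hlt⟩ := DeficientSet.increaseDefect_freq hx e hε hreg
    exact ⟨c, hc, hlt.trans_le (min_le_left _ _)⟩
end

section
/- Let (X, 𝓑, T) be a Borel system and let α = {A_i}_{i∈ℕ} ⊆ 𝓑 be an ω-cover of X. Suppose that either (a) ∑_{i∈ℕ} s̄(x, A_i) < 1 for every x ∈ X, or (b) there is a partition ℕ = ⋃_{u=1}^∞ I_u such that for each u the sets {A_i}_{i∈I_u} are pairwise disjoint, and for every finite J ⊆ ℕ and every x ∈ X, ∑_u s̄*(x, ⋃_{i∈I_u∩J} A_i) < 1 − sup_{i∈ℕ} s̄*(x, A_i). Then there exists a Borel set B ∈ 𝓑 such that σ_T({B}) ∨ σ_T(α) = 𝓑. -/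
open Filter
open scoped Classical ENNReal

/-- The frequency of visits of the first `N` points of the forward orbit of `x` to `A`:
`S_N(x,A) = (1/N) · #{0 ≤ i < N : T^i x ∈ A}`. -/
noncomputable def visitFreq {X : Type*} (T : Equiv.Perm X) (A : Set X) (x : X) (N : ℕ) : ℝ :=
  (∑ i ∈ Finset.range N, if (T ^ i) x ∈ A then (1 : ℝ) else 0) / N

/-- The upper frequency `s̄(x,A) = limsup_N S_N(x,A)`. -/
noncomputable def upperFreq {X : Type*} (T : Equiv.Perm X) (A : Set X) (x : X) : ℝ :=
  limsup (visitFreq T A x) atTop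

/-- The upper uniform density of a set `I ⊆ ℤ`:
`limsup_{N→∞} sup_{n∈ℤ} (1/N)·|I ∩ [n, n+N−1]|`. -/
noncomputable def upperUniformDensity (I : Set ℤ) : ℝ :=
  limsup (fun N : ℕ =>
    ⨆ n : ℤ, (∑ i ∈ Finset.range N, if n + (i : ℤ) ∈ I then (1 : ℝ) else 0) / N) atTop

/-- The upper uniform frequency `s̄*(x,A) = s̄*({i ∈ ℤ : T^i x ∈ A})`. -/
noncomputable def upperUniformFreq {X : Type*} (T : Equiv.Perm X) (A : Set X) (x : X) : ℝ :=
  upperUniformDensity {i : ℤ | (T ^ i) x ∈ A}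

/-- `σ_T(α)`: the smallest `T`-invariant σ-algebra containing the family `α`, i.e. the
σ-algebra generated by `{T^n A : A ∈ α, n ∈ ℤ}`. -/
def sigmaT {X : Type*} (T : Equiv.Perm X) (α : Set (Set X)) : MeasurableSpace X :=
  MeasurableSpace.generateFrom {s : Set X | ∃ (n : ℤ) (A : Set X), A ∈ α ∧ s = ⇑(T ^ n) '' A}

theorem zpow_neg_apply_zpow {X : Type*} {T : Equiv.Perm X} (n : ℤ) (x : X) :
    (T ^ (-n)) ((T ^ n) x) = x := by
  rw [← Equiv.Perm.mul_apply, ← zpow_add, neg_add_cancel, zpow_zero, Equiv.Perm.one_apply]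

section Visits

variable {X : Type*} (T : Equiv.Perm X)

/-- The number of `0 ≤ k < N` with `T^k x ∈ A`. -/
noncomputable def visits (A : Set X) (x : X) (N : ℕ) : ℤ :=
  ∑ k ∈ Finset.range N, if (T ^ k) x ∈ A then 1 else 0

theorem visits_zero (A : Set X) (x : X) : visits T A x 0 = 0 := by
  simp [visits]

theorem visits_one (A : Set X) (x : X) : visits T A x 1 = if x ∈ A then 1 else 0 := by
  rw [visits, Finset.sum_range_one, pow_zero, Equiv.Perm.one_apply]

theorem visits_add (A : Set X) (x : X) (M N : ℕ) :
    visits T A x (M + N) = visits T A x M + visits T A ((T ^ M) x) N := by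
  simp only [visits, Finset.sum_range_add]
  congr 1
  refine Finset.sum_congr rfl fun k _ => ?_
  rw [add_comm M k, pow_add, Equiv.Perm.mul_apply]

theorem visits_succ (A : Set X) (x : X) (N : ℕ) :
    visits T A x (N + 1) = visits T A x N + if (T ^ N) x ∈ A then 1 else 0 := by
  rw [visits_add, visits_one]

theorem visits_succ' (A : Set X) (x : X) (N : ℕ) :
    visits T A x (N + 1) = (if x ∈ A then 1 else 0) + visits T A (T x) N := by
  rw [add_comm N 1, visits_add, visits_one, pow_one]

theorem visits_nonneg (A : Set X) (x : X) (N : ℕ) : 0 ≤ visits T A x N :=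
  Finset.sum_nonneg fun k _ => by split_ifs <;> simp

theorem visits_le (A : Set X) (x : X) (N : ℕ) : visits T A x N ≤ N := by
  induction N with
  | zero => simp [visits_zero]
  | succ N ih => rw [visits_succ]; push_cast; split_ifs <;> omega

theorem visits_compl (A : Set X) (x : X) (N : ℕ) : visits T Aᶜ x N = N - visits T A x N := by
  induction N with
  | zero => simp [visits_zero]
  | succ N ih =>
    rw [visits_succ, visits_succ, ih]
    by_cases h : (T ^ N) x ∈ A
    · simp [h]
    · simp [h]
      omega

theorem visits_union_le (A B : Set X) (x : X) (N : ℕ) :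
    visits T (A ∪ B) x N ≤ visits T A x N + visits T B x N := by
  rw [visits, visits, visits, ← Finset.sum_add_distrib]
  refine Finset.sum_le_sum fun k _ => ?_
  by_cases h : (T ^ k) x ∈ A <;> by_cases h' : (T ^ k) x ∈ B <;> simp [h, h']

theorem visits_eq_card (A : Set X) (x : X) (N : ℕ) :
    visits T A x N = ((Finset.range N).filter fun k => (T ^ k) x ∈ A).card := by
  simp [visits]

theorem visits_pow_le (A : Set X) (x : X) (m N : ℕ) :
    visits T A ((T ^ m) x) N ≤ visits T A x N + m := by
  have h1 := visits_add T A x m N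
  have h2 := visits_add T A x N m
  have h3 := visits_nonneg T A x m
  have h4 := visits_le T A ((T ^ N) x) m
  rw [add_comm N m] at h2
  omega

theorem visits_le_pow (A : Set X) (x : X) (m N : ℕ) :
    visits T A x N ≤ visits T A ((T ^ m) x) N + m := by
  have h1 := visits_add T A x m N
  have h2 := visits_add T A x N m
  have h3 := visits_nonneg T A ((T ^ N) x) m
  have h4 := visits_le T A x m
  rw [add_comm N m] at h2
  omega

theorem visits_zpow_le (A : Set X) (x : X) (m : ℤ) (N : ℕ) :
    visits T A ((T ^ m) x) N ≤ visits T A x N + |m| := by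
  obtain ⟨k, rfl | rfl⟩ := m.eq_nat_or_neg
  · simpa using visits_pow_le T A x k N
  · have h := visits_le_pow T A ((T ^ (-(k : ℤ))) x) k N
    rw [← Equiv.Perm.mul_apply, ← zpow_natCast, ← zpow_add] at h
    simpa using h

end Visits

section Matching

variable {X : Type*} (T : Equiv.Perm X)

/-- Reading points of `A` as opening and points of `F` as closing parentheses along the orbit,
the parenthesis opened at `x` is closed at `T^n x`. -/
def MatchedAt (A F : Set X) (n : ℕ) (x : X) : Prop :=
  x ∈ A ∧ (T ^ n) x ∈ F ∧ (∀ j, 0 < j → j ≤ n → visits T F x j < visits T A x j) ∧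
    visits T A x (n + 1) = visits T F x (n + 1)

/-- The parenthesis matching of points of `A` with points of `F` along forward orbits. -/
def Matched (A F : Set X) (x y : X) : Prop :=
  ∃ n : ℕ, MatchedAt T A F n x ∧ (T ^ n) x = y

variable {T} {A F : Set X}

theorem MatchedAt.unique {n n' : ℕ} {x : X} (h : MatchedAt T A F n x)
    (h' : MatchedAt T A F n' x) : n = n' := by
  rcases lt_trichotomy n n' with hlt | rfl | hlt
  · have := h'.2.2.1 (n + 1) (by omega) (by omega)
    have := h.2.2.2
    omega
  · rfl
  · have := h.2.2.1 (n' + 1) (by omega) (by omega)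
    have := h'.2.2.2
    omega

theorem Matched.right_unique {x y y' : X} (h : Matched T A F x y) (h' : Matched T A F x y') :
    y = y' := by
  obtain ⟨n, hn, rfl⟩ := h
  obtain ⟨n', hn', rfl⟩ := h'
  rw [hn.unique hn']

theorem Matched.left_unique {x x' y : X} (h : Matched T A F x y) (h' : Matched T A F x' y) :
    x = x' := by
  obtain ⟨n, hn, rfl⟩ := h
  obtain ⟨n', hn', he⟩ := h'
  wlog hle : n' ≤ n generalizing n n' x x'
  · exact (this n' hn' n hn he.symm (by omega)).symm
  obtain ⟨d, rfl⟩ := Nat.exists_eq_add_of_le hle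
  have hx : x' = (T ^ d) x := by
    rw [pow_add, Equiv.Perm.mul_apply] at he
    exact (T ^ n').injective he
  rcases Nat.eq_zero_or_pos d with rfl | hd
  · simpa using hx.symm
  · have h1 := visits_add T A x d (n' + 1)
    have h2 := visits_add T F x d (n' + 1)
    have h3 := hn.2.2.1 d hd (by omega)
    have h4 := hn.2.2.2
    have h5 := hn'.2.2.2
    rw [show n' + d + 1 = d + (n' + 1) by omega] at h4
    rw [← hx] at h1 h2
    omega

theorem Matched.left_mem {x y : X} (h : Matched T A F x y) : x ∈ A := by
  obtain ⟨n, hn, rfl⟩ := h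
  exact hn.1

theorem Matched.right_mem {x y : X} (h : Matched T A F x y) : y ∈ F := by
  obtain ⟨n, hn, rfl⟩ := h
  exact hn.2.1

theorem exists_matched {x : X} (hx : x ∈ A)
    (h : ∃ N, 0 < N ∧ visits T A x N ≤ visits T F x N) : ∃ y, Matched T A F x y := by
  have hpos := (Nat.find_spec h).1
  have hle := (Nat.find_spec h).2
  have hmin : ∀ j, 0 < j → j < Nat.find h → visits T F x j < visits T A x j := by
    intro j hj hlt
    have := Nat.find_min h hlt
    push Not at this
    exact this hj
  obtain ⟨n, hn⟩ := Nat.exists_eq_succ_of_ne_zero hpos.ne'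
  rw [hn] at hle hmin
  refine ⟨(T ^ n) x, n, ⟨hx, ?_⟩, rfl⟩
  simp only [Nat.succ_eq_add_one] at hle hmin
  have key : (T ^ n) x ∈ F ∧ visits T A x (n + 1) = visits T F x (n + 1) := by
    rcases Nat.eq_zero_or_pos n with rfl | hn0
    · simp only [zero_add, visits_one, hx, if_true] at hle ⊢
      by_cases hF : x ∈ F <;> simp_all
    · have := hmin n hn0 (by omega)
      rw [visits_succ, visits_succ] at hle ⊢
      by_cases hF : (T ^ n) x ∈ F <;> by_cases hA : (T ^ n) x ∈ A <;> simp [hF, hA] at hle ⊢ <;>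
        omega
  exact ⟨key.1, fun j hj hjn => hmin j hj (by omega), key.2⟩

/-- A point of `F` lying between two matched points is itself matched. -/
theorem MatchedAt.exists_matched_of_mem {n m : ℕ} {x : X} (h : MatchedAt T A F n x)
    (hmn : m ≤ n) (hF : (T ^ m) x ∈ F) : ∃ x', Matched T A F x' ((T ^ m) x) := by
  let P : ℕ → Prop := fun p =>
    visits T F ((T ^ p) x) (m - p + 1) ≤ visits T A ((T ^ p) x) (m - p + 1)
  have hP0 : P 0 := by
    simp only [P, pow_zero, Equiv.Perm.one_apply, Nat.sub_zero]
    rcases hmn.eq_or_lt with rfl | hlt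
    · exact h.2.2.2.ge
    · exact (h.2.2.1 _ (by omega) (by omega)).le
  obtain ⟨p, hpm, hPp, hmax⟩ : ∃ p, p ≤ m ∧ P p ∧ ∀ q, p < q → q ≤ m → ¬ P q :=
    ⟨Nat.findGreatest P m, Nat.findGreatest_le m, Nat.findGreatest_spec (Nat.zero_le m) hP0,
      fun q hq hqm => Nat.findGreatest_is_greatest hq hqm⟩
  obtain ⟨d, rfl⟩ := Nat.exists_eq_add_of_le hpm
  have hmax' : ∀ j, 0 < j → j ≤ d → visits T A ((T ^ j) ((T ^ p) x)) (d - j + 1) <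
      visits T F ((T ^ j) ((T ^ p) x)) (d - j + 1) := by
    intro j hj hjd
    have := hmax (p + j) (by omega) (by omega)
    simp only [P] at this
    rw [show p + d - (p + j) + 1 = d - j + 1 by omega, add_comm p j, pow_add,
      Equiv.Perm.mul_apply] at this
    omega
  simp only [P, Nat.add_sub_cancel_left] at hPp
  rw [add_comm p d, pow_add, Equiv.Perm.mul_apply] at hF ⊢
  generalize (T ^ p) x = w at *
  have key : w ∈ A ∧ visits T A w (d + 1) = visits T F w (d + 1) := by
    rcases Nat.eq_zero_or_pos d with rfl | hd
    · simp only [pow_zero, Equiv.Perm.one_apply] at hF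
      simp only [zero_add, visits_one, hF, if_true] at hPp ⊢
      by_cases hA : w ∈ A <;> simp_all
    · have := hmax' 1 one_pos hd
      rw [Nat.sub_add_cancel hd, pow_one] at this
      rw [visits_succ', visits_succ'] at hPp ⊢
      by_cases hF : w ∈ F <;> by_cases hA : w ∈ A <;> simp [hF, hA] at hPp ⊢ <;> omega
  refine ⟨w, d, ⟨key.1, hF, fun j hj hjd => ?_, key.2⟩, rfl⟩
  have h1 := visits_add T A w j (d - j + 1)
  have h2 := visits_add T F w j (d - j + 1)
  have h3 := hmax' j hj hjd
  rw [show j + (d - j + 1) = d + 1 by omega] at h1 h2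
  omega

/-- No matched pair straddles an unmatched point of `F`, so the matching does not increase the
number of visits counted from such a point. -/
theorem visits_range_matched_le {y : X} (hF : y ∈ F) (hy : ¬ ∃ x, Matched T A F x y) (N : ℕ) :
    visits T {z | ∃ x, Matched T A F x z} y N ≤ visits T A y N := by
  have hex : ∀ k, (T ^ k) y ∈ {z | ∃ x, Matched T A F x z} →
      ∃ p ≤ k, MatchedAt T A F (k - p) ((T ^ p) y) := by
    rintro k ⟨x, n, hn, hx⟩
    have hnk : n ≤ k := by
      by_contra hlt
      apply hy
      have hyx : (T ^ (n - k)) x = y := by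
        apply (T ^ k).injective
        rw [← Equiv.Perm.mul_apply, ← pow_add, Nat.add_sub_cancel' (by omega), hx]
      rw [← hyx]
      exact hn.exists_matched_of_mem (by omega) (by rwa [hyx])
    refine ⟨k - n, by omega, ?_⟩
    have hxy : (T ^ (k - n)) y = x := by
      apply (T ^ n).injective
      rw [← Equiv.Perm.mul_apply, ← pow_add, Nat.add_sub_cancel' hnk, hx]
    rwa [hxy, Nat.sub_sub_self hnk]
  rw [visits_eq_card, visits_eq_card]
  choose! p hpk hp using hex
  norm_cast
  refine Finset.card_le_card_of_injOn p (fun k hk => ?_) fun k hk k' hk' he => ?_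
  · simp only [Finset.coe_filter, Finset.mem_range, Set.mem_ofPred_eq] at hk ⊢
    exact ⟨(hpk k hk.2).trans_lt hk.1, (hp k hk.2).1⟩
  · simp only [Finset.coe_filter, Finset.mem_range, Set.mem_ofPred_eq] at hk hk'
    have h1 := hp k hk.2
    have h2 := hp k' hk'.2
    rw [← he] at h2
    have h3 := h1.unique h2
    have h4 := hpk k hk.2
    have h5 := hpk k' hk'.2
    omega

end Matching

section OrbitMeasurable

variable {X : Type*} [MeasurableSpace X] {T : Equiv.Perm X}

/-- The relation `R` relates points of the same orbit, the displacement being measurable: it is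
the union over `n ∈ ℤ` of the graphs of `T^n` restricted to measurable sets. -/
def OrbitMeasurable (T : Equiv.Perm X) (R : X → X → Prop) : Prop :=
  ∃ G : ℤ → Set X, (∀ n, MeasurableSet (G n)) ∧ ∀ x y, R x y ↔ ∃ n, x ∈ G n ∧ (T ^ n) x = y

namespace OrbitMeasurable

variable {R S : X → X → Prop}

theorem measurableSet_domain (hR : OrbitMeasurable T R) : MeasurableSet {x | ∃ y, R x y} := by
  obtain ⟨G, hGm, hG⟩ := hR
  have : {x | ∃ y, R x y} = ⋃ n, G n := by
    ext x
    simp [hG]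
  rw [this]
  exact .iUnion hGm

theorem symm (hT : ∀ n : ℤ, Measurable (T ^ n)) (hR : OrbitMeasurable T R) :
    OrbitMeasurable T fun x y => R y x := by
  obtain ⟨G, hGm, hG⟩ := hR
  refine ⟨fun n => (T ^ n) ⁻¹' G (-n), fun n => hT n (hGm _), fun x y => ?_⟩
  simp only [hG]
  constructor
  · rintro ⟨n, hn, rfl⟩
    exact ⟨-n, by rwa [Set.mem_preimage, zpow_neg_apply_zpow, neg_neg], zpow_neg_apply_zpow n y⟩
  · rintro ⟨n, hn, rfl⟩
    exact ⟨-n, hn, zpow_neg_apply_zpow n x⟩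

theorem comp (hT : ∀ n : ℤ, Measurable (T ^ n)) (hR : OrbitMeasurable T R)
    (hS : OrbitMeasurable T S) : OrbitMeasurable T fun x z => ∃ y, R x y ∧ S y z := by
  obtain ⟨G, hGm, hG⟩ := hR
  obtain ⟨H, hHm, hH⟩ := hS
  refine ⟨fun n => ⋃ k, G k ∩ (T ^ k) ⁻¹' H (n - k),
    fun n => .iUnion fun k => (hGm k).inter (hT k (hHm _)), fun x z => ?_⟩
  simp only [hG, hH, Set.mem_iUnion]
  constructor
  · rintro ⟨_, ⟨k, hk, rfl⟩, n, hn, rfl⟩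
    refine ⟨n + k, ⟨k, hk, ?_⟩, ?_⟩
    · simpa using hn
    · rw [zpow_add, Equiv.Perm.mul_apply]
  · rintro ⟨n, ⟨k, hk, hkn⟩, rfl⟩
    refine ⟨_, ⟨k, hk, rfl⟩, n - k, hkn, ?_⟩
    rw [← Equiv.Perm.mul_apply, ← zpow_add, sub_add_cancel]

theorem restrict (hR : OrbitMeasurable T R) {D : Set X} (hD : MeasurableSet D) :
    OrbitMeasurable T fun x y => x ∈ D ∧ R x y := by
  obtain ⟨G, hGm, hG⟩ := hR
  refine ⟨fun n => D ∩ G n, fun n => hD.inter (hGm n), fun x y => ?_⟩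
  simp only [hG, Set.mem_inter_iff, and_assoc, exists_and_left]

theorem iUnion {ι : Type*} [Countable ι] {R : ι → X → X → Prop}
    (hR : ∀ i, OrbitMeasurable T (R i)) : OrbitMeasurable T fun x y => ∃ i, R i x y := by
  choose G hGm hG using hR
  refine ⟨fun n => ⋃ i, G i n, fun n => .iUnion fun i => hGm i n, fun x y => ?_⟩
  simp only [hG, Set.mem_iUnion]
  constructor
  · rintro ⟨i, n, hn, rfl⟩
    exact ⟨n, ⟨i, hn⟩, rfl⟩
  · rintro ⟨n, ⟨i, hn⟩, rfl⟩
    exact ⟨i, n, hn, rfl⟩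

theorem or (hR : OrbitMeasurable T R) (hS : OrbitMeasurable T S) :
    OrbitMeasurable T fun x y => R x y ∨ S x y := by
  obtain ⟨G, hGm, hG⟩ := hR
  obtain ⟨H, hHm, hH⟩ := hS
  refine ⟨fun n => G n ∪ H n, fun n => (hGm n).union (hHm n), fun x y => ?_⟩
  simp only [hG, hH, Set.mem_union, or_and_right, exists_or]

theorem eq : OrbitMeasurable T fun x y => x = y := by
  refine ⟨fun n => if n = 0 then Set.univ else ∅, fun n => ?_, fun x y => ?_⟩
  · by_cases h : n = 0 <;> simp [h]
  · constructor
    · rintro rfl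
      exact ⟨0, by simp⟩
    · rintro ⟨n, hn, rfl⟩
      by_cases h : n = 0 <;> simp_all

end OrbitMeasurable

/-- The iterates of a relation. -/
def relIterate {X : Type*} (R : X → X → Prop) : ℕ → X → X → Prop
  | 0 => fun x y => x = y
  | k + 1 => fun x z => ∃ y, relIterate R k x y ∧ R y z

theorem OrbitMeasurable.relIterate (hT : ∀ n : ℤ, Measurable (T ^ n)) {R : X → X → Prop}
    (hR : OrbitMeasurable T R) (k : ℕ) : OrbitMeasurable T (relIterate R k) := by
  induction k with
  | zero => exact .eq
  | succ k ih => exact ih.comp hT hR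

theorem measurable_visits (hT : ∀ n : ℤ, Measurable (T ^ n)) {A : Set X} (hA : MeasurableSet A)
    (N : ℕ) : Measurable fun x => visits T A x N := by
  refine Finset.measurable_fun_sum _ fun k _ => ?_
  have : MeasurableSet {x | (T ^ k) x ∈ A} := hT k hA
  exact Measurable.ite this measurable_const measurable_const

theorem orbitMeasurable_matched (hT : ∀ n : ℤ, Measurable (T ^ n)) {A F : Set X}
    (hA : MeasurableSet A) (hF : MeasurableSet F) : OrbitMeasurable T (Matched T A F) := by
  have key : ∀ n : ℕ, MeasurableSet {x | MatchedAt T A F n x} := by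
    intro n
    have h1 : MeasurableSet {x | (T ^ n) x ∈ F} := hT n hF
    have h2 : ∀ j, MeasurableSet {x | visits T F x j < visits T A x j} := fun j =>
      measurableSet_lt (measurable_visits hT hF j) (measurable_visits hT hA j)
    have h3 : MeasurableSet {x | visits T A x (n + 1) = visits T F x (n + 1)} :=
      measurableSet_eq_fun (measurable_visits hT hA _) (measurable_visits hT hF _)
    have h4 : MeasurableSet {x | ∀ j, 0 < j → j ≤ n → visits T F x j < visits T A x j} := by
      simp only [Set.ofPred_forall]
      exact .iInter fun j => .iInter fun _ => .iInter fun _ => h2 j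
    exact hA.inter (h1.inter (h4.inter h3))
  refine ⟨fun n => ⋃ k : ℕ, {x | MatchedAt T A F k x ∧ (k : ℤ) = n},
    fun n => .iUnion fun k => (key k).inter (.const _), fun x y => ?_⟩
  simp only [Set.mem_iUnion]
  constructor
  · rintro ⟨k, hk, rfl⟩
    exact ⟨k, ⟨k, hk, rfl⟩, by simp⟩
  · rintro ⟨_, ⟨k, hk, rfl⟩, rfl⟩
    exact ⟨k, hk, by simp⟩

end OrbitMeasurable

section Slots

variable {X : Type*} (T : Equiv.Perm X) (α : ℕ → Set X)

/-- The set of points used when the sets `α 0, …, α (i - 1)` are successively matched with points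
not used before. -/
def occupied : ℕ → Set X
  | 0 => ∅
  | i + 1 => occupied i ∪ {y | ∃ x, Matched T (α i) (occupied i)ᶜ x y}

/-- The matching of `α i` uses all the points of the orbit of `x` not used before. -/
def Saturated (i : ℕ) (x : X) : Prop :=
  ∀ y, T.SameCycle x y → y ∈ (occupied T α i)ᶜ → ∃ w, Matched T (α i) (occupied T α i)ᶜ w y

variable {T α}

theorem Saturated.of_sameCycle {i : ℕ} {x y : X} (h : Saturated T α i x)
    (hxy : T.SameCycle x y) : Saturated T α i y :=
  fun z hz => h z (hxy.trans hz)

theorem occupied_mono : Monotone (occupied T α) :=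
  monotone_nat_of_le_succ fun _ => Set.subset_union_left

theorem Matched.sameCycle {A F : Set X} {x y : X} (h : Matched T A F x y) : T.SameCycle x y := by
  obtain ⟨n, -, hn⟩ := h
  exact ⟨n, by simpa using hn⟩

theorem exists_visits_occupied_le {i : ℕ} {x : X} (h : ∀ j < i, ¬ Saturated T α j x) :
    ∃ K : ℤ, ∀ N, visits T (occupied T α i) x N ≤
      ∑ j ∈ Finset.range i, visits T (α j) x N + K := by
  induction i with
  | zero => exact ⟨0, fun N => by simp [occupied, visits]⟩
  | succ i ih =>
    obtain ⟨K, hK⟩ := ih fun j hj => h j (by omega)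
    have hi := h i (by omega)
    simp only [Saturated, not_forall] at hi
    obtain ⟨_, ⟨m, rfl⟩, hF, hy⟩ := hi
    refine ⟨K + 2 * |m|, fun N => ?_⟩
    have h1 := visits_union_le T (occupied T α i)
      {y | ∃ x, Matched T (α i) (occupied T α i)ᶜ x y} x N
    have h2 := visits_range_matched_le hF hy N
    have h3 := visits_zpow_le T (α i) x m N
    have h4 := visits_zpow_le T {y | ∃ x, Matched T (α i) (occupied T α i)ᶜ x y}
      ((T ^ m) x) (-m) N
    rw [zpow_neg_apply_zpow, abs_neg] at h4
    rw [Finset.sum_range_succ, occupied]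
    linarith [hK N]

/-- Any finitely many of the sets leave room: up to an additive constant, the numbers of visits to
them sum to less than the length of some initial segment of the forward orbit. -/
def LeavesRoom (T : Equiv.Perm X) (α : ℕ → Set X) : Prop :=
  ∀ (x : X) (J : Finset ℕ) (K : ℤ), ∃ N : ℕ, 0 < N ∧ ∑ j ∈ J, visits T (α j) x N + K < N

theorem LeavesRoom.exists_visits_lt (hα : LeavesRoom T α) {i k : ℕ} (hik : i < k) {x : X}
    (h : ∀ j < i, ¬ Saturated T α j x) :
    ∃ N, 0 < N ∧ visits T (α i) x N < visits T (occupied T α i ∪ α k)ᶜ x N := by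
  obtain ⟨K, hK⟩ := exists_visits_occupied_le h
  obtain ⟨N, hN, hlt⟩ := hα x (insert k (Finset.range (i + 1))) K
  refine ⟨N, hN, ?_⟩
  rw [Finset.sum_insert (by simp; omega), Finset.sum_range_succ] at hlt
  rw [visits_compl]
  linarith [hK N, visits_union_le T (occupied T α i) (α k) x N]

theorem LeavesRoom.exists_matched_diff (hα : LeavesRoom T α) {i k : ℕ} (hik : i < k) {x : X}
    (h : ∀ j < i, ¬ Saturated T α j x) (hx : x ∈ α i) :
    ∃ y, Matched T (α i) (occupied T α i ∪ α k)ᶜ x y := by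
  obtain ⟨N, hN, hlt⟩ := hα.exists_visits_lt hik h
  exact exists_matched hx ⟨N, hN, hlt.le⟩

theorem visits_mono {A B : Set X} (hAB : A ⊆ B) (x : X) (N : ℕ) :
    visits T A x N ≤ visits T B x N := by
  refine Finset.sum_le_sum fun k _ => ?_
  split_ifs with h1 h2
  · exact le_rfl
  · exact absurd (hAB h1) h2
  · exact zero_le_one
  · exact le_rfl

theorem LeavesRoom.exists_matched (hα : LeavesRoom T α) {i : ℕ} {x : X}
    (h : ∀ j < i, ¬ Saturated T α j x) (hx : x ∈ α i) :
    ∃ y, Matched T (α i) (occupied T α i)ᶜ x y := by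
  obtain ⟨N, hN, hlt⟩ := hα.exists_visits_lt (Nat.lt_succ_self i) h
  exact _root_.exists_matched hx ⟨N, hN, hlt.le.trans
    (visits_mono (Set.compl_subset_compl.2 Set.subset_union_left) x N)⟩

theorem LeavesRoom.exists_free (hα : LeavesRoom T α) {i : ℕ} {x : X}
    (h : ∀ j < i, ¬ Saturated T α j x) : ∃ y, T.SameCycle x y ∧ y ∈ (occupied T α i)ᶜ := by
  obtain ⟨N, -, hlt⟩ := hα.exists_visits_lt (Nat.lt_succ_self i) h
  have hne := ((visits_nonneg T (α i) x N).trans_lt hlt).ne'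
  obtain ⟨k, -, hk⟩ := Finset.exists_ne_zero_of_sum_ne_zero hne
  have hk' : (T ^ k) x ∈ (occupied T α i ∪ α (i + 1))ᶜ := by
    by_contra hcon
    exact hk (if_neg hcon)
  exact ⟨(T ^ k) x, ⟨k, by simp⟩, fun hcon => hk' (Or.inl hcon)⟩

variable (T α)

/-- The set `α k`, with `k > i`, meets the points of the orbit of `x` not used by the first `i`
matchings. -/
def MeetsFree (i k : ℕ) (x : X) : Prop :=
  i < k ∧ ∃ y, T.SameCycle x y ∧ y ∈ (occupied T α i)ᶜ ∩ α k

/-- The first saturated matching on the orbit of `x` is the `i`-th one, and `k` is least such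
that `α k` meets the points not used before it. -/
def FirstSaturated (i k : ℕ) (x : X) : Prop :=
  Saturated T α i x ∧ (∀ j < i, ¬ Saturated T α j x) ∧ MeetsFree T α i k x ∧
    ∀ l < k, ¬ MeetsFree T α i l x

/-- On orbits saturated at `i`, an injection of the points not used by the first `i` matchings
into those lying outside of `α k`. -/
def compression (i k : ℕ) (z z' : X) : Prop :=
  ∃ x, Matched T (α i) (occupied T α i)ᶜ x z ∧ Matched T (α i) (occupied T α i ∪ α k)ᶜ x z'

/-- The places where the bits read at a point `x` are to be written. -/
def Slot (j : ℕ) (x z : X) : Prop :=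
  (x ∈ {x | ∀ i, ¬ Saturated T α i x} ∧ Matched T (α j) (occupied T α j)ᶜ x z) ∨
    ∃ p : ℕ × ℕ, x ∈ {x | FirstSaturated T α p.1 p.2 x} ∩ ((occupied T α p.1)ᶜ ∩ α p.2) ∧
      relIterate (compression T α p.1 p.2) j x z

variable {T α}

theorem MeetsFree.of_sameCycle {i k : ℕ} {x y : X} (h : MeetsFree T α i k x)
    (hxy : T.SameCycle x y) : MeetsFree T α i k y :=
  ⟨h.1, h.2.imp fun _ hz => ⟨hxy.symm.trans hz.1, hz.2⟩⟩

theorem FirstSaturated.of_sameCycle {i k : ℕ} {x y : X} (h : FirstSaturated T α i k x)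
    (hxy : T.SameCycle x y) : FirstSaturated T α i k y :=
  ⟨h.1.of_sameCycle hxy, fun j hj hs => h.2.1 j hj (hs.of_sameCycle hxy.symm),
    h.2.2.1.of_sameCycle hxy, fun l hl hs => h.2.2.2 l hl (hs.of_sameCycle hxy.symm)⟩

theorem FirstSaturated.unique {p q : ℕ × ℕ} {x : X} (hp : FirstSaturated T α p.1 p.2 x)
    (hq : FirstSaturated T α q.1 q.2 x) : p = q := by
  obtain ⟨i, k⟩ := p
  obtain ⟨i', k'⟩ := q
  obtain rfl : i = i' := by
    rcases lt_trichotomy i i' with h | h | h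
    · exact absurd hp.1 (hq.2.1 i h)
    · exact h
    · exact absurd hq.1 (hp.2.1 i' h)
  obtain rfl : k = k' := by
    rcases lt_trichotomy k k' with h | h | h
    · exact absurd hp.2.2.1 (hq.2.2.2 k h)
    · exact h
    · exact absurd hq.2.2.1 (hp.2.2.2 k' h)
  rfl

theorem compression_left_unique {i k : ℕ} {z w z' : X} (h : compression T α i k z z')
    (h' : compression T α i k w z') : z = w := by
  obtain ⟨x, hx, hx'⟩ := h
  obtain ⟨y, hy, hy'⟩ := h'
  obtain rfl := hx'.left_unique hy'
  exact hx.right_unique hy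

theorem relIterate_compression_left_unique {i k a b : ℕ} {q r z : X} (hq : q ∈ α k)
    (hr : r ∈ α k) (ha : relIterate (compression T α i k) a q z)
    (hb : relIterate (compression T α i k) b r z) : q = r ∧ a = b := by
  have hnot : ∀ {y z}, compression T α i k y z → z ∉ α k := by
    rintro y z ⟨x, -, hx⟩ hz
    exact hx.right_mem (Or.inr hz)
  induction a generalizing b z with
  | zero =>
    obtain rfl : q = z := ha
    cases b with
    | zero => exact ⟨Eq.symm hb, rfl⟩
    | succ b =>
      obtain ⟨y, -, hy⟩ := hb
      exact absurd hq (hnot hy)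
  | succ a ih =>
    obtain ⟨y, hay, hy⟩ := ha
    cases b with
    | zero =>
      obtain rfl : r = z := hb
      exact absurd hr (hnot hy)
    | succ b =>
      obtain ⟨y', hby', hy'⟩ := hb
      obtain rfl := compression_left_unique hy hy'
      obtain ⟨h1, h2⟩ := ih hay hby'
      exact ⟨h1, congrArg _ h2⟩

theorem FirstSaturated.exists_relIterate (hα : LeavesRoom T α) {i k : ℕ} {x : X}
    (h : FirstSaturated T α i k x) (hx : x ∈ (occupied T α i)ᶜ) (j : ℕ) :
    ∃ z, T.SameCycle x z ∧ z ∈ (occupied T α i)ᶜ ∧ relIterate (compression T α i k) j x z := by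
  induction j with
  | zero => exact ⟨x, .refl _ _, hx, rfl⟩
  | succ j ih =>
    obtain ⟨z, hxz, hz, hjz⟩ := ih
    obtain ⟨w, hw⟩ := h.1 z hxz hz
    have hxw := hxz.trans hw.sameCycle.symm
    obtain ⟨z', hz'⟩ := hα.exists_matched_diff h.2.2.1.1 (h.of_sameCycle hxw).2.1 hw.left_mem
    exact ⟨z', hxw.trans hz'.sameCycle, fun hcon => hz'.right_mem (Or.inl hcon),
      z, hjz, w, hw, hz'⟩

theorem exists_infinite_slot (hα : LeavesRoom T α) (hcover : ∀ x : X, {i | x ∈ α i}.Infinite)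
    (x : X) : ∃ m : ℤ, {j | ∃ z, Slot T α j ((T ^ m) x) z}.Infinite := by
  by_cases hgood : ∀ i, ¬ Saturated T α i x
  · refine ⟨0, (hcover x).mono fun j hj => ?_⟩
    obtain ⟨z, hz⟩ := hα.exists_matched (fun i _ => hgood i) hj
    exact ⟨z, Or.inl ⟨hgood, hz⟩⟩
  · simp only [not_forall, not_not] at hgood
    have hi := Nat.find_spec hgood
    have hmin : ∀ j < Nat.find hgood, ¬ Saturated T α j x := fun j hj => Nat.find_min hgood hj
    generalize Nat.find hgood = i at hi hmin
    have hk : ∃ k, MeetsFree T α i k x := by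
      obtain ⟨y, hxy, hy⟩ := hα.exists_free hmin
      obtain ⟨k, hk, hik⟩ := (hcover y).exists_gt i
      exact ⟨k, hik, y, hxy, hy, hk⟩
    have hfs : FirstSaturated T α i (Nat.find hk) x :=
      ⟨hi, hmin, Nat.find_spec hk, fun l hl => Nat.find_min hk hl⟩
    generalize Nat.find hk = k at hfs
    obtain ⟨-, y, hxy, hy, hyk⟩ := hfs.2.2.1
    obtain ⟨m, rfl⟩ := hxy
    have hfs' := hfs.of_sameCycle ⟨m, rfl⟩
    refine ⟨m, Set.infinite_univ.mono fun j _ => ?_⟩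
    obtain ⟨z, -, -, hz⟩ := hfs'.exists_relIterate hα hy j
    exact ⟨z, Or.inr ⟨(i, k), ⟨hfs', hy, hyk⟩, hz⟩⟩

theorem relIterate_compression_sameCycle {i k j : ℕ} {x z : X}
    (h : relIterate (compression T α i k) j x z) : T.SameCycle x z := by
  induction j generalizing z with
  | zero =>
    obtain rfl : x = z := h
    exact .refl _ _
  | succ j ih =>
    obtain ⟨y, hy, w, hw, hw'⟩ := h
    exact (ih hy).trans (hw.sameCycle.symm.trans hw'.sameCycle)

theorem Slot.sameCycle {j : ℕ} {x z : X} (h : Slot T α j x z) : T.SameCycle x z := by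
  obtain ⟨-, h⟩ | ⟨p, -, h⟩ := h
  · exact h.sameCycle
  · exact relIterate_compression_sameCycle h

theorem Slot.left_unique {j j' : ℕ} {x x' z : X} (h : Slot T α j x z) (h' : Slot T α j' x' z) :
    x = x' ∧ j = j' := by
  have hxx' := h.sameCycle.trans h'.sameCycle.symm
  obtain ⟨hg, h⟩ | ⟨p, ⟨hp, -, hxp⟩, h⟩ := h <;> obtain ⟨hg', h'⟩ | ⟨p', ⟨hp', -, hxp'⟩, h'⟩ := h'
  · have hlt : ∀ {a b : ℕ} {u v : X}, Matched T (α a) (occupied T α a)ᶜ u z →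
        Matched T (α b) (occupied T α b)ᶜ v z → ¬ a < b := fun {a b u v} hu hv hab =>
      hv.right_mem (occupied_mono (Nat.succ_le_of_lt hab) (Or.inr ⟨u, hu⟩))
    obtain rfl : j = j' := le_antisymm (not_lt.1 (hlt h' h)) (not_lt.1 (hlt h h'))
    exact ⟨h.left_unique h', rfl⟩
  · exact absurd (hp'.1.of_sameCycle hxx'.symm) (hg p'.1)
  · exact absurd (hp.1.of_sameCycle hxx') (hg' p.1)
  · obtain rfl := hp.unique (hp'.of_sameCycle hxx'.symm)
    exact relIterate_compression_left_unique hxp hxp' h h'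

section Measurability

variable [MeasurableSpace X]

theorem measurableSet_exists_sameCycle (hT : ∀ n : ℤ, Measurable (T ^ n)) {A : Set X}
    (hA : MeasurableSet A) : MeasurableSet {x | ∃ y, T.SameCycle x y ∧ y ∈ A} := by
  have : {x | ∃ y, T.SameCycle x y ∧ y ∈ A} = ⋃ n : ℤ, (T ^ n) ⁻¹' A := by
    ext x
    simp only [Set.mem_iUnion]
    constructor
    · rintro ⟨_, ⟨n, rfl⟩, hn⟩
      exact ⟨n, hn⟩
    · rintro ⟨n, hn⟩
      exact ⟨_, ⟨n, rfl⟩, hn⟩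
  rw [this]
  exact .iUnion fun n => hT n hA

theorem measurableSet_occupied (hT : ∀ n : ℤ, Measurable (T ^ n))
    (hα : ∀ i, MeasurableSet (α i)) (i : ℕ) : MeasurableSet (occupied T α i) := by
  induction i with
  | zero => exact .empty
  | succ i ih =>
    exact ih.union ((orbitMeasurable_matched hT (hα i) ih.compl).symm hT).measurableSet_domain

theorem measurableSet_saturated (hT : ∀ n : ℤ, Measurable (T ^ n))
    (hα : ∀ i, MeasurableSet (α i)) (i : ℕ) : MeasurableSet {x | Saturated T α i x} := by
  have hO := measurableSet_occupied hT hα i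
  have hM := ((orbitMeasurable_matched hT (hα i) hO.compl).symm hT).measurableSet_domain
  have : {x | Saturated T α i x} = {x | ∃ y, T.SameCycle x y ∧ y ∈ (occupied T α i)ᶜ ∩
      {y | ∃ w, Matched T (α i) (occupied T α i)ᶜ w y}ᶜ}ᶜ := by
    ext x
    change (∀ y, _ → _ → _) ↔ ¬ (∃ y, _ ∧ _ ∧ ¬ _)
    simp only [not_exists, not_and, not_not]
    rfl
  rw [this]
  exact (measurableSet_exists_sameCycle hT (hO.compl.inter hM.compl)).compl

theorem measurableSet_meetsFree (hT : ∀ n : ℤ, Measurable (T ^ n))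
    (hα : ∀ i, MeasurableSet (α i)) (i k : ℕ) : MeasurableSet {x | MeetsFree T α i k x} :=
  (MeasurableSet.const (i < k)).inter (measurableSet_exists_sameCycle hT
    ((measurableSet_occupied hT hα i).compl.inter (hα k)))

theorem measurableSet_firstSaturated (hT : ∀ n : ℤ, Measurable (T ^ n))
    (hα : ∀ i, MeasurableSet (α i)) (i k : ℕ) :
    MeasurableSet {x | FirstSaturated T α i k x} := by
  have h1 : MeasurableSet {x | ∀ j < i, ¬ Saturated T α j x} := by
    simp only [Set.ofPred_forall]
    exact .iInter fun j => .iInter fun _ => (measurableSet_saturated hT hα j).compl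
  have h2 : MeasurableSet {x | ∀ l < k, ¬ MeetsFree T α i l x} := by
    simp only [Set.ofPred_forall]
    exact .iInter fun l => .iInter fun _ => (measurableSet_meetsFree hT hα i l).compl
  exact (measurableSet_saturated hT hα i).inter
    (h1.inter ((measurableSet_meetsFree hT hα i k).inter h2))

theorem orbitMeasurable_slot (hT : ∀ n : ℤ, Measurable (T ^ n))
    (hα : ∀ i, MeasurableSet (α i)) (j : ℕ) : OrbitMeasurable T (Slot T α j) := by
  have hO := measurableSet_occupied hT hα
  have hgood : MeasurableSet {x | ∀ i, ¬ Saturated T α i x} := by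
    simp only [Set.ofPred_forall]
    exact .iInter fun i => (measurableSet_saturated hT hα i).compl
  refine ((orbitMeasurable_matched hT (hα j) (hO j).compl).restrict hgood).or
    (.iUnion fun p => OrbitMeasurable.restrict (.relIterate hT ?_ j)
      ((measurableSet_firstSaturated hT hα p.1 p.2).inter ((hO p.1).compl.inter (hα p.2))))
  exact ((orbitMeasurable_matched hT (hα p.1) (hO p.1).compl).symm hT).comp hT
    (orbitMeasurable_matched hT (hα p.1) ((hO p.1).union (hα p.2)).compl)

end Measurability

end Slots

section SigmaT

open scoped MeasureTheory

variable {X : Type*} {T : Equiv.Perm X}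

theorem image_zpow_eq_preimage (n : ℤ) (A : Set X) : (T ^ n) '' A = (T ^ (-n)) ⁻¹' A := by
  rw [Equiv.image_eq_preimage_symm, zpow_neg]
  rfl

theorem preimage_zpow_eq_image (n : ℤ) (A : Set X) : (T ^ n) ⁻¹' A = (T ^ (-n)) '' A := by
  rw [image_zpow_eq_preimage, neg_neg]

theorem measurableSet_sigmaT_preimage {α : Set (Set X)} {A : Set X} (hA : A ∈ α) (n : ℤ) :
    MeasurableSet[sigmaT T α] ((T ^ n) ⁻¹' A) :=
  MeasurableSpace.measurableSet_generateFrom ⟨-n, A, hA, preimage_zpow_eq_image n A⟩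

theorem measurable_zpow_sigmaT (α : Set (Set X)) (n : ℤ) :
    Measurable[sigmaT T α, sigmaT T α] ⇑(T ^ n) := by
  refine @measurable_generateFrom _ _ (sigmaT T α) _ _ ?_
  rintro _ ⟨k, A, hA, rfl⟩
  rw [image_zpow_eq_preimage, ← Set.preimage_comp, ← Equiv.Perm.coe_mul, ← zpow_add]
  exact measurableSet_sigmaT_preimage hA _

theorem sigmaT_le [MeasurableSpace X] (hT : ∀ n : ℤ, Measurable (T ^ n)) {α : Set (Set X)}
    (hα : ∀ A ∈ α, MeasurableSet A) : sigmaT T α ≤ ‹MeasurableSpace X› := by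
  refine MeasurableSpace.generateFrom_le ?_
  rintro _ ⟨k, A, hA, rfl⟩
  rw [image_zpow_eq_preimage]
  exact hT _ (hα A hA)

theorem measurable_zpow [MeasurableSpace X] (hT : Measurable T) (hTinv : Measurable T.symm)
    (n : ℤ) : Measurable (T ^ n) := by
  obtain ⟨k, rfl | rfl⟩ := n.eq_nat_or_neg
  · rw [zpow_natCast, Equiv.Perm.coe_pow]
    exact hT.iterate k
  · rw [zpow_neg, zpow_natCast, ← inv_pow, Equiv.Perm.coe_pow]
    exact hTinv.iterate k

theorem OrbitMeasurable.mono {R : X → X → Prop} {m m' : MeasurableSpace X} (hm : m ≤ m')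
    (hR : @OrbitMeasurable X m T R) :
    @OrbitMeasurable X m' T R :=
  hR.imp fun _ hG => ⟨fun n => hm _ (hG.1 n), hG.2⟩

theorem measurableSet_count_eq [MeasurableSpace X] {P : ℕ → X → Prop}
    (hP : ∀ i, MeasurableSet {x | P i x}) (j r : ℕ) :
    MeasurableSet {x | Nat.count (fun i => P i x) j = r} := by
  have : Measurable fun x => Nat.count (fun i => P i x) j := by
    induction j with
    | zero => simp [measurable_const]
    | succ j ih =>
      simp only [Nat.count_succ]
      exact ih.add (Measurable.ite (hP j) measurable_const measurable_const)
  exact this (measurableSet_singleton r)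

/-- If all points have, somewhere on their orbit, infinitely many places reserved for them in a
measurable way with respect to a `T`-invariant σ-algebra `m`, then `m` and the translates of a
single set generate the whole σ-algebra. -/
theorem exists_generator_of_slots {m : MeasurableSpace X} [mX : MeasurableSpace X]
    [MeasurableSpace.CountablyGenerated X] (hT : ∀ n : ℤ, Measurable (T ^ n)) (hm : m ≤ mX)
    (hTm : ∀ n : ℤ, Measurable[m, m] ⇑(T ^ n)) {R : ℕ → X → X → Prop}
    (hR : ∀ j, @OrbitMeasurable X m T (R j))
    (hinj : ∀ {j j' x x' z}, R j x z → R j' x' z → x = x' ∧ j = j')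
    (hinf : ∀ x, ∃ n : ℤ, {j | ∃ z, R j ((T ^ n) x) z}.Infinite) :
    ∃ B : Set X, MeasurableSet B ∧ mX ≤ sigmaT T {B} ⊔ m := by
  obtain ⟨e, he⟩ := exists_surjective_nat (ℤ × ℕ)
  let gen := MeasurableSpace.natGeneratingSequence X
  let C : ℕ → Set X := fun r => (T ^ (-(e r).1)) ⁻¹' gen (e r).2
  let rank : X → ℕ → ℕ := fun x j => Nat.count (fun i => ∃ z, R i x z) j
  have hrank : ∀ j r, MeasurableSet[m] {x | rank x j = r} := fun j r =>
    @measurableSet_count_eq X m _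
      (fun i => @OrbitMeasurable.measurableSet_domain X m T _ (hR i)) j r
  have hC : ∀ r, MeasurableSet (C r) := fun r =>
    hT _ (MeasurableSpace.measurableSet_natGeneratingSequence _)
  let B : Set X := {z | ∃ j x, R j x z ∧ x ∈ C (rank x j)}
  have hB : MeasurableSet B := by
    have : B = ⋃ (j : ℕ) (r : ℕ), {z | ∃ x, x ∈ {x | rank x j = r} ∩ C r ∧ R j x z} := by
      ext z
      simp only [Set.mem_iUnion]
      constructor
      · rintro ⟨j, x, hx, hxC⟩
        exact ⟨j, rank x j, x, ⟨rfl, hxC⟩, hx⟩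
      · rintro ⟨j, _, x, ⟨rfl, hxC⟩, hx⟩
        exact ⟨j, x, hx, hxC⟩
    rw [this]
    exact .iUnion fun j => .iUnion fun r => ((((hR j).mono hm).restrict
      ((hm _ (hrank j r)).inter (hC r))).symm hT).measurableSet_domain
  have hBiff : ∀ {j x z}, R j x z → (z ∈ B ↔ x ∈ C (rank x j)) := by
    intro j x z h
    refine ⟨?_, fun hx => ⟨j, x, h, hx⟩⟩
    rintro ⟨j', x', h', hx'⟩
    obtain ⟨rfl, rfl⟩ := hinj h h'
    exact hx'
  refine ⟨B, hB, ?_⟩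
  choose G hGm hG using hR
  have hgen : ∀ k, gen k = ⋃ (r : ℕ) (_ : (e r).2 = k) (j : ℕ) (n : ℤ),
      (T ^ (e r).1) ⁻¹' (G j n ∩ {x | rank x j = r}) ∩ (T ^ (n + (e r).1)) ⁻¹' B := by
    intro k
    ext x
    simp only [Set.mem_iUnion]
    constructor
    · intro hx
      obtain ⟨l, hl⟩ := hinf x
      obtain ⟨r, hr⟩ := he (l, k)
      let j := Nat.nth (fun i => ∃ z, R i ((T ^ l) x) z) r
      have hj : rank ((T ^ l) x) j = r := Nat.count_nth_of_infinite hl r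
      obtain ⟨z, hz⟩ : ∃ z, R j ((T ^ l) x) z := Nat.nth_mem_of_infinite hl r
      obtain ⟨n, hn, rfl⟩ := (hG _ _ _).1 hz
      refine ⟨r, by rw [hr], j, n, ⟨?_, ?_⟩, ?_⟩
      · rwa [hr]
      · rwa [hr]
      · rw [Set.mem_preimage, hr, zpow_add, Equiv.Perm.mul_apply, hBiff hz, hj]
        simpa only [C, hr, Set.mem_preimage, zpow_neg_apply_zpow] using hx
    · rintro ⟨r, rfl, j, n, ⟨hn, hj⟩, hxB⟩
      rw [Set.mem_preimage, zpow_add, Equiv.Perm.mul_apply,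
        hBiff ((hG _ _ _).2 ⟨n, hn, rfl⟩), show rank _ j = r from hj] at hxB
      simpa only [C, Set.mem_preimage, zpow_neg_apply_zpow] using hxB
  rw [← MeasurableSpace.generateFrom_natGeneratingSequence X]
  refine MeasurableSpace.generateFrom_le ?_
  rintro _ ⟨k, rfl⟩
  change MeasurableSet[sigmaT T {B} ⊔ m] (gen k)
  rw [hgen k]
  refine .iUnion fun r => .iUnion fun _ => .iUnion fun j => .iUnion fun n => .inter ?_ ?_
  · exact (le_sup_right : m ≤ sigmaT T {B} ⊔ m) _ (hTm _ (.inter (hGm j n) (hrank j r)))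
  · exact (le_sup_left : sigmaT T {B} ≤ sigmaT T {B} ⊔ m) _
      (measurableSet_sigmaT_preimage (Set.mem_singleton B) _)

end SigmaT

section Frequencies

variable {X : Type*} {T : Equiv.Perm X}

theorem visitFreq_eq (A : Set X) (x : X) (N : ℕ) :
    visitFreq T A x N = (visits T A x N : ℝ) / N := by
  simp only [visitFreq, visits]
  push_cast
  rfl

theorem visitFreq_mem_Icc (A : Set X) (x : X) (N : ℕ) : visitFreq T A x N ∈ Set.Icc (0 : ℝ) 1 := by
  rw [visitFreq_eq]
  have h0 : (0 : ℝ) ≤ visits T A x N := by exact_mod_cast visits_nonneg T A x N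
  have h1 : (visits T A x N : ℝ) ≤ N := by exact_mod_cast visits_le T A x N
  exact ⟨by positivity, div_le_one_of_le₀ h1 (by positivity)⟩

theorem exists_visits_le_of_eventually {A : Set X} {x : X} {d : ℝ} (hd : 0 ≤ d)
    (h : ∀ᶠ N in atTop, visitFreq T A x N < d) :
    ∃ K : ℝ, ∀ N : ℕ, (visits T A x N : ℝ) ≤ d * N + K := by
  obtain ⟨M, hM⟩ := eventually_atTop.1 h
  refine ⟨M, fun N => ?_⟩
  have hdN : 0 ≤ d * N := by positivity
  rcases le_total M N with hMN | hNM
  · have := hM N hMN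
    rw [visitFreq_eq] at this
    rcases N.eq_zero_or_pos with rfl | hN
    · simp [visits_zero]
    · rw [div_lt_iff₀ (by positivity)] at this
      have : (0 : ℝ) ≤ M := by positivity
      linarith
  · have h1 : (visits T A x N : ℝ) ≤ N := by exact_mod_cast visits_le T A x N
    have h2 : (N : ℝ) ≤ M := by exact_mod_cast hNM
    linarith

theorem exists_visits_le_of_upperFreq_lt {A : Set X} {x : X} {d : ℝ} (hd : 0 ≤ d)
    (h : upperFreq T A x < d) : ∃ K : ℝ, ∀ N : ℕ, (visits T A x N : ℝ) ≤ d * N + K :=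
  exists_visits_le_of_eventually hd
    (eventually_lt_of_limsup_lt h (isBoundedUnder_of ⟨1, fun N => (visitFreq_mem_Icc A x N).2⟩))

theorem sum_mem_div_mem_Icc (I : Set ℤ) (n : ℤ) (N : ℕ) :
    (∑ i ∈ Finset.range N, if n + (i : ℤ) ∈ I then (1 : ℝ) else 0) / N ∈ Set.Icc (0 : ℝ) 1 := by
  have h0 : (0 : ℝ) ≤ ∑ i ∈ Finset.range N, if n + (i : ℤ) ∈ I then (1 : ℝ) else 0 :=
    Finset.sum_nonneg fun i _ => by split_ifs <;> simp
  have h1 : (∑ i ∈ Finset.range N, if n + (i : ℤ) ∈ I then (1 : ℝ) else 0) ≤ N := by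
    refine (Finset.sum_le_sum (g := fun _ => (1 : ℝ)) fun i _ => ?_).trans_eq (by simp)
    split_ifs <;> simp
  exact ⟨by positivity, div_le_one_of_le₀ h1 (by positivity)⟩

theorem bddAbove_sum_mem_div (I : Set ℤ) (N : ℕ) : BddAbove (Set.range fun n : ℤ =>
    (∑ i ∈ Finset.range N, if n + (i : ℤ) ∈ I then (1 : ℝ) else 0) / N) := by
  refine ⟨1, ?_⟩
  rintro _ ⟨n, rfl⟩
  exact (sum_mem_div_mem_Icc I n N).2

theorem upperUniformDensity_nonneg (I : Set ℤ) : 0 ≤ upperUniformDensity I := by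
  refine le_limsup_of_frequently_le (Frequently.of_forall fun N =>
    Real.iSup_nonneg fun n => (sum_mem_div_mem_Icc I n N).1)
    (isBoundedUnder_of ⟨1, fun N => ciSup_le fun n => (sum_mem_div_mem_Icc I n N).2⟩)

theorem exists_visits_le_of_upperUniformFreq_lt {A : Set X} {x : X} {d : ℝ} (hd : 0 ≤ d)
    (h : upperUniformFreq T A x < d) :
    ∃ K : ℝ, ∀ N : ℕ, (visits T A x N : ℝ) ≤ d * N + K := by
  have hbdd := bddAbove_sum_mem_div {i : ℤ | (T ^ i) x ∈ A}
  have hev := eventually_lt_of_limsup_lt h (isBoundedUnder_of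
    ⟨1, fun N => ciSup_le fun n => (sum_mem_div_mem_Icc {i : ℤ | (T ^ i) x ∈ A} n N).2⟩)
  refine exists_visits_le_of_eventually hd (hev.mono fun N hN => lt_of_le_of_lt ?_ hN)
  refine le_of_eq_of_le ?_ (le_ciSup (hbdd N) 0)
  simp only [visitFreq, zero_add, Set.mem_ofPred_eq, zpow_natCast]

/-- Finitely many counting functions with asymptotic slopes summing to less than one have a sum
that eventually stays below the identity by any prescribed amount. -/
theorem exists_sum_add_lt {ι : Type*} (J : Finset ι) (s : ι → ℝ) (f : ι → ℕ → ℤ)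
    (hs : ∑ j ∈ J, ENNReal.ofReal (s j) < 1)
    (hf : ∀ j ∈ J, ∀ d : ℝ, 0 ≤ d → s j < d → ∃ K : ℝ, ∀ N : ℕ, (f j N : ℝ) ≤ d * N + K)
    (K : ℤ) : ∃ N : ℕ, 0 < N ∧ ∑ j ∈ J, f j N + K < N := by
  have hsum : ∑ j ∈ J, max (s j) 0 < 1 := by
    have h1 : ∑ j ∈ J, ENNReal.ofReal (s j) = ENNReal.ofReal (∑ j ∈ J, max (s j) 0) := by
      rw [ENNReal.ofReal_sum_of_nonneg fun _ _ => le_max_right _ _]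
      refine Finset.sum_congr rfl fun j _ => ?_
      rw [ENNReal.ofReal_max]
      simp
    rw [h1, ← ENNReal.ofReal_one, ENNReal.ofReal_lt_ofReal_iff one_pos] at hs
    exact hs
  set c := ∑ j ∈ J, max (s j) 0
  obtain ⟨δ, hδ, hδc⟩ : ∃ δ : ℝ, 0 < δ ∧ c + J.card * δ < 1 := by
    refine ⟨(1 - c) / (J.card + 1), div_pos (by linarith) (by positivity), ?_⟩
    have : (J.card : ℝ) * ((1 - c) / (J.card + 1)) < 1 - c := by
      rw [mul_div_assoc', div_lt_iff₀ (by positivity)]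
      nlinarith
    linarith
  have hf' : ∀ j, ∃ K : ℝ, j ∈ J → ∀ N : ℕ, (f j N : ℝ) ≤ (max (s j) 0 + δ) * N + K := by
    intro j
    by_cases hj : j ∈ J
    · obtain ⟨K, hK⟩ := hf j hj (max (s j) 0 + δ) (by positivity)
        ((le_max_left _ _).trans_lt (by linarith))
      exact ⟨K, fun _ => hK⟩
    · exact ⟨0, fun h => absurd h hj⟩
  choose k hk using hf'
  obtain ⟨N, hN⟩ := exists_nat_gt ((∑ j ∈ J, k j + K) / (1 - (c + J.card * δ)))
  refine ⟨N + 1, N.succ_pos, ?_⟩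
  rw [div_lt_iff₀ (by linarith)] at hN
  have hle : (∑ j ∈ J, (f j (N + 1) : ℝ)) ≤ (c + J.card * δ) * (N + 1) + ∑ j ∈ J, k j := by
    refine (Finset.sum_le_sum fun j hj => hk j hj (N + 1)).trans_eq ?_
    rw [Finset.sum_add_distrib, ← Finset.sum_mul, Finset.sum_add_distrib]
    simp [c]
  have : (∑ j ∈ J, (f j (N + 1) : ℝ)) + K < (N + 1 : ℕ) := by
    push_cast
    nlinarith
  exact_mod_cast this

theorem leavesRoom_of_tsum_upperFreq_lt {α : ℕ → Set X}
    (h : ∀ x, ∑' i, ENNReal.ofReal (upperFreq T (α i) x) < 1) : LeavesRoom T α := fun x J =>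
  exists_sum_add_lt J (fun j => upperFreq T (α j) x) (fun j => visits T (α j) x)
    ((ENNReal.sum_le_tsum J).trans_lt (h x))
    fun _ _ _ hd hlt => exists_visits_le_of_upperFreq_lt hd hlt

theorem visits_biUnion (J : Finset ℕ) {α : ℕ → Set X}
    (hJ : ∀ i ∈ J, ∀ j ∈ J, i ≠ j → Disjoint (α i) (α j)) (x : X) (N : ℕ) :
    visits T (⋃ i ∈ J, α i) x N = ∑ i ∈ J, visits T (α i) x N := by
  simp only [visits]
  rw [Finset.sum_comm]
  refine Finset.sum_congr rfl fun k _ => ?_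
  by_cases h : ∃ i ∈ J, (T ^ k) x ∈ α i
  · obtain ⟨i, hi, hx⟩ := h
    rw [Finset.sum_eq_single_of_mem i hi fun j hj hji => if_neg fun hxj =>
      Set.disjoint_left.1 (hJ j hj i hi hji) hxj hx, if_pos hx, if_pos]
    simp only [Set.mem_iUnion]
    exact ⟨i, hi, hx⟩
  · rw [if_neg (by simpa using h), Finset.sum_eq_zero]
    exact fun i hi => if_neg fun hx => h ⟨i, hi, hx⟩

theorem leavesRoom_of_tsum_upperUniformFreq_lt {α : ℕ → Set X} {I : ℕ → Set ℕ}
    (hI : Pairwise fun u v => Disjoint (I u) (I v)) (hcov : (⋃ u, I u) = Set.univ)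
    (hdisj : ∀ u, ∀ i ∈ I u, ∀ j ∈ I u, i ≠ j → Disjoint (α i) (α j))
    (h : ∀ (J : Finset ℕ) (x : X),
      ∑' u, ENNReal.ofReal (upperUniformFreq T (⋃ i ∈ I u ∩ (J : Set ℕ), α i) x) < 1) :
    LeavesRoom T α := by
  intro x J K
  have hex : ∀ i, ∃ u, i ∈ I u := fun i => by
    simpa using Set.eq_univ_iff_forall.1 hcov i
  choose g hg using hex
  have hgu : ∀ {i u}, i ∈ I u ↔ g i = u := by
    refine fun {i u} => ⟨fun hi => ?_, fun hi => hi ▸ hg i⟩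
    by_contra hne
    exact Set.disjoint_left.1 (hI hne) (hg i) hi
  obtain ⟨N, hN, hlt⟩ := exists_sum_add_lt (J.image g)
    (fun u => upperUniformFreq T (⋃ i ∈ I u ∩ (J : Set ℕ), α i) x)
    (fun u => visits T (⋃ i ∈ I u ∩ (J : Set ℕ), α i) x)
    ((ENNReal.sum_le_tsum _).trans_lt (h J x))
    (fun _ _ _ hd hlt => exists_visits_le_of_upperUniformFreq_lt hd hlt) K
  refine ⟨N, hN, ?_⟩
  convert hlt using 2
  rw [← Finset.sum_fiberwise_of_maps_to (fun i hi => Finset.mem_image_of_mem g hi)]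
  refine Finset.sum_congr rfl fun u _ => ?_
  have hset : (⋃ i ∈ I u ∩ (J : Set ℕ), α i) = ⋃ i ∈ J.filter (fun i => g i = u), α i := by
    ext z
    simp [hgu, and_comm]
  rw [hset, visits_biUnion]
  simp only [Finset.mem_filter, ← hgu]
  exact fun i hi j hj hij => hdisj u i hi.2 j hj.2 hij

end Frequencies

/-- **General strategy.** Let `(X,𝓑,T)` be a Borel system and `α = {A_i}_{i∈ℕ} ⊆ 𝓑` an
ω-cover of `X` satisfying condition (a) or (b). Then there exists a Borel set `B` such that
`σ_T({B}) ∨ σ_T(α) = 𝓑`. -/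
theorem general_strategy {X : Type*} [MeasurableSpace X] [StandardBorelSpace X]
    (T : Equiv.Perm X) (hT : Measurable T) (hTinv : Measurable T.symm)
    (α : ℕ → Set X) (hαm : ∀ i, MeasurableSet (α i))
    (hcover : ∀ x : X, {i : ℕ | x ∈ α i}.Infinite)
    (hcond :
      -- (a) the upper frequencies sum to less than one at every point, or
      (∀ x : X, ∑' i : ℕ, ENNReal.ofReal (upperFreq T (α i) x) < 1) ∨
      -- (b) a partition of the index set into groups on which the sets are disjoint, with
      -- uniformly summable uniform upper frequencies
      (∃ I : ℕ → Set ℕ,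
        (Pairwise fun u v => Disjoint (I u) (I v)) ∧ (⋃ u, I u) = Set.univ ∧
        (∀ u : ℕ, ∀ i ∈ I u, ∀ j ∈ I u, i ≠ j → Disjoint (α i) (α j)) ∧
        (∀ (J : Finset ℕ) (x : X),
          ∑' u : ℕ, ENNReal.ofReal
              (upperUniformFreq T (⋃ i ∈ I u ∩ (J : Set ℕ), α i) x)
            < ENNReal.ofReal (1 - ⨆ i : ℕ, upperUniformFreq T (α i) x)))) :
    ∃ B : Set X, MeasurableSet B ∧
      sigmaT T {B} ⊔ sigmaT T (Set.range α) = ‹MeasurableSpace X› := by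
  have hTn := measurable_zpow hT hTinv
  have hle : sigmaT T (Set.range α) ≤ ‹MeasurableSpace X› :=
    sigmaT_le hTn (by rintro _ ⟨i, rfl⟩; exact hαm i)
  have hα : LeavesRoom T α := by
    obtain h | ⟨I, hI, hcov, hdisj, h⟩ := hcond
    · exact leavesRoom_of_tsum_upperFreq_lt h
    · refine leavesRoom_of_tsum_upperUniformFreq_lt hI hcov hdisj fun J x => (h J x).trans_le ?_
      rw [← ENNReal.ofReal_one]
      refine ENNReal.ofReal_le_ofReal (sub_le_self _ (Real.iSup_nonneg fun i => ?_))
      exact upperUniformDensity_nonneg _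
  have hTm := measurable_zpow_sigmaT (T := T) (Set.range α)
  have hαm' : ∀ i, @MeasurableSet X (sigmaT T (Set.range α)) (α i) := fun i =>
    measurableSet_sigmaT_preimage (T := T) (Set.mem_range_self i) 0
  obtain ⟨B, hB, hgen⟩ := exists_generator_of_slots hTn hle hTm
    (@orbitMeasurable_slot X T α (sigmaT T (Set.range α)) hTm hαm') Slot.left_unique
    (exists_infinite_slot hα hcover)
  refine ⟨B, hB, le_antisymm (sup_le (sigmaT_le hTn ?_) hle) hgen⟩
  rintro _ rfl
  exact hB
end
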